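/- Let q be a prime power of characteristic p and let F_1,…,F_m ∈ F_q[t][x] with deg_x F_i > 0 be pairwise non-associate, irreducible, and separable over F_q(t) (not necessarily monic in x). Set F = ∏_{i=1}^m F_i. Let n be a natural number, a_0,…,a_n algebraically independent variables, f♯ = Σ_{j=0}^n a_j t^j, and N_i = deg_t F_i(t, f♯). Let L be the splitting field of F(t, f♯) over F_q(a_0,…,a_n), G = Gal(L/F_q(a_0,…,a_n)) its Galois group viewed as a subgroup of S_{N_1}×…×S_{N_m} via its action on the roots of the F_i(t, f♯), let F_{q^ν} be the algebraic closure of F_q in L, and let G_1 ⊆ G be the coset of elements acting as the q-power Frobenius on F_{q^ν}. Then there is a constant C depending only on m, deg F_1,…,deg F_m and n such that for every conjugacy class K of S_{N_1}×…×S_{N_m}: |#{f ∈ F_q[t] : deg f = n, Θ(F_1(t,f),…,F_m(t,f)) = K} − (#(K ∩ G_1)/#G_1)·q^{n+1}| ≤ C·q^{n+1/2}. -/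

import Mathlib

open Polynomial

/-- The generic polynomial `f♯ = Σ_{j=0}^n a_j t^j`. -/
noncomputable def fsharp (K : Type) [CommRing K] (n : ℕ) :
    Polynomial (MvPolynomial (Fin (n + 1)) K) :=
  ∑ j : Fin (n + 1), Polynomial.C (MvPolynomial.X j) * Polynomial.X ^ (j : ℕ)

/-- For `F ∈ K[t][x]` (with `x` the outer variable), the substitution
`F(t, f♯) ∈ K[a_0,…,a_n][t]`. -/
noncomputable def substF {K : Type} [CommRing K] (n : ℕ)
    (F : Polynomial (Polynomial K)) :
    Polynomial (MvPolynomial (Fin (n + 1)) K) :=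
  Polynomial.eval (fsharp K n) (F.map (Polynomial.mapRingHom MvPolynomial.C))

/-- The total degree of a polynomial `P ∈ K[t][x]` (with `x` the outer variable). -/
noncomputable def totalDeg {K : Type} [Field K] (P : Polynomial (Polynomial K)) : ℕ :=
  (Finset.range (P.natDegree + 1)).sup fun j => j + (P.coeff j).natDegree

set_option linter.unusedSectionVars false

namespace FCE

/-- A multiplicative filtration on a commutative ring. -/
structure IsFil {R : Type*} [CommRing R] (Fil : ℕ → AddSubgroup R) : Prop where
  mono : ∀ {a b : ℕ}, a ≤ b → Fil a ≤ Fil b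
  one_mem : (1 : R) ∈ Fil 0
  mul_mem : ∀ {a b : ℕ} {x y : R}, x ∈ Fil a → y ∈ Fil b → x * y ∈ Fil (a + b)

/-- Coefficient growth condition for power series. -/
def PB {R : Type*} [CommRing R] (Fil : ℕ → AddSubgroup R) (c k : ℕ) (p : PowerSeries R) : Prop :=
  ∀ e, PowerSeries.coeff e p ∈ Fil (c * e + k)

section PB
variable {R : Type*} [CommRing R] {Fil : ℕ → AddSubgroup R} 

theorem IsFil.pow_mem (hF : IsFil Fil) {a : ℕ} {x : R} (hx : x ∈ Fil a) (j : ℕ) : x ^ j ∈ Fil (a * j) := by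
  induction j with
  | zero => simpa using hF.one_mem
  | succ j ih => rw [pow_succ, Nat.mul_succ]; exact hF.mul_mem ih hx

theorem PB.mono (hF : IsFil Fil) {c k k' : ℕ} {p : PowerSeries R} (h : PB Fil c k p) (hk : k ≤ k') :
    PB Fil c k' p := fun e => hF.mono (by omega) (h e)

theorem PB.zero (hF : IsFil Fil) {c k : ℕ} : PB Fil c k 0 := fun e => by simp [(Fil _).zero_mem]

theorem PB.add (hF : IsFil Fil) {c k : ℕ} {p p' : PowerSeries R} (h : PB Fil c k p) (h' : PB Fil c k p') :
    PB Fil c k (p + p') := fun e => by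
  rw [map_add]; exact (Fil _).add_mem (h e) (h' e)

theorem PB.neg (hF : IsFil Fil) {c k : ℕ} {p : PowerSeries R} (h : PB Fil c k p) :
    PB Fil c k (-p) := fun e => by
  rw [map_neg]; exact (Fil _).neg_mem (h e)

theorem PB.sum (hF : IsFil Fil) {ι : Type*} {c k : ℕ} (s : Finset ι) {p : ι → PowerSeries R}
    (h : ∀ i ∈ s, PB Fil c k (p i)) : PB Fil c k (∑ i ∈ s, p i) := fun e => by
  rw [map_sum]; exact (Fil _).sum_mem fun i hi => h i hi e

theorem PB.mul (hF : IsFil Fil) {c k k' : ℕ} {p p' : PowerSeries R} (h : PB Fil c k p) (h' : PB Fil c k' p') :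
    PB Fil c (k + k') (p * p') := fun e => by
  rw [PowerSeries.coeff_mul]
  refine (Fil _).sum_mem fun x hx => ?_
  have := Finset.HasAntidiagonal.mem_antidiagonal.1 hx
  have h1 := hF.mul_mem (h x.1) (h' x.2)
  have e1 : c * x.1 + k + (c * x.2 + k') = c * e + (k + k') := by rw [← this]; ring
  rwa [e1] at h1

theorem PB.C_mem (hF : IsFil Fil) {c k : ℕ} {x : R} (hx : x ∈ Fil k) : PB Fil c k (PowerSeries.C x) := fun e => by
  rw [PowerSeries.coeff_C]
  split_ifs
  · exact hF.mono (by omega) hx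
  · exact (Fil _).zero_mem

theorem PB.pow (hF : IsFil Fil) {c k : ℕ} {p : PowerSeries R} (h : PB Fil c k p) (j : ℕ) :
    PB Fil c (k * j) (p ^ j) := by
  induction j with
  | zero =>
    rw [pow_zero, mul_zero, ← map_one (PowerSeries.C (R := R))]
    exact PB.C_mem hF hF.one_mem
  | succ j ih => rw [pow_succ, Nat.mul_succ]; exact PB.mul hF ih h

theorem PB.X_pow_mul (hF : IsFil Fil) {c k k' i : ℕ} {p : PowerSeries R} (h : PB Fil c k p) (hk : k ≤ c * i + k') :
    PB Fil c k' (PowerSeries.X ^ i * p) := fun e => by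
  rw [PowerSeries.coeff_X_pow_mul']
  split_ifs with hie
  · refine hF.mono ?_ (h (e - i))
    obtain ⟨t, rfl⟩ := Nat.exists_eq_add_of_le hie
    rw [Nat.add_sub_cancel_left, mul_add]; omega
  · exact (Fil _).zero_mem

end PB

/-- Contractive fixed points in power series rings. -/
theorem exists_fixed {R : Type*} [CommRing R] (Φ : PowerSeries R → PowerSeries R)
    (hΦ : ∀ e p p', (PowerSeries.X : PowerSeries R) ^ e ∣ p - p' →
      (PowerSeries.X : PowerSeries R) ^ (e + 1) ∣ Φ p - Φ p')
    (P : ℕ → R → Prop) (hP : ∀ p, (∀ e, P e (PowerSeries.coeff e p)) →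
      ∀ e, P e (PowerSeries.coeff e (Φ p))) (h0 : ∀ e, P e 0) :
    ∃ p, Φ p = p ∧ ∀ e, P e (PowerSeries.coeff e p) := by
  let u : ℕ → PowerSeries R := fun n => Φ^[n] 0
  have hu : ∀ n, u (n + 1) = Φ (u n) := fun n => Function.iterate_succ_apply' Φ n 0
  have hPu : ∀ n, ∀ e, P e (PowerSeries.coeff e (u n)) := by
    intro n
    induction n with
    | zero => intro e; simpa [u] using h0 e
    | succ n ih => rw [hu]; exact hP _ ih
  have hstep : ∀ n, (PowerSeries.X : PowerSeries R) ^ n ∣ u (n + 1) - u n := by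
    intro n
    induction n with
    | zero => simp
    | succ n ih => rw [hu (n + 1), hu n]; exact hΦ _ _ _ (by rwa [hu] at ih)
  have hst : ∀ n k, (PowerSeries.X : PowerSeries R) ^ n ∣ u (n + k) - u n := by
    intro n k
    induction k with
    | zero => simp
    | succ k ih =>
      have := dvd_add ((pow_dvd_pow _ (Nat.le_add_right n k)).trans (hstep (n + k))) ih
      rwa [sub_add_sub_cancel] at this
  let p : PowerSeries R := PowerSeries.mk fun e => PowerSeries.coeff e (u (e + 1))
  have hp : ∀ n, (PowerSeries.X : PowerSeries R) ^ n ∣ p - u n := by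
    intro n
    rw [PowerSeries.X_pow_dvd_iff]
    intro e he
    obtain ⟨k, rfl⟩ := Nat.exists_eq_add_of_le (Nat.succ_le_of_lt he)
    have := (PowerSeries.X_pow_dvd_iff.1 (hst (e + 1) k)) e (Nat.lt_succ_self e)
    rw [map_sub] at this ⊢
    rw [PowerSeries.coeff_mk, ← neg_sub, neg_eq_zero]
    exact this
  refine ⟨p, ?_, fun e => ?_⟩
  · rw [← sub_eq_zero]
    ext e
    have h1 := hΦ _ _ _ (hp (e + 1))
    have h2 := hp (e + 1 + 1)
    rw [hu] at h2
    have h3 := dvd_sub h1 h2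
    have h4 := PowerSeries.X_pow_dvd_iff.1 h3 e (by omega)
    simp only [map_sub, map_zero] at h4 ⊢
    linear_combination h4
  · simp only [p, PowerSeries.coeff_mk]; exact hPu _ _

theorem hensel_core {R : Type*} [CommRing R] {Fil : ℕ → AddSubgroup R} (hF : IsFil Fil)
    (d I J : ℕ) (b : ℕ → ℕ → R) (hI : 1 ≤ I) (hJ : 2 ≤ J) (h00 : b 0 0 = 0) (h01 : b 0 1 = 1)
    (hb : ∀ i j, 1 ≤ i + j → (i, j) ≠ (0, 1) → b i j ∈ Fil (d * (2 * i + j - 1))) :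
    ∃ p : PowerSeries R, PB Fil (2 * d) d p ∧
      ∑ i ∈ Finset.range I, ∑ j ∈ Finset.range J,
        PowerSeries.C (b i j) * PowerSeries.X ^ i * (PowerSeries.X * p) ^ j = 0 := by
  classical
  let S : Finset (ℕ × ℕ) := ((Finset.range I ×ˢ Finset.range J).erase (0, 0)).erase (0, 1)
  have hS : ∀ x ∈ S, 1 ≤ x.1 + x.2 ∧ (x.1, x.2) ≠ (0, 1) := by
    rintro ⟨i, j⟩ hx
    simp only [S, Finset.mem_erase, ne_eq, Prod.mk.injEq, Finset.mem_product] at hx ⊢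
    omega
  let Φ : PowerSeries R → PowerSeries R := fun p =>
    -∑ x ∈ S, PowerSeries.C (b x.1 x.2) * (PowerSeries.X ^ (x.1 + x.2 - 1) * p ^ x.2)
  obtain ⟨p, hp, hPB⟩ := exists_fixed Φ (by
      intro e p p' h
      have : Φ p - Φ p' = -∑ x ∈ S, PowerSeries.C (b x.1 x.2) *
          (PowerSeries.X ^ (x.1 + x.2 - 1) * (p ^ x.2 - p' ^ x.2)) := by
        simp only [Φ, mul_sub, Finset.sum_sub_distrib]; ring
      rw [this, dvd_neg]
      refine Finset.dvd_sum fun x hx => ?_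
      obtain ⟨h1, h2⟩ := hS x hx
      refine Dvd.dvd.mul_left ?_ _
      obtain ⟨i, j⟩ := x
      by_cases hj : j = 0
      · simp [hj]
      · have : 1 ≤ i + j - 1 := by
          simp only [ne_eq, Prod.mk.injEq] at h2 h1
          omega
        rw [pow_succ']
        exact mul_dvd_mul (dvd_pow_self _ (by simp only; omega))
          (h.trans (sub_dvd_pow_sub_pow _ _ _)))
    (fun e r => r ∈ Fil (2 * d * e + d)) (by
      intro p hp
      change PB Fil (2 * d) d (Φ p)
      refine PB.neg hF (PB.sum hF _ fun x hx => ?_)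
      obtain ⟨h1, h2⟩ := hS x hx
      rw [mul_left_comm]
      refine PB.X_pow_mul hF (PB.mul hF (PB.C_mem hF (hb _ _ h1 h2)) (PB.pow hF (k := d) hp x.2)) ?_
      obtain ⟨t, ht⟩ := Nat.exists_eq_add_of_le h1
      have e1 : 2 * x.1 + x.2 - 1 + x.2 = 2 * (x.1 + x.2 - 1) + 1 := by omega
      calc d * (2 * x.1 + x.2 - 1) + d * x.2 = d * (2 * x.1 + x.2 - 1 + x.2) := by ring
        _ = d * (2 * (x.1 + x.2 - 1) + 1) := by rw [e1]
        _ ≤ 2 * d * (x.1 + x.2 - 1) + d := by ring_nf; exact le_rfl)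
    (fun e => (Fil _).zero_mem)
  refine ⟨p, hPB, ?_⟩
  rw [← Finset.sum_product']
  have m00 : ((0, 0) : ℕ × ℕ) ∈ Finset.range I ×ˢ Finset.range J := by simp; omega
  have m01 : ((0, 1) : ℕ × ℕ) ∈ (Finset.range I ×ˢ Finset.range J).erase (0, 0) := by simp; omega
  rw [← Finset.add_sum_erase _ _ m00, ← Finset.add_sum_erase _ _ m01]
  change _ + (_ + ∑ x ∈ S, _) = 0
  have : ∑ x ∈ S, PowerSeries.C (b x.1 x.2) * PowerSeries.X ^ x.1 * (PowerSeries.X * p) ^ x.2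
      = PowerSeries.X * -Φ p := by
    simp only [Φ, neg_neg, Finset.mul_sum]
    refine Finset.sum_congr rfl fun x hx => ?_
    obtain ⟨t, ht⟩ := Nat.exists_eq_add_of_le (hS x hx).1
    have e2 : x.1 + x.2 - 1 = t := by omega
    have e3 : (PowerSeries.X : PowerSeries R) ^ x.1 * PowerSeries.X ^ x.2 =
      PowerSeries.X * PowerSeries.X ^ t := by rw [← pow_add, ht]; ring
    rw [e2, mul_pow]
    linear_combination PowerSeries.C (b x.1 x.2) * p ^ x.2 * e3
  rw [this, hp, h00, h01]
  simp

end FCE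

namespace FCE

section Q
variable {𝕜 : Type*} [Field 𝕜] (f : 𝕜[X][X])

/-- the coordinate `s` -/
noncomputable def sQ : AdjoinRoot f := AdjoinRoot.of f X
/-- the coordinate `θ` -/
noncomputable def tQ : AdjoinRoot f := AdjoinRoot.root f

noncomputable def FilQ (D n : ℕ) : Submodule 𝕜 (AdjoinRoot f) :=
  Submodule.span 𝕜 {x | ∃ i j : ℕ, i + D * j ≤ n ∧ sQ f ^ i * tQ f ^ j = x}

noncomputable def famQ (n : ℕ) (x : Fin n × Fin f.natDegree) : AdjoinRoot f :=
  sQ f ^ (x.1 : ℕ) * tQ f ^ (x.2 : ℕ)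

noncomputable def VQ (n : ℕ) : Submodule 𝕜 (AdjoinRoot f) :=
  Submodule.span 𝕜 (Set.range (famQ f n))

variable {f}

theorem mon_mem_FilQ {D i j n : ℕ} (h : i + D * j ≤ n) : sQ f ^ i * tQ f ^ j ∈ FilQ f D n :=
  Submodule.subset_span ⟨i, j, h, rfl⟩

theorem FilQ_mono {D a b : ℕ} (h : a ≤ b) : FilQ f D a ≤ FilQ f D b :=
  Submodule.span_mono fun _ ⟨i, j, hij, hx⟩ => ⟨i, j, hij.trans h, hx⟩

theorem FilQ_mul {D a b : ℕ} {x y : AdjoinRoot f} (hx : x ∈ FilQ f D a) (hy : y ∈ FilQ f D b) :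
    x * y ∈ FilQ f D (a + b) := by
  have h1 : x * y ∈ FilQ f D a * FilQ f D b := Submodule.mul_mem_mul hx hy
  rw [FilQ, FilQ, Submodule.span_mul_span] at h1
  refine Submodule.span_le.2 ?_ h1
  rintro _ ⟨_, ⟨i, j, h, rfl⟩, _, ⟨i', j', h', rfl⟩, rfl⟩
  have : sQ f ^ i * tQ f ^ j * (sQ f ^ i' * tQ f ^ j') = sQ f ^ (i + i') * tQ f ^ (j + j') := by
    ring
  simp only [this]
  exact mon_mem_FilQ (by rw [mul_add]; omega)

theorem one_mem_FilQ {D : ℕ} : (1 : AdjoinRoot f) ∈ FilQ f D 0 := by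
  simpa using mon_mem_FilQ (f := f) (D := D) (i := 0) (j := 0) (n := 0) (by simp)

theorem isFil_FilQ (D : ℕ) : IsFil (fun n => (FilQ f D n).toAddSubgroup) where
  mono h := FilQ_mono h
  one_mem := one_mem_FilQ
  mul_mem := FilQ_mul

theorem mk_C_C (c : 𝕜) : AdjoinRoot.mk f (C (C c)) = algebraMap 𝕜 (AdjoinRoot f) c := rfl

theorem of_eq_aeval (p : 𝕜[X]) : AdjoinRoot.of f p = aeval (sQ f) p := by
  have : (AdjoinRoot.ofAlgHom 𝕜 f).comp (AlgHom.id 𝕜 _) = aeval (sQ f) := by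
    ext; simp [sQ]
  exact congrArg (fun g => g p) this

theorem of_eq_sum (p : 𝕜[X]) {D : ℕ} (h : p.natDegree ≤ D) :
    AdjoinRoot.of f p = ∑ i ∈ Finset.range (D + 1), p.coeff i • sQ f ^ i := by
  rw [of_eq_aeval, aeval_eq_sum_range' (Nat.lt_succ_of_le h)]

theorem mk_mem_FilQ {D a b : ℕ} (G : 𝕜[X][X]) (ha : ∀ j, (G.coeff j).natDegree ≤ a)
    (hb : G.natDegree ≤ b) : AdjoinRoot.mk f G ∈ FilQ f D (a + D * b) := by
  rw [G.as_sum_range' (b + 1) (by omega), map_sum]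
  refine Submodule.sum_mem _ fun j hj => ?_
  rw [← C_mul_X_pow_eq_monomial, map_mul, map_pow, AdjoinRoot.mk_C, of_eq_sum _ (ha j),
    Finset.sum_mul]
  refine Submodule.sum_mem _ fun i hi => ?_
  rw [smul_mul_assoc]
  refine Submodule.smul_mem _ _ (mon_mem_FilQ ?_)
  simp only [Finset.mem_range] at hi hj
  have : D * j ≤ D * b := Nat.mul_le_mul_left _ (by omega)
  omega

theorem VQ_le_FilQ (D n : ℕ) : VQ f n ≤ FilQ f D (n + D * f.natDegree) := by
  refine Submodule.span_le.2 ?_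
  rintro _ ⟨⟨i, j⟩, rfl⟩
  refine mon_mem_FilQ ?_
  have : D * (j : ℕ) ≤ D * f.natDegree := Nat.mul_le_mul_left _ j.2.le
  have := i.2
  simp only
  omega

theorem VQ_mono {a b : ℕ} (h : a ≤ b) : VQ f a ≤ VQ f b := by
  refine Submodule.span_mono ?_
  rintro _ ⟨⟨i, j⟩, rfl⟩
  exact ⟨(⟨i, i.2.trans_le h⟩, j), rfl⟩

theorem FilQ_le_VQ (hf : f.Monic) {D : ℕ} (hD : ∀ j, (f.coeff j).natDegree ≤ D) (n : ℕ) :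
    FilQ f D n ≤ VQ f (n + 1) := by
  have key : ∀ j i, i + D * j ≤ n → sQ f ^ i * tQ f ^ j ∈ VQ f (n + 1) := by
    intro j
    induction j using Nat.strong_induction_on with
    | _ j ih =>
      intro i hij
      by_cases hj : j < f.natDegree
      · exact Submodule.subset_span ⟨(⟨i, by omega⟩, ⟨j, hj⟩), rfl⟩
      · obtain ⟨k, rfl⟩ := Nat.exists_eq_add_of_le (not_lt.1 hj)
        have h0 : AdjoinRoot.mk f (X ^ f.natDegree +
            ∑ i ∈ Finset.range f.natDegree, C (f.coeff i) * X ^ i) = 0 := by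
          rw [← hf.as_sum]; exact AdjoinRoot.mk_self
        rw [map_add, map_pow, map_sum] at h0
        have h1 : tQ f ^ f.natDegree =
            -∑ l ∈ Finset.range f.natDegree, AdjoinRoot.of f (f.coeff l) * tQ f ^ l := by
          rw [eq_neg_iff_add_eq_zero]
          simpa [tQ] using h0
        rw [pow_add, h1]
        have h2 : sQ f ^ i * ((-∑ l ∈ Finset.range f.natDegree,
            AdjoinRoot.of f (f.coeff l) * tQ f ^ l) * tQ f ^ k) =
            -∑ l ∈ Finset.range f.natDegree, ∑ e ∈ Finset.range (D + 1),
              (f.coeff l).coeff e • (sQ f ^ (i + e) * tQ f ^ (l + k)) := by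
          rw [neg_mul, mul_neg, Finset.sum_mul, Finset.mul_sum]
          congr 1
          refine Finset.sum_congr rfl fun l _ => ?_
          rw [of_eq_sum _ (hD l), Finset.sum_mul, Finset.sum_mul, Finset.mul_sum]
          refine Finset.sum_congr rfl fun e _ => ?_
          rw [pow_add, pow_add, Algebra.smul_def, Algebra.smul_def]
          ring
        rw [h2]
        refine Submodule.neg_mem _ (Submodule.sum_mem _ fun l hl => Submodule.sum_mem _ fun e he =>
          Submodule.smul_mem _ _ (ih _ ?_ _ ?_))
        · simp only [Finset.mem_range] at hl; omega
        · simp only [Finset.mem_range] at hl he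
          have : D * (l + k) + D ≤ D * (f.natDegree + k) := by
            calc D * (l + k) + D = D * (l + k + 1) := by ring
              _ ≤ _ := Nat.mul_le_mul_left _ (by omega)
          omega
  refine Submodule.span_le.2 ?_
  rintro _ ⟨i, j, h, rfl⟩
  exact key j i h

theorem famQ_linearIndependent (hf : f.Monic) (n : ℕ) : LinearIndependent 𝕜 (famQ f n) := by
  have h3 := linearIndependent_smul (Polynomial.basisMonomials 𝕜).linearIndependent
    (AdjoinRoot.powerBasis' hf).basis.linearIndependent
  have h4 := h3.comp (fun x : Fin n × Fin f.natDegree => ((x.1 : ℕ), x.2)) (by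
    rintro ⟨a, b⟩ ⟨c, e⟩ h
    have h1 := congrArg Prod.fst h
    have h2 := congrArg Prod.snd h
    exact Prod.ext (Fin.ext h1) h2)
  convert h4 using 1
  funext x
  simp only [famQ, Function.comp, Algebra.smul_def, PowerBasis.coe_basis, coe_basisMonomials]
  congr 1
  rw [sQ, ← map_pow, X_pow_eq_monomial]
  rfl

theorem exists_mem_VQ (hf : f.Monic) {D : ℕ} (hD : ∀ j, (f.coeff j).natDegree ≤ D)
    (x : AdjoinRoot f) : ∃ n, x ∈ VQ f n := by
  obtain ⟨G, rfl⟩ := AdjoinRoot.mk_surjective x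
  refine ⟨_, FilQ_le_VQ hf hD _ (mk_mem_FilQ (a := (Finset.range (G.natDegree + 1)).sup
    fun j => (G.coeff j).natDegree) G (fun j => ?_) le_rfl)⟩
  by_cases hj : j < G.natDegree + 1
  · exact Finset.le_sup (f := fun j => (G.coeff j).natDegree) (Finset.mem_range.2 hj)
  · rw [coeff_eq_zero_of_natDegree_lt (by omega)]; simp

theorem finrank_VQ (hf : f.Monic) (n : ℕ) : Module.finrank 𝕜 (VQ f n) = n * f.natDegree := by
  rw [VQ, finrank_span_eq_card (famQ_linearIndependent hf n)]
  simp

end Q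
end FCE

namespace FCE

section Taylor2
variable {R : Type*} [CommRing R]

/-- Two variable Hasse derivative. -/
noncomputable def hD (i j : ℕ) (f : R[X][X]) : R[X][X] :=
  ∑ k ∈ Finset.range (f.natDegree + 1),
    C ((k.choose j : R[X]) * hasseDeriv i (f.coeff k)) * X ^ (k - j)

theorem hD_zero_zero (f : R[X][X]) : hD 0 0 f = f := by
  conv_rhs => rw [f.as_sum_range_C_mul_X_pow]
  simp [hD]

theorem hD_zero_one (f : R[X][X]) : hD 0 1 f = derivative f := by
  conv_rhs => rw [f.as_sum_range_C_mul_X_pow, derivative_sum]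
  rw [hD]
  refine Finset.sum_congr rfl fun k _ => ?_
  rw [derivative_C_mul_X_pow]
  simp [mul_comm]

theorem hD_natDegree (i j : ℕ) (f : R[X][X]) : (hD i j f).natDegree ≤ f.natDegree := by
  refine natDegree_sum_le_of_forall_le _ _ fun k hk => ?_
  refine (natDegree_C_mul_X_pow_le _ _).trans ?_
  simp only [Finset.mem_range] at hk; omega

theorem hasseDeriv_natDegree_le (i : ℕ) (p : R[X]) : (hasseDeriv i p).natDegree ≤ p.natDegree :=
  (natDegree_hasseDeriv_le p i).trans (Nat.sub_le _ _)

theorem hD_coeff_natDegree (i j : ℕ) (f : R[X][X]) {D : ℕ} (h : ∀ k, (f.coeff k).natDegree ≤ D)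
    (l : ℕ) : ((hD i j f).coeff l).natDegree ≤ D := by
  rw [hD, finsetSum_coeff]
  refine natDegree_sum_le_of_forall_le _ _ fun k hk => ?_
  rw [coeff_C_mul, coeff_X_pow]
  split_ifs
  · rw [mul_one, ← nsmul_eq_mul]
    refine (natDegree_smul_le _ _).trans ((hasseDeriv_natDegree_le _ _).trans (h k))
  · simp

theorem hasseDeriv_map' {A : Type*} [CommRing A] (φ : R →+* A) (p : R[X]) (i : ℕ) :
    hasseDeriv i (p.map φ) = (hasseDeriv i p).map φ := by
  ext k
  simp [hasseDeriv_coeff]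

theorem taylor1 {A : Type*} [CommRing A] (φ : R →+* A) (p : R[X]) (s u : A) {I : ℕ}
    (hI : p.natDegree < I) :
    p.eval₂ φ (s + u) = ∑ i ∈ Finset.range I, (hasseDeriv i p).eval₂ φ s * u ^ i := by
  rw [eval₂_eq_eval_map, add_comm, ← taylor_eval, eval_eq_sum_range' (n := I)]
  · refine Finset.sum_congr rfl fun i _ => ?_
    rw [taylor_coeff, eval₂_eq_eval_map, hasseDeriv_map']
  · rw [natDegree_taylor]; exact natDegree_map_le.trans_lt hI

theorem taylor2 {A : Type*} [CommRing A] (φ : R →+* A) (f : R[X][X]) (s t u v : A) {I J : ℕ}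
    (hI : ∀ k, (f.coeff k).natDegree < I) (hJ : f.natDegree < J) :
    f.eval₂ (eval₂RingHom φ (s + u)) (t + v) = ∑ i ∈ Finset.range I, ∑ j ∈ Finset.range J,
      (hD i j f).eval₂ (eval₂RingHom φ s) t * u ^ i * v ^ j := by
  rw [eval₂_eq_sum_range]
  have h1 : ∀ k ∈ Finset.range (f.natDegree + 1), eval₂RingHom φ (s + u) (f.coeff k) * (t + v) ^ k
      = ∑ i ∈ Finset.range I, ∑ j ∈ Finset.range J,
        ((k.choose j : A) * (hasseDeriv i (f.coeff k)).eval₂ φ s * t ^ (k - j)) * u ^ i * v ^ j := by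
    intro k hk
    simp only [Finset.mem_range] at hk
    rw [coe_eval₂RingHom, taylor1 φ _ s u (hI k), Finset.sum_mul]
    refine Finset.sum_congr rfl fun i _ => ?_
    rw [add_comm t v, add_pow, Finset.mul_sum]
    refine Finset.sum_subset_zero_on_sdiff ?_ ?_ ?_
    · intro x; simp only [Finset.mem_range]; omega
    · intro x hx
      simp only [Finset.mem_sdiff, Finset.mem_range] at hx
      rw [Nat.choose_eq_zero_of_lt (by omega)]; simp
    · intro x _; ring
  rw [Finset.sum_congr rfl h1, Finset.sum_comm]
  refine Finset.sum_congr rfl fun i _ => ?_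
  rw [Finset.sum_comm]
  refine Finset.sum_congr rfl fun j _ => ?_
  rw [hD, eval₂_finsetSum, Finset.sum_mul, Finset.sum_mul]
  refine Finset.sum_congr rfl fun k _ => ?_
  simp
end Taylor2

section Tau
variable {𝕜 : Type*} [Field 𝕜] {f : 𝕜[X][X]}

theorem ringHom_ext_Q {A : Type*} [CommRing A] {g h : AdjoinRoot f →+* A}
    (h0 : ∀ c : 𝕜, g (algebraMap 𝕜 _ c) = h (algebraMap 𝕜 _ c)) (hs : g (sQ f) = h (sQ f))
    (ht : g (tQ f) = h (tQ f)) : g = h := by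
  apply Ideal.Quotient.ringHom_ext
  apply Polynomial.ringHom_ext'
  · apply Polynomial.ringHom_ext'
    · ext c; exact h0 c
    · exact hs
  · exact ht

theorem mk_eq_eval₂ (G : 𝕜[X][X]) :
    AdjoinRoot.mk f G = G.eval₂ (eval₂RingHom (algebraMap 𝕜 (AdjoinRoot f)) (sQ f)) (tQ f) := by
  have : AdjoinRoot.mk f =
      eval₂RingHom (eval₂RingHom (algebraMap 𝕜 (AdjoinRoot f)) (sQ f)) (tQ f) := by
    apply Polynomial.ringHom_ext'
    · apply Polynomial.ringHom_ext'
      · ext c; simp; rfl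
      · simp [sQ]
    · simp [tQ]
  rw [this]; rfl

/-- `Δ = f_y(s,θ)` -/
noncomputable def dQ (f : 𝕜[X][X]) : AdjoinRoot f := AdjoinRoot.mk f (derivative f)

theorem hom_eval₂_CQ {A : Type*} [CommRing A] (φ : AdjoinRoot f →+* A) (G : 𝕜[X][X]) :
    G.eval₂ (eval₂RingHom (φ.comp (algebraMap 𝕜 (AdjoinRoot f))) (φ (sQ f))) (φ (tQ f)) =
      φ (AdjoinRoot.mk f G) := by
  rw [mk_eq_eval₂, hom_eval₂]
  congr 1
  apply Polynomial.ringHom_ext'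
  · ext; simp
  · simp

theorem exists_tau {D : ℕ} (hD : ∀ j, (f.coeff j).natDegree ≤ D) :
    ∃ τ : AdjoinRoot f →+* PowerSeries (AdjoinRoot f),
      (∀ c : 𝕜, τ (algebraMap 𝕜 _ c) = PowerSeries.C (algebraMap 𝕜 _ c)) ∧
      τ (sQ f) = PowerSeries.C (sQ f) + PowerSeries.C (dQ f ^ 2) * PowerSeries.X ∧
      (∀ x, PowerSeries.constantCoeff (τ x) = x) ∧
      ∀ n, ∀ x ∈ FilQ f D n, ∀ e, PowerSeries.coeff e (τ x) ∈
        FilQ f D (2 * (D + D * f.natDegree) * e + n) := by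
  classical
  set d := D + D * f.natDegree with hd
  have hF := isFil_FilQ (f := f) D
  have hmem : ∀ i j, AdjoinRoot.mk f (FCE.hD i j f) ∈ FilQ f D d := fun i j =>
    mk_mem_FilQ _ (hD_coeff_natDegree i j f hD) (hD_natDegree i j f)
  have hdQ : dQ f ∈ FilQ f D d := by rw [dQ, ← hD_zero_one]; exact hmem 0 1
  let b : ℕ → ℕ → AdjoinRoot f := fun i j =>
    if (i, j) = (0, 1) then 1 else AdjoinRoot.mk f (FCE.hD i j f) * dQ f ^ (2 * i + j - 2)
  obtain ⟨p, hp, hsum⟩ := hensel_core hF d (D + 1) (f.natDegree + 2) b (by omega) (by omega)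
    (by simp [b, hD_zero_zero]) (by simp [b]) (by
      intro i j h1 h2
      simp only [b, if_neg h2]
      have h3 := hF.mul_mem (hmem i j) (hF.pow_mem hdQ (2 * i + j - 2))
      have h4 : d + d * (2 * i + j - 2) = d * (2 * i + j - 1) := by
        have : 2 * i + j - 1 = (2 * i + j - 2) + 1 := by
          have : ¬ (i = 0 ∧ j = 1) := by simpa using h2
          omega
        rw [this]; ring
      rwa [h4] at h3)
  let φ0 : AdjoinRoot f →+* PowerSeries (AdjoinRoot f) := PowerSeries.C
  let S := PowerSeries.C (sQ f) + PowerSeries.C (dQ f ^ 2) * PowerSeries.X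
  let T := PowerSeries.C (tQ f) + PowerSeries.C (dQ f) * (PowerSeries.X * p)
  have hroot : f.eval₂ (eval₂RingHom (φ0.comp (algebraMap 𝕜 (AdjoinRoot f))) S) T = 0 := by
    rw [taylor2 (I := D + 1) (J := f.natDegree + 2) _ f _ _ _ _ (fun k => by have := hD k; omega)
      (by omega)]
    have h1 : ∀ i j, (FCE.hD i j f).eval₂ (eval₂RingHom (φ0.comp (algebraMap 𝕜 (AdjoinRoot f)))
        (PowerSeries.C (sQ f))) (PowerSeries.C (tQ f)) * (PowerSeries.C (dQ f ^ 2) * PowerSeries.X) ^ i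
        * (PowerSeries.C (dQ f) * (PowerSeries.X * p)) ^ j
        = PowerSeries.C (dQ f ^ 2) * (PowerSeries.C (b i j) * PowerSeries.X ^ i *
          (PowerSeries.X * p) ^ j) := by
      intro i j
      have h2 := hom_eval₂_CQ φ0 (FCE.hD i j f)
      have h3 : AdjoinRoot.mk f (FCE.hD i j f) * dQ f ^ (2 * i + j) = dQ f ^ 2 * b i j := by
        by_cases h : (i, j) = (0, 1)
        · simp only [b, if_pos h]
          obtain ⟨rfl, rfl⟩ := Prod.mk.inj h
          rw [hD_zero_one, ← dQ]; ring
        · simp only [b, if_neg h]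
          by_cases h' : (i, j) = (0, 0)
          · obtain ⟨rfl, rfl⟩ := Prod.mk.inj h'
            rw [hD_zero_zero]; simp
          · have : 2 * i + j = 2 * i + j - 2 + 2 := by
              have : ¬ (i = 0 ∧ j = 1) := by simpa using h
              have : ¬ (i = 0 ∧ j = 0) := by simpa using h'
              omega
            conv_lhs => rw [this]
            ring
      have h4 := congrArg φ0 h3
      simp only [map_mul, map_pow] at h4
      refine (congrArg (fun z => z * (PowerSeries.C (dQ f ^ 2) * PowerSeries.X) ^ i
        * (PowerSeries.C (dQ f) * (PowerSeries.X * p)) ^ j) h2).trans ?_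
      simp only [φ0, map_pow] at h4 ⊢
      linear_combination (PowerSeries.X ^ i * (PowerSeries.X * p) ^ j) * h4
    rw [Finset.sum_congr rfl fun i _ => Finset.sum_congr rfl fun j _ => h1 i j]
    simp_rw [← Finset.mul_sum]
    rw [hsum, mul_zero]
  let τ : AdjoinRoot f →+* PowerSeries (AdjoinRoot f) := AdjoinRoot.lift _ _ hroot
  have hτc : ∀ c : 𝕜, τ (algebraMap 𝕜 _ c) = PowerSeries.C (algebraMap 𝕜 _ c) := by
    intro c
    have : τ (AdjoinRoot.of f (C c)) = _ := AdjoinRoot.lift_of hroot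
    exact this.trans (by simp [φ0])
  have hτs : τ (sQ f) = S := by
    have : τ (AdjoinRoot.of f X) = _ := AdjoinRoot.lift_of hroot
    exact this.trans (by simp)
  have hτt : τ (tQ f) = T := AdjoinRoot.lift_root hroot
  refine ⟨τ, hτc, hτs, ?_, ?_⟩
  · have : (PowerSeries.constantCoeff (R := AdjoinRoot f)).comp τ = RingHom.id _ := by
      apply ringHom_ext_Q
      · intro c; simp [hτc]
      · simp [hτs, S]
      · simp [hτt, T]
    intro x
    exact congrArg (fun g => g x) this
  · intro n x hx
    have hd2 : dQ f ^ 2 ∈ FilQ f D (2 * d) := by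
      have := hF.pow_mem hdQ 2; rwa [mul_comm] at this
    have hs1 : sQ f ∈ FilQ f D 1 := by simpa using mon_mem_FilQ (f := f) (D := D) (i := 1) (j := 0) (n := 1) (by simp)
    have ht1 : tQ f ∈ FilQ f D D := by simpa using mon_mem_FilQ (f := f) (D := D) (i := 0) (j := 1) (n := D) (by simp)
    have hS : PB (fun n => (FilQ f D n).toAddSubgroup) (2 * d) 1 (τ (sQ f)) := by
      rw [hτs]
      refine PB.add hF (PB.C_mem hF hs1) ?_
      have := PB.X_pow_mul hF (i := 1) (k' := 1) (PB.C_mem hF (c := 2 * d) hd2) (by omega)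
      rwa [pow_one, mul_comm PowerSeries.X] at this
    have hT : PB (fun n => (FilQ f D n).toAddSubgroup) (2 * d) D (τ (tQ f)) := by
      rw [hτt]
      refine PB.add hF (PB.C_mem hF ht1) ?_
      have := PB.X_pow_mul hF (i := 1) (k' := D) (PB.mul hF (PB.C_mem hF (c := 2 * d) hdQ) hp) (by omega)
      rw [pow_one] at this
      convert this using 1
      ring
    suffices PB (fun n => (FilQ f D n).toAddSubgroup) (2 * d) n (τ x) from this
    induction hx using Submodule.span_induction with
    | mem x h =>
      obtain ⟨i, j, h, rfl⟩ := h
      rw [map_mul, map_pow, map_pow]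
      exact PB.mono hF (PB.mul hF (PB.pow hF hS i) (PB.pow hF hT j)) (by omega)
    | zero => rw [map_zero]; exact PB.zero hF
    | add x y _ _ h1 h2 => rw [map_add]; exact PB.add hF h1 h2
    | smul a x _ h =>
      intro e
      rw [Algebra.smul_def, map_mul, hτc, PowerSeries.coeff_C_mul, ← Algebra.smul_def]
      exact Submodule.smul_mem _ _ (h e)

end Tau
end FCE

namespace FCE

section Zero
variable {𝕜 : Type*} [Field 𝕜] {f : 𝕜[X][X]}

theorem Q_isDomain (hirr : Irreducible f) : IsDomain (AdjoinRoot f) :=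
  AdjoinRoot.isDomain_of_prime hirr.prime

theorem VQ_finite (n : ℕ) : Module.Finite 𝕜 (VQ f n) := by
  rw [VQ]; exact Module.Finite.span_of_finite 𝕜 (Set.finite_range _)

/-- coefficient evaluation -/
noncomputable def coefMap {ι : Type*} (M : ℕ) (ev : ι → (AdjoinRoot f →+* PowerSeries 𝕜))
    (hc : ∀ i, ∀ c : 𝕜, ev i (algebraMap 𝕜 _ c) = PowerSeries.C c) :
    AdjoinRoot f →ₗ[𝕜] (ι × Fin M → 𝕜) where
  toFun x y := PowerSeries.coeff y.2 (ev y.1 x)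
  map_add' x y := by funext; simp
  map_smul' c x := by funext y; simp [Algebra.smul_def, hc]

theorem coefMap_surjective {ι : Type*} [Fintype ι] (M : ℕ)
    (ev : ι → (AdjoinRoot f →+* PowerSeries 𝕜))
    (hc : ∀ i, ∀ c : 𝕜, ev i (algebraMap 𝕜 _ c) = PowerSeries.C c)
    (a c β : ι → 𝕜) (hs : ∀ i, ev i (sQ f) = PowerSeries.C (a i) + PowerSeries.C (c i) * PowerSeries.X)
    (hc0 : ∀ i, c i ≠ 0) (ht : ∀ i, PowerSeries.constantCoeff (ev i (tQ f)) = β i)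
    (hinj : ∀ i j, i ≠ j → a i ≠ a j ∨ β i ≠ β j) :
    Function.Surjective (coefMap M ev hc) := by
  classical
  let I : ι → Ideal (AdjoinRoot f) := fun i => (Ideal.span {PowerSeries.X ^ M}).comap (ev i)
  have hI : ∀ i x, x ∈ I i ↔ PowerSeries.X ^ M ∣ ev i x := fun i x => by
    simp [I, Ideal.mem_comap, Ideal.mem_span_singleton]
  have hmem : ∀ i x, PowerSeries.constantCoeff (ev i x) = 0 → x ^ M ∈ I i := by
    intro i x h
    rw [hI, map_pow]
    exact pow_dvd_pow_of_dvd (PowerSeries.X_dvd_iff.2 h) _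
  have hgen : ∀ i j : ι, ∀ x : AdjoinRoot f, ∀ u v : 𝕜, u ≠ v →
      PowerSeries.constantCoeff (ev i x) = u → PowerSeries.constantCoeff (ev j x) = v →
      IsCoprime (I i) (I j) := by
    intro i j x u v huv hu hv
    have h1 : IsCoprime (x - algebraMap 𝕜 _ u) (x - algebraMap 𝕜 _ v) := by
      refine ⟨algebraMap 𝕜 _ (v - u)⁻¹, -algebraMap 𝕜 _ (v - u)⁻¹, ?_⟩
      have : (v - u)⁻¹ * (v - u) = 1 := inv_mul_cancel₀ (sub_ne_zero.2 huv.symm)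
      have := congrArg (algebraMap 𝕜 (AdjoinRoot f)) this
      simp only [map_mul, map_sub, map_one] at this ⊢
      linear_combination this
    obtain ⟨y, z, hyz⟩ := h1.pow (m := M) (n := M)
    rw [Ideal.isCoprime_iff_exists]
    refine ⟨_, Ideal.mul_mem_left _ y (hmem i _ ?_), _, Ideal.mul_mem_left _ z (hmem j _ ?_), hyz⟩
    · simp [hu, hc]
    · simp [hv, hc]
  have hcop : Pairwise fun i j => IsCoprime (I i) (I j) := by
    intro i j hij
    rcases hinj i j hij with h | h
    · exact hgen i j (sQ f) _ _ h (by simp [hs]) (by simp [hs])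
    · exact hgen i j (tQ f) _ _ h (ht i) (ht j)
  intro y
  let g : ι → AdjoinRoot f := fun i => ∑ e : Fin M,
    algebraMap 𝕜 _ (y (i, e) * ((c i)⁻¹) ^ (e : ℕ)) * (sQ f - algebraMap 𝕜 _ (a i)) ^ (e : ℕ)
  obtain ⟨r, hr⟩ := Ideal.exists_forall_sub_mem_ideal hcop g
  refine ⟨r, ?_⟩
  funext ⟨i, e⟩
  have h1 := (hI _ _).1 (hr i)
  have h2 := PowerSeries.X_pow_dvd_iff.1 h1 e e.2
  rw [map_sub, map_sub, sub_eq_zero] at h2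
  change PowerSeries.coeff (e : ℕ) (ev i r) = _
  rw [h2]
  simp only [g, map_sum, map_mul, map_pow, map_sub, hs, hc, add_sub_cancel_left]
  rw [Finset.sum_eq_single e]
  · rw [mul_pow, ← map_pow PowerSeries.C, ← map_pow PowerSeries.C, ← map_mul PowerSeries.C, ← mul_assoc, ← map_mul PowerSeries.C,
      PowerSeries.coeff_C_mul, PowerSeries.coeff_X_pow_self, mul_one, mul_assoc, ← mul_pow,
      inv_mul_cancel₀ (hc0 i), one_pow, mul_one]
  · intro e' _ he
    rw [mul_pow, ← map_pow PowerSeries.C, ← map_pow PowerSeries.C, ← map_mul PowerSeries.C, ← mul_assoc, ← map_mul PowerSeries.C,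
      PowerSeries.coeff_C_mul, PowerSeries.coeff_X_pow, if_neg, mul_zero]
    intro h; exact he (Fin.ext h.symm)
  · simp

theorem zero_lemma (hf : f.Monic) (hirr : Irreducible f) {D : ℕ}
    (hD : ∀ j, (f.coeff j).natDegree ≤ D) {ι : Type*} [Fintype ι] (M : ℕ)
    (ev : ι → (AdjoinRoot f →+* PowerSeries 𝕜))
    (hc : ∀ i, ∀ c : 𝕜, ev i (algebraMap 𝕜 _ c) = PowerSeries.C c)
    (a c β : ι → 𝕜) (hs : ∀ i, ev i (sQ f) = PowerSeries.C (a i) + PowerSeries.C (c i) * PowerSeries.X)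
    (hc0 : ∀ i, c i ≠ 0) (ht : ∀ i, PowerSeries.constantCoeff (ev i (tQ f)) = β i)
    (hinj : ∀ i j, i ≠ j → a i ≠ a j ∨ β i ≠ β j) {h : ℕ} {H : AdjoinRoot f} (hH0 : H ≠ 0)
    (hH : H ∈ FilQ f D h) (hdvd : ∀ i, PowerSeries.X ^ M ∣ ev i H) :
    Fintype.card ι * M ≤ (h + D * f.natDegree + 1) * f.natDegree := by
  classical
  have := Q_isDomain hirr
  have hsurj := coefMap_surjective M ev hc a c β hs hc0 ht hinj
  set Φ := coefMap M ev hc with hΦ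
  -- choose n
  obtain ⟨n, hn⟩ : ∃ n, ∀ y, ∃ x ∈ VQ f n, Φ x = y := by
    choose g hg using fun y : ι × Fin M => hsurj (Pi.single y 1)
    choose N hN using fun y : ι × Fin M => exists_mem_VQ hf hD (g y)
    refine ⟨Finset.univ.sup N, fun y => ⟨∑ z, y z • g z, ?_, ?_⟩⟩
    · exact Submodule.sum_mem _ fun z _ => Submodule.smul_mem _ _
        (VQ_mono (Finset.le_sup (Finset.mem_univ z)) (hN z))
    · simp only [map_sum, map_smul, hg]
      funext z
      simp [Finset.sum_apply, Pi.single_apply]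
  set n' := n + D * f.natDegree + h + 1 with hn'
  have := VQ_finite (f := f) n
  have := VQ_finite (f := f) n'
  let Ψ : VQ f n' →ₗ[𝕜] (ι × Fin M → 𝕜) := Φ.comp (VQ f n').subtype
  have hΨ : Function.Surjective Ψ := by
    intro y
    obtain ⟨x, hx, hxy⟩ := hn y
    exact ⟨⟨x, VQ_mono (by omega) hx⟩, hxy⟩
  have hmem : ∀ x ∈ VQ f n, H * x ∈ VQ f n' := by
    intro x hx
    have h1 := FilQ_mul hH (VQ_le_FilQ D n hx)
    exact VQ_mono (by omega) (FilQ_le_VQ hf hD _ h1)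
  let mulH : VQ f n →ₗ[𝕜] VQ f n' :=
    ((LinearMap.mulLeft 𝕜 H).comp (VQ f n).subtype).codRestrict _ (fun x => hmem x x.2)
  have hker : ∀ x, mulH x ∈ LinearMap.ker Ψ := by
    intro x
    rw [LinearMap.mem_ker]
    funext ⟨i, e⟩
    change PowerSeries.coeff (e : ℕ) (ev i (H * x)) = 0
    rw [map_mul]
    exact PowerSeries.X_pow_dvd_iff.1 ((hdvd i).mul_right _) e e.2
  have hinj' : Function.Injective (mulH.codRestrict _ hker) := by
    intro x y hxy
    have h2 : H * (x : AdjoinRoot f) = H * y := congrArg (fun z : LinearMap.ker Ψ => ((z : VQ f n') : AdjoinRoot f)) hxy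
    exact Subtype.ext (mul_left_cancel₀ hH0 h2)
  have h1 := LinearMap.finrank_le_finrank_of_injective hinj'
  have h2 := LinearMap.finrank_range_add_finrank_ker Ψ
  rw [LinearMap.range_eq_top.2 hΨ, finrank_top, finrank_VQ hf] at h2
  rw [finrank_VQ hf] at h1
  simp only [Module.finrank_fintype_fun_eq_card, Fintype.card_prod, Fintype.card_fin] at h2
  have h3 : n' * f.natDegree = (h + D * f.natDegree + 1) * f.natDegree + n * f.natDegree := by
    rw [hn']; ring
  omega

end Zero
end FCE

namespace FCE

section Step
variable {K : Type*} [Field K] {f : K[X][X]}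

theorem frob_trunc (p k : ℕ) [ExpChar K p] (z : PowerSeries K) :
    PowerSeries.X ^ (p ^ k) ∣ z ^ (p ^ k) - PowerSeries.C (PowerSeries.constantCoeff z ^ (p ^ k)) := by
  have : ExpChar (PowerSeries K) p :=
    expChar_of_injective_ringHom (PowerSeries.C_injective (R := K)) p
  rw [map_pow, ← sub_pow_expChar_pow]
  exact pow_dvd_pow_of_dvd (PowerSeries.X_dvd_iff.2 (by simp)) _

/-- one-point versions -/
theorem ev_ne_zero (hf : f.Monic) (hirr : Irreducible f) {D : ℕ}
    (hD : ∀ j, (f.coeff j).natDegree ≤ D)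
    (ev : AdjoinRoot f →+* PowerSeries K)
    (hc : ∀ c : K, ev (algebraMap K _ c) = PowerSeries.C c)
    (a c : K) (hs : ev (sQ f) = PowerSeries.C a + PowerSeries.C c * PowerSeries.X)
    (hc0 : c ≠ 0) {h : ℕ} {H : AdjoinRoot f} (hH0 : H ≠ 0) (hH : H ∈ FilQ f D h) {M : ℕ}
    (hM : (h + D * f.natDegree + 1) * f.natDegree < M) : ¬ PowerSeries.X ^ M ∣ ev H := by
  intro hdvd
  have := zero_lemma hf hirr hD (ι := Unit) M (fun _ => ev) (fun _ => hc) (fun _ => a) (fun _ => c)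
    (fun _ => PowerSeries.constantCoeff (ev (tQ f))) (fun _ => hs) (fun _ => hc0) (fun _ => rfl)
    (fun i j h => absurd (Subsingleton.elim i j) h) hH0 hH (fun _ => hdvd)
  simp at this
  omega

theorem lin_ne_zero (hf : f.Monic) {n : ℕ} {d : Fin n × Fin f.natDegree → K} (hd : d ≠ 0) :
    ∑ x, d x • famQ f n x ≠ 0 := by
  intro h
  exact hd (funext fun x => Fintype.linearIndependent_iff.1 (famQ_linearIndependent hf n) d h x)

theorem lin_mem (n : ℕ) (d : Fin n × Fin f.natDegree → K) :
    ∑ x, d x • famQ f n x ∈ VQ f n :=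
  Submodule.sum_mem _ fun x _ => Submodule.smul_mem _ _ (Submodule.subset_span ⟨x, rfl⟩)

theorem stepanov_ne_zero (hf : f.Monic) (hirr : Irreducible f) {D : ℕ}
    (hD : ∀ j, (f.coeff j).natDegree ≤ D) (p k : ℕ) [ExpChar K p]
    (hroot : ∀ x : K, ∃ y, y ^ (p ^ k) = x)
    (ev : AdjoinRoot f →+* PowerSeries K)
    (hc : ∀ c : K, ev (algebraMap K _ c) = PowerSeries.C c)
    (a c : K) (hs : ev (sQ f) = PowerSeries.C a + PowerSeries.C c * PowerSeries.X)
    (hc0 : c ≠ 0) {l m : ℕ} (hl : (l + D * f.natDegree + D * f.natDegree + 1) * f.natDegree < p ^ k)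
    (u : Fin l × Fin f.natDegree → Fin m × Fin f.natDegree → K) (hu : u ≠ 0) :
    ∑ x, ∑ y, u x y • (famQ f l x * famQ f m y ^ (p ^ k)) ≠ 0 := by
  classical
  intro h0
  have := Q_isDomain hirr
  have hEQ : ExpChar (AdjoinRoot f) p :=
    expChar_of_injective_ringHom (algebraMap K (AdjoinRoot f)).injective p
  choose v hv using fun x y => hroot (u x y)
  let Y : Fin l × Fin f.natDegree → AdjoinRoot f := fun x => ∑ y, v x y • famQ f m y
  have hY : ∀ x, ∑ y, u x y • (famQ f l x * famQ f m y ^ (p ^ k)) = famQ f l x * Y x ^ (p ^ k) := by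
    intro x
    simp only [Y]
    rw [sum_pow_char_pow, Finset.mul_sum]
    refine Finset.sum_congr rfl fun y _ => ?_
    rw [_root_.smul_pow, hv, mul_smul_comm]
  rw [Finset.sum_congr rfl fun x _ => hY x] at h0
  have h1 : ∑ x, ev (famQ f l x) * ev (Y x) ^ (p ^ k) = 0 := by
    have := congrArg ev h0
    simpa using this
  -- some `Y x` is nonzero
  obtain ⟨x0, hx0⟩ : ∃ x, Y x ≠ 0 := by
    obtain ⟨x, hx⟩ := Function.ne_iff.1 hu
    refine ⟨x, lin_ne_zero hf (fun h => hx ?_)⟩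
    funext y
    rw [← hv x y, congrFun h y]
    simp [(expChar_pos K p).ne']
  have hex : ∃ r, ¬ ∀ x, PowerSeries.X ^ r ∣ ev (Y x) :=
    ⟨_, fun h => ev_ne_zero hf hirr hD ev hc a c hs hc0 hx0 (VQ_le_FilQ D m (lin_mem m _))
      (Nat.lt_succ_self _) (h x0)⟩
  have hr1 := Nat.find_spec hex
  set r := Nat.find hex with hr
  have hr0 : r ≠ 0 := by
    intro h; rw [h] at hr1; exact hr1 (fun x => by simp)
  obtain ⟨r', hr'⟩ := Nat.exists_eq_succ_of_ne_zero hr0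
  have hr2 : ∀ x, PowerSeries.X ^ r' ∣ ev (Y x) := by
    have := Nat.find_min hex (m := r') (by omega)
    simpa using this
  choose Z hZ using hr2
  have h2 : ∑ x, ev (famQ f l x) * Z x ^ (p ^ k) = 0 := by
    have h3 : (PowerSeries.X ^ r') ^ (p ^ k) * ∑ x, ev (famQ f l x) * Z x ^ (p ^ k) = 0 := by
      rw [← h1, Finset.mul_sum]
      refine Finset.sum_congr rfl fun x _ => ?_
      rw [hZ x]; ring
    exact (mul_eq_zero.1 h3).resolve_left (pow_ne_zero _ (pow_ne_zero _ PowerSeries.X_ne_zero))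
  let z : Fin l × Fin f.natDegree → K := fun x => PowerSeries.constantCoeff (Z x) ^ (p ^ k)
  have hz : z ≠ 0 := by
    intro hz
    apply hr1
    intro x
    have h4 : PowerSeries.constantCoeff (Z x) = 0 := by
      have := congrFun hz x
      exact pow_eq_zero_iff (pow_pos (expChar_pos K p) k).ne' |>.1 this
    rw [hZ x, hr', pow_succ]
    exact mul_dvd_mul_left _ (PowerSeries.X_dvd_iff.2 h4)
  refine ev_ne_zero hf hirr hD ev hc a c hs hc0 (lin_ne_zero hf hz)
    (VQ_le_FilQ D l (lin_mem l z)) hl ?_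
  have h5 : ev (∑ x, z x • famQ f l x) = - ∑ x, ev (famQ f l x) *
      (Z x ^ (p ^ k) - PowerSeries.C (PowerSeries.constantCoeff (Z x) ^ (p ^ k))) := by
    simp only [mul_sub, Finset.sum_sub_distrib, h2, zero_sub, neg_neg, map_sum, Algebra.smul_def,
      map_mul, hc, z]
    exact Finset.sum_congr rfl fun x _ => mul_comm _ _
  rw [h5, dvd_neg]
  exact Finset.dvd_sum fun x _ => (frob_trunc p k _).mul_left _


/-- the ring hom of a point -/
noncomputable def ptHom (a β : K) (h : f.evalEval a β = 0) : AdjoinRoot f →+* K :=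
  AdjoinRoot.lift (evalRingHom a) β (by rw [eval₂_evalRingHom]; exact h)

theorem ptHom_mk (a β : K) (h : f.evalEval a β = 0) (G : K[X][X]) :
    ptHom a β h (AdjoinRoot.mk f G) = G.evalEval a β := by
  rw [ptHom, AdjoinRoot.lift_mk, eval₂_evalRingHom]

theorem ptHom_s (a β : K) (h : f.evalEval a β = 0) : ptHom a β h (sQ f) = a := by
  have := ptHom_mk a β h (C X)
  rw [AdjoinRoot.mk_C] at this
  exact this.trans (by simp [evalEval])

theorem ptHom_t (a β : K) (h : f.evalEval a β = 0) : ptHom a β h (tQ f) = β := by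
  have := ptHom_mk a β h X
  rw [AdjoinRoot.mk_X] at this
  exact this.trans (by simp [evalEval])

theorem ptHom_c (a β : K) (h : f.evalEval a β = 0) (c : K) :
    ptHom a β h (algebraMap K _ c) = c := by
  have := ptHom_mk a β h (C (C c))
  rw [mk_C_C] at this
  exact this.trans (by simp [evalEval])

theorem stepanov (hf : f.Monic) (hirr : Irreducible f) {D : ℕ}
    (hD : ∀ j, (f.coeff j).natDegree ≤ D) (p k : ℕ) [ExpChar K p]
    (hroot : ∀ x : K, ∃ y, y ^ (p ^ k) = x) (w g : K[X][X])
    (hwD : ∀ j, (w.coeff j).natDegree ≤ D) (hw : w.natDegree ≤ D)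
    (hgD : ∀ j, (g.coeff j).natDegree ≤ D) (hg : g.natDegree ≤ D)
    (S : Finset (K × K))
    (hS : ∀ x ∈ S, x.1 ^ (p ^ k) = x.1 ∧ f.evalEval x.1 x.2 = 0 ∧
      (derivative f).evalEval x.1 x.2 ≠ 0 ∧ w.evalEval x.1 x.2 ≠ 0 ∧
      w.evalEval x.1 x.2 * x.2 ^ (p ^ k) = g.evalEval x.1 x.2)
    {l m M T : ℕ} (hM : M ≤ p ^ k)
    (hl : (l + D * f.natDegree + D * f.natDegree + 1) * f.natDegree < p ^ k)
    (hT : 2 * (D + D * f.natDegree) * M + (l + D * f.natDegree) + m +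
      (D + D * D) * f.natDegree + 1 ≤ T)
    (hcount : M * (T * f.natDegree) < (l * f.natDegree) * (m * f.natDegree)) :
    S.card * M ≤ ((l + D * f.natDegree) + p ^ k * (m + D * f.natDegree) + D * f.natDegree + 1)
      * f.natDegree := by
  classical
  rcases S.eq_empty_or_nonempty with rfl | ⟨pt0, hpt0⟩
  · simp
  obtain ⟨τ, hτc, hτs, hτ0, hτF⟩ := exists_tau hD
  have hF := isFil_FilQ (f := f) D
  let ev : S → (AdjoinRoot f →+* PowerSeries K) := fun x =>
    (PowerSeries.map (ptHom x.1.1 x.1.2 (hS x x.2).2.1)).comp τ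
  have hevc : ∀ x, ∀ c : K, ev x (algebraMap K _ c) = PowerSeries.C c := by
    intro x c; simp [ev, hτc, ptHom_c]
  let cc : S → K := fun x => ((derivative f).evalEval x.1.1 x.1.2) ^ 2
  have hevs : ∀ x, ev x (sQ f) = PowerSeries.C x.1.1 + PowerSeries.C (cc x) * PowerSeries.X := by
    intro x; simp [ev, hτs, ptHom_s, dQ, ptHom_mk, cc]
  have hevt : ∀ x, PowerSeries.constantCoeff (ev x (tQ f)) = x.1.2 := by
    intro x
    rw [← PowerSeries.coeff_zero_eq_constantCoeff_apply]
    simp only [ev, RingHom.comp_apply, PowerSeries.coeff_map]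
    rw [PowerSeries.coeff_zero_eq_constantCoeff_apply, hτ0, ptHom_t]
  have hcc : ∀ x, cc x ≠ 0 := fun x => pow_ne_zero _ (hS x x.2).2.2.1
  -- the conditions
  let A : Fin m × Fin f.natDegree → AdjoinRoot f := fun y =>
    sQ f ^ (y.1 : ℕ) * (AdjoinRoot.mk f g ^ (y.2 : ℕ) * AdjoinRoot.mk f w ^ (f.natDegree - 1 - y.2))
  have hmem : ∀ e < M, ∀ x y, PowerSeries.coeff e (τ (famQ f l x)) * A y ∈ VQ f T := by
    intro e he x y
    have h1 : famQ f l x ∈ FilQ f D (l + D * f.natDegree) :=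
      VQ_le_FilQ D l (Submodule.subset_span ⟨x, rfl⟩)
    have h2 := hτF _ _ h1 e
    have hs1 : sQ f ∈ FilQ f D 1 := by
      simpa using mon_mem_FilQ (f := f) (D := D) (i := 1) (j := 0) (n := 1) (by simp)
    have h3 := hF.pow_mem hs1 y.1
    have h4 := hF.pow_mem (mk_mem_FilQ (D := D) g hgD hg) y.2
    have h5 := hF.pow_mem (mk_mem_FilQ (D := D) w hwD hw) (f.natDegree - 1 - y.2)
    have h6 := FilQ_mul h2 (FilQ_mul h3 (FilQ_mul h4 h5))
    refine VQ_mono ?_ (FilQ_le_VQ hf hD _ h6)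
    refine le_trans ?_ hT
    have h7 : 2 * (D + D * f.natDegree) * e ≤ 2 * (D + D * f.natDegree) * M :=
      Nat.mul_le_mul_left _ he.le
    have h8 : (D + D * D) * (y.2 : ℕ) + (D + D * D) * (f.natDegree - 1 - y.2) ≤
        (D + D * D) * f.natDegree := by
      rw [← Nat.mul_add]; exact Nat.mul_le_mul_left _ (by have := y.2.2; omega)
    have := y.1.2
    omega
  have := VQ_finite (f := f) T
  let Λ : (Fin l × Fin f.natDegree → Fin m × Fin f.natDegree → K) →ₗ[K] (Fin M → VQ f T) :=
    { toFun := fun u e => ∑ x, ∑ y, u x y •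
        (⟨PowerSeries.coeff e (τ (famQ f l x)) * A y, hmem e e.2 x y⟩ : VQ f T)
      map_add' := fun u v => by
        funext e; simp only [Pi.add_apply, add_smul, Finset.sum_add_distrib]
      map_smul' := fun c u => by
        funext e; simp [mul_smul, Finset.smul_sum] }
  obtain ⟨u, hu, hu0⟩ : ∃ u ∈ LinearMap.ker Λ, u ≠ 0 := by
    have : LinearMap.ker Λ ≠ ⊥ := by
      refine LinearMap.ker_ne_bot_of_finrank_lt ?_
      rw [Module.finrank_pi_fintype, Module.finrank_pi_fintype]
      simp only [Module.finrank_fintype_fun_eq_card, Finset.sum_const, finrank_VQ hf,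
        Finset.card_univ, Fintype.card_prod, Fintype.card_fin, smul_eq_mul]
      exact hcount
    exact Submodule.exists_mem_ne_zero_of_ne_bot this
  have hu1 : ∀ e < M, ∑ x, ∑ y, u x y • (PowerSeries.coeff e (τ (famQ f l x)) * A y) = 0 := by
    intro e he
    have h1 := congrArg (fun z => ((z ⟨e, he⟩ : VQ f T) : AdjoinRoot f)) (LinearMap.mem_ker.1 hu)
    simpa [Λ] using h1
  have hH0 := stepanov_ne_zero hf hirr hD p k hroot (ev ⟨pt0, hpt0⟩) (hevc _) _ _ (hevs _) (hcc _)
    hl u hu0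
  set H := ∑ x, ∑ y, u x y • (famQ f l x * famQ f m y ^ (p ^ k)) with hH
  have hHmem : H ∈ FilQ f D ((l + D * f.natDegree) + p ^ k * (m + D * f.natDegree)) := by
    refine Submodule.sum_mem _ fun x _ => Submodule.sum_mem _ fun y _ => Submodule.smul_mem _ _
      (FilQ_mul (VQ_le_FilQ D l (Submodule.subset_span ⟨x, rfl⟩)) ?_)
    have := hF.pow_mem (a := m + D * f.natDegree) (VQ_le_FilQ D m (Submodule.subset_span ⟨y, rfl⟩)) (p ^ k)
    rwa [mul_comm] at this
  have hfin := zero_lemma hf hirr hD M ev hevc (fun x => x.1.1) cc (fun x => x.1.2) hevs hcc hevt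
    (by
      intro x y hxy
      by_contra hcon
      push Not at hcon
      exact hxy (Subtype.ext (Prod.ext hcon.1 hcon.2))) hH0 hHmem ?_
  · simpa using hfin
  intro pt
  obtain ⟨ha, hfz, hfy, hwz, hwg⟩ := hS pt pt.2
  set a := pt.1.1
  set β := pt.1.2
  rw [PowerSeries.X_pow_dvd_iff]
  intro e he
  let π := ptHom a β hfz
  have h1 : PowerSeries.coeff e (ev pt H) =
      ∑ x, ∑ y, u x y * (PowerSeries.coeff e (ev pt (famQ f l x)) * (π (famQ f m y)) ^ (p ^ k)) := by
    have h2 : ∀ y, PowerSeries.constantCoeff (ev pt (famQ f m y)) = π (famQ f m y) := by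
      intro y
      rw [← PowerSeries.coeff_zero_eq_constantCoeff_apply]
      simp only [ev, RingHom.comp_apply, PowerSeries.coeff_map]
      rw [PowerSeries.coeff_zero_eq_constantCoeff_apply, hτ0]
    simp only [hH, map_sum, Algebra.smul_def, map_mul, hevc, map_pow]
    refine Finset.sum_congr rfl fun x _ => Finset.sum_congr rfl fun y _ => ?_
    rw [PowerSeries.coeff_C_mul]
    congr 1
    have h3 := frob_trunc p k (ev pt (famQ f m y))
    have h4 := PowerSeries.X_pow_dvd_iff.1 (h3.mul_left (ev pt (famQ f l x))) e (by omega)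
    rw [mul_sub, map_sub, sub_eq_zero, PowerSeries.coeff_mul_C, h2] at h4
    exact h4
  have h2 : ∀ y, w.evalEval a β ^ (f.natDegree - 1) * (π (famQ f m y)) ^ (p ^ k) = π (A y) := by
    intro y
    simp only [famQ, A, map_mul, map_pow, π, ptHom_s, ptHom_t, ptHom_mk]
    rw [mul_pow, ← pow_mul, mul_comm (y.1 : ℕ), pow_mul, ha, ← hwg, mul_pow, ← pow_mul, ← pow_mul]
    have : f.natDegree - 1 = y.2 + (f.natDegree - 1 - y.2) := by have := y.2.2; omega
    conv_lhs => rw [this, pow_add]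
    ring
  have h3 := congrArg π (hu1 e he)
  have h4 : w.evalEval a β ^ (f.natDegree - 1) * PowerSeries.coeff e (ev pt H) = 0 := by
    rw [h1, Finset.mul_sum]
    rw [map_zero, map_sum] at h3
    rw [← h3]
    refine Finset.sum_congr rfl fun x _ => ?_
    rw [Finset.mul_sum, map_sum]
    refine Finset.sum_congr rfl fun y _ => ?_
    rw [Algebra.smul_def, map_mul, map_mul, ← h2]
    have h5 : π (algebraMap K _ (u x y)) = u x y := ptHom_c _ _ _ _
    have h6 : PowerSeries.coeff e (ev pt (famQ f l x)) = π (PowerSeries.coeff e (τ (famQ f l x))) := by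
      simp only [ev, RingHom.comp_apply, PowerSeries.coeff_map]
      rfl
    rw [h5, h6]; ring
  exact (mul_eq_zero.1 h4).resolve_left (pow_ne_zero _ hwz)

end Step
end FCE

namespace FCE

theorem trivial_bound {K : Type*} [Field K] {f : K[X][X]} (hf : f.Monic) {q : ℕ} (hq : 1 < q)
    (S : Finset (K × K)) (hS : ∀ x ∈ S, x.1 ^ q = x.1 ∧ f.evalEval x.1 x.2 = 0) :
    S.card ≤ f.natDegree * q := by
  classical
  have h1 := Finset.card_le_mul_card_image (f := Prod.fst) S f.natDegree (by
    intro a _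
    have hm : (f.map (evalRingHom a)).Monic := hf.map _
    calc _ ≤ ((f.map (evalRingHom a)).roots.toFinset).card := by
          refine Finset.card_le_card_of_injOn Prod.snd ?_ ?_
          · rintro ⟨b, β⟩ hb
            simp only [Finset.coe_filter, Set.mem_ofPred_eq] at hb
            obtain ⟨hb, rfl⟩ := hb
            simp only [Finset.mem_coe, Multiset.mem_toFinset]
            rw [mem_roots hm.ne_zero, IsRoot, eval_map, eval₂_evalRingHom]
            exact (hS _ hb).2
          · rintro ⟨b, β⟩ hb ⟨b', β'⟩ hb' h
            simp only [Finset.coe_filter, Set.mem_ofPred_eq] at hb hb' h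
            rw [h, hb.2, hb'.2]
      _ ≤ _ := (Multiset.toFinset_card_le _).trans ((card_roots' _).trans natDegree_map_le))
  refine h1.trans (Nat.mul_le_mul_left _ ?_)
  have hne : (X ^ q - X : K[X]) ≠ 0 := (monic_X_pow_sub (p := (X : K[X])) (n := q) (by
    rw [degree_X]; exact_mod_cast hq)).ne_zero
  calc _ ≤ ((X ^ q - X : K[X]).roots.toFinset).card := by
        refine Finset.card_le_card ?_
        intro a ha
        obtain ⟨x, hx, rfl⟩ := Finset.mem_image.1 ha
        rw [Multiset.mem_toFinset, mem_roots hne]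
        simp [(hS x hx).1]
    _ ≤ (X ^ q - X : K[X]).natDegree := (Multiset.toFinset_card_le _).trans (card_roots' _)
    _ ≤ q := by
        refine (natDegree_sub_le _ _).trans ?_
        simp; omega

set_option maxHeartbeats 1000000 in
theorem LW1.{u} (D : ℕ) : ∃ C : ℝ, 0 ≤ C ∧ ∀ (K : Type u) [Field K] (p k : ℕ) [ExpChar K p]
    (_ : ∀ x : K, ∃ y, y ^ (p ^ k) = x) (_ : 1 < p ^ k) (f w g : K[X][X]) (S : Finset (K × K)),
    f.Monic → Irreducible f → f.natDegree ≤ D → (∀ j, (f.coeff j).natDegree ≤ D) →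
    (∀ j, (w.coeff j).natDegree ≤ D) → w.natDegree ≤ D →
    (∀ j, (g.coeff j).natDegree ≤ D) → g.natDegree ≤ D →
    (∀ x ∈ S, x.1 ^ (p ^ k) = x.1 ∧ f.evalEval x.1 x.2 = 0 ∧
      (derivative f).evalEval x.1 x.2 ≠ 0 ∧ w.evalEval x.1 x.2 ≠ 0 ∧
      w.evalEval x.1 x.2 * x.2 ^ (p ^ k) = g.evalEval x.1 x.2) →
    (S.card : ℝ) ≤ (p ^ k : ℕ) + C * Real.sqrt (p ^ k : ℕ) := by
  obtain ⟨k1, hk1⟩ : ∃ k1, k1 = 2 * (D + D * D) + 1 := ⟨_, rfl⟩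
  obtain ⟨κ1, hκ1⟩ : ∃ κ1, κ1 = D * D + (D + D * D) * D + 1 := ⟨_, rfl⟩
  obtain ⟨κ, hκ⟩ : ∃ κ, κ = 4 * D * k1 := ⟨_, rfl⟩
  obtain ⟨M0, hM0⟩ : ∃ M0, M0 = 4 * D + κ + D + κ1 + 1 + 2 * ((2 * (D * D) + 1) * D) := ⟨_, rfl⟩
  obtain ⟨C1, hC1⟩ : ∃ C1, C1 = 1 + 2 * (D * D) * D + D + κ + D + D * D * D := ⟨_, rfl⟩
  refine ⟨2 * C1 + D * (M0 + 1) ^ 2, by positivity, ?_⟩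
  intro K _ p k _ hroot hq f w g S hf hirr hfD hD hwD hw hgD hg hS
  set q := p ^ k with hqdef
  have hsq1 : (1 : ℝ) ≤ Real.sqrt q := by
    rw [Real.one_le_sqrt]; exact_mod_cast hq.le
  have hδ : 1 ≤ f.natDegree := by
    by_contra h
    have h0 : f.natDegree = 0 := by omega
    have := hf.natDegree_eq_zero.1 h0
    rw [this] at hirr
    exact not_irreducible_one hirr
  set δ := f.natDegree with hδdef
  set M := Nat.sqrt q with hM
  have hMq : M * M ≤ q := Nat.sqrt_le q
  have hMq' : q < (M + 1) * (M + 1) := Nat.sqrt_lt'.mp (Nat.lt_succ_self _) |> fun h => by rwa [sq] at h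
  by_cases hbig : M < M0
  · have h1 := trivial_bound hf hq S fun x hx => ⟨(hS x hx).1, (hS x hx).2.1⟩
    have h2 : q ≤ (M0 + 1) ^ 2 := by
      rw [sq]; exact hMq'.le.trans (Nat.mul_le_mul (by omega) (by omega))
    have h3 : S.card ≤ D * (M0 + 1) ^ 2 := h1.trans (Nat.mul_le_mul hfD h2)
    have h4 : (S.card : ℝ) ≤ D * (M0 + 1) ^ 2 := by exact_mod_cast h3
    have h5 : (0 : ℝ) ≤ q := by positivity
    have h6 : (0 : ℝ) ≤ 2 * C1 := by positivity
    have h7 : (0 : ℝ) ≤ (D : ℝ) * (M0 + 1) ^ 2 := by positivity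
    have h8 := mul_le_mul_of_nonneg_left hsq1 h7
    have h9 : 0 ≤ 2 * (C1 : ℝ) * Real.sqrt q := by positivity
    rw [add_mul]
    linarith
  · push Not at hbig
    have hDpos : 1 ≤ D := hδ.trans hfD
    obtain ⟨l, hl⟩ : ∃ l, l = q / (2 * δ) := ⟨_, rfl⟩
    have hl1 : 2 * δ * l ≤ q := by rw [hl]; exact Nat.mul_div_le _ _
    have hl2 : q < 2 * δ * (l + 1) := by
      rw [hl]; exact Nat.lt_mul_div_succ _ (by omega)
    obtain ⟨m, hm⟩ : ∃ m, m = (M + κ) / δ + 1 := ⟨_, rfl⟩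
    have hm1 : M + κ < δ * m := by rw [hm]; exact Nat.lt_mul_div_succ _ (by omega)
    have hm2 : δ * m ≤ M + κ + D := by
      rw [hm, mul_add, mul_one]
      have := Nat.mul_div_le (M + κ) δ
      omega
    have hmm : m ≤ δ * m := Nat.le_mul_of_pos_left _ (by omega)
    have hDδ : D * δ ≤ D * D := Nat.mul_le_mul_left _ hfD
    have hM1 : 1 ≤ M := by omega
    have hMM : M ≤ M * M := Nat.le_mul_self M
    have hmain := stepanov hf hirr hD p k hroot w g hwD hw hgD hg S hS (l := l) (m := m) (M := M)
      (T := 2 * (D + D * D) * M + l + m + κ1) (by omega) ?_ ?_ ?_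
    · rw [← hqdef, ← hδdef] at hmain
      have e1 : S.card * M ≤ q * M + q * C1 := by
        refine hmain.trans ?_
        have a1 : (l + D * δ + q * (m + D * δ) + D * δ + 1) * δ =
          l * δ + D * δ * δ + q * (δ * m) + q * (D * δ * δ) + D * δ * δ + δ := by ring
        rw [a1]
        have a2 : D * δ * δ ≤ D * D * D := Nat.mul_le_mul hDδ hfD
        have a3 : q * (δ * m) ≤ q * (M + κ + D) := Nat.mul_le_mul_left _ hm2
        have a4 : q * (D * δ * δ) ≤ q * (D * D * D) := Nat.mul_le_mul_left _ a2
        have a5 : l * δ ≤ q := by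
          have : 2 * δ * l = 2 * (l * δ) := by ring
          omega
        have a6 : D * D * D ≤ q * (D * D * D) := Nat.le_mul_of_pos_left _ (by omega)
        have a7 : δ ≤ q * D := hfD.trans (Nat.le_mul_of_pos_left _ (by omega))
        have a8 : q * C1 = q + 2 * (q * (D * D * D)) + q * D + q * κ + q * D + q * (D * D * D) := by
          rw [hC1]; ring
        have a9 : q * (M + κ + D) = q * M + q * κ + q * D := by ring
        omega
      have e2 : (S.card : ℝ) * M ≤ q * M + q * C1 := by exact_mod_cast e1
      have hMr : (1 : ℝ) ≤ M := by exact_mod_cast hM1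
      have e3 : Real.sqrt q ≤ 2 * M := by
        rw [Real.sqrt_le_left (by positivity)]
        have : (q : ℝ) ≤ (M + 1) * (M + 1) := by exact_mod_cast hMq'.le
        nlinarith
      have e4 : (q : ℝ) = Real.sqrt q * Real.sqrt q := by
        rw [Real.mul_self_sqrt (by positivity)]
      have e5 : (q : ℝ) * C1 ≤ Real.sqrt q * (2 * M) * C1 := by
        conv_lhs => rw [e4]
        gcongr
      have e6 : (S.card : ℝ) ≤ q + 2 * C1 * Real.sqrt q := by
        have e8 : (S.card : ℝ) * M ≤ (q + 2 * C1 * Real.sqrt q) * M := by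
          calc _ ≤ _ := e2
            _ ≤ q * M + Real.sqrt q * (2 * M) * C1 := by linarith
            _ = _ := by ring
        exact le_of_mul_le_mul_right e8 (by linarith)
      have e7 : (0 : ℝ) ≤ (D : ℝ) * (M0 + 1) ^ 2 * Real.sqrt q := by positivity
      rw [add_mul]
      linarith
    · rw [← hqdef, ← hδdef]
      have b1 : (l + D * δ + D * δ + 1) * δ = l * δ + (2 * (D * δ) + 1) * δ := by ring
      rw [b1]
      have b2 : (2 * (D * δ) + 1) * δ ≤ (2 * (D * D) + 1) * D := Nat.mul_le_mul (by omega) hfD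
      have b3 : 2 * (l * δ) ≤ q := by
        have : 2 * δ * l = 2 * (l * δ) := by ring
        omega
      omega
    · rw [← hδdef]
      have c1 : (D + D * D) * δ ≤ (D + D * D) * D := Nat.mul_le_mul_left _ hfD
      have c2 : 2 * (D + D * δ) * M ≤ 2 * (D + D * D) * M := Nat.mul_le_mul_right _ (by omega)
      omega
    · rw [← hδdef]
      have d0 : M * (2 * (D + D * D) * M + l + m + κ1) < l * (δ * m) := by
        have d1 : l * (M + κ) ≤ l * (δ * m) := Nat.mul_le_mul_left _ hm1.le
        have d2 : M * m ≤ M * (M + κ + D) := Nat.mul_le_mul_left _ (by omega)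
        have d3 : 2 * q ≤ 4 * D * l + 4 * D := by
          have : 2 * δ * (l + 1) ≤ 2 * D * (l + 1) := Nat.mul_le_mul_right _ (by omega)
          have h' : 2 * D * (l + 1) * 2 = 4 * D * l + 4 * D := by ring
          omega
        have d4 : k1 * (2 * (M * M)) ≤ k1 * (4 * D * l + 4 * D) := Nat.mul_le_mul_left _ (by omega)
        have d5 : M * (4 * D + κ + D + κ1 + 1) ≤ M * M := Nat.mul_le_mul_left _ (by omega)
        have d6 : l * κ = k1 * (4 * D * l) := by rw [hκ]; ring
        have d7 : k1 * (M * (4 * D + κ + D + κ1 + 1)) ≤ k1 * (M * M) := Nat.mul_le_mul_left _ d5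
        have d8 : k1 * (4 * D) ≤ k1 * (M * (4 * D)) :=
          Nat.mul_le_mul_left _ (Nat.le_mul_of_pos_left _ (by omega))
        have d9 : M * (κ + D + κ1 + 1) ≤ k1 * (M * (κ + D + κ1 + 1)) :=
          Nat.le_mul_of_pos_left _ (by omega)
        have d10 : k1 * (M * M) = 2 * (D + D * D) * (M * M) + M * M := by rw [hk1]; ring
        clear_value M δ q
        clear hm1 hm2 hmm hl1 hl2 hMq hMq' hsq1 hS hwD hgD hD
        nlinarith
      calc M * ((2 * (D + D * D) * M + l + m + κ1) * δ)
          = (M * (2 * (D + D * D) * M + l + m + κ1)) * δ := by ring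
        _ < (l * (δ * m)) * δ := Nat.mul_lt_mul_of_pos_right d0 (by omega)
        _ = _ := by ring
end FCE

namespace FCE

theorem exists_minor {F : Type*} [Field F] {r E : Type} [Fintype r] [DecidableEq r] [Fintype E]
    (A : r → E → F) (h : LinearIndependent F A) :
    ∃ c : r → E, Matrix.det (Matrix.of fun i j => A i (c j)) ≠ 0 := by
  classical
  let B : Matrix r E F := Matrix.of A
  have h1 : B.rank = Fintype.card r := LinearIndependent.rank_matrix (M := B) h
  rw [Matrix.rank_eq_finrank_span_cols] at h1
  have htop : Submodule.span F (Set.range B.col) = ⊤ := by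
    apply Submodule.eq_top_of_finrank_eq
    rw [h1]; simp
  obtain ⟨κ, a, ha, hsp, hli⟩ := exists_linearIndependent' F B.col
  rw [htop] at hsp
  let bs := Module.Basis.mk hli hsp.ge
  have : Finite κ := Finite.of_injective a ha
  have := Fintype.ofFinite κ
  have hcard : Fintype.card κ = Fintype.card r := by
    rw [← Module.finrank_eq_card_basis bs]; simp
  let e : r ≃ κ := Fintype.equivOfCardEq hcard.symm
  refine ⟨a ∘ e, ?_⟩
  have hli2 := hli.comp e e.injective
  set N : Matrix r r F := Matrix.of fun i j => A i ((a ∘ e) j) with hN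
  have h3 : IsUnit N := Matrix.linearIndependent_cols_iff_isUnit.1 hli2
  exact ((Matrix.isUnit_iff_isUnit_det _).1 h3).ne_zero

theorem coeff_swap {R : Type*} [CommRing R] (p : R[X][X]) (i j : ℕ) :
    ((Bivariate.swap p).coeff i).coeff j = (p.coeff j).coeff i := by
  induction p using Polynomial.induction_on' with
  | add p q hp hq => simp [hp, hq]
  | monomial n a =>
    induction a using Polynomial.induction_on' with
    | add p q hp hq => simp only [map_add, coeff_add, hp, hq]
    | monomial m r =>
      rw [Bivariate.swap_monomial_monomial]
      simp only [coeff_monomial]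
      split_ifs <;> simp_all [coeff_monomial]

theorem coeff_natDegree_le_swap {R : Type*} [CommRing R] (p : R[X][X]) (j : ℕ) :
    (p.coeff j).natDegree ≤ (Bivariate.swap p).natDegree := by
  rw [natDegree_le_iff_coeff_eq_zero]
  intro N hN
  rw [← coeff_swap, coeff_eq_zero_of_natDegree_lt hN, coeff_zero]

theorem swap_natDegree_le {R : Type*} [CommRing R] (p : R[X][X]) {D : ℕ}
    (h : ∀ j, (p.coeff j).natDegree ≤ D) : (Bivariate.swap p).natDegree ≤ D := by
  rw [natDegree_le_iff_coeff_eq_zero]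
  intro N hN
  ext j
  rw [coeff_swap, coeff_eq_zero_of_natDegree_lt ((h j).trans_lt hN), coeff_zero]

theorem factor_coeff_natDegree {R : Type*} [CommRing R] [IsDomain R] {G H : R[X][X]} {D : ℕ}
    (h : ∀ j, ((G * H).coeff j).natDegree ≤ D) (hne : G * H ≠ 0) (j : ℕ) :
    (G.coeff j).natDegree ≤ D := by
  refine (coeff_natDegree_le_swap G j).trans (le_trans ?_ (swap_natDegree_le _ h))
  rw [map_mul, natDegree_mul]
  · omega
  · simpa using left_ne_zero_of_mul hne
  · simpa using right_ne_zero_of_mul hne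

/-- irreducibility criterion by a power series root -/
theorem irreducible_of_ps {K : Type*} [Field K] {f : K[X][X]} (hf : f.Monic) (hf1 : 0 < f.natDegree)
    {D : ℕ} (hD : ∀ j, (f.coeff j).natDegree ≤ D) (α : PowerSeries K)
    (hα : f.eval₂ (eval₂RingHom PowerSeries.C PowerSeries.X) α = 0) {E : ℕ}
    (hind : LinearIndependent K (fun (x : Fin (D + 1) × Fin f.natDegree) (e : Fin E) =>
      PowerSeries.coeff e (PowerSeries.X ^ (x.1 : ℕ) * α ^ (x.2 : ℕ)))) : Irreducible f := by
  classical
  have key : ∀ G : K[X][X], G.natDegree < f.natDegree → (∀ j, (G.coeff j).natDegree ≤ D) →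
      G.eval₂ (eval₂RingHom PowerSeries.C PowerSeries.X) α = 0 → G = 0 := by
    intro G hG hGD h0
    rw [Fintype.linearIndependent_iff] at hind
    have h1 := hind (fun x => (G.coeff x.2).coeff x.1) (by
      funext e
      rw [Finset.sum_apply]
      simp only [Pi.smul_apply, smul_eq_mul, Pi.zero_apply]
      have h2 := congrArg (PowerSeries.coeff (e : ℕ)) h0
      rw [eval₂_eq_sum_range' _ hG, map_sum, map_zero] at h2
      rw [← h2, Finset.sum_range, Fintype.sum_prod_type_right]
      refine Finset.sum_congr rfl fun j _ => ?_
      rw [coe_eval₂RingHom, eval₂_eq_sum_range' _ (Nat.lt_succ_of_le (hGD j)), Finset.sum_mul, map_sum,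
        Finset.sum_range]
      refine Finset.sum_congr rfl fun i _ => ?_
      rw [mul_assoc, PowerSeries.coeff_C_mul])
    ext j i
    by_cases hj : j < f.natDegree
    · by_cases hi : i < D + 1
      · exact h1 (⟨i, hi⟩, ⟨j, hj⟩)
      · rw [coeff_eq_zero_of_natDegree_lt (p := G.coeff j) (by have := hGD j; omega)]; simp
    · rw [coeff_eq_zero_of_natDegree_lt (p := G) (by omega)]; simp
  rw [hf.irreducible_iff_natDegree']
  refine ⟨fun h => by rw [h] at hf1; simp at hf1, ?_⟩
  intro G H hG hH hGH hmem
  rw [Finset.mem_Ioc] at hmem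
  have hdeg : G.natDegree + H.natDegree = f.natDegree := by rw [← hGH, hG.natDegree_mul hH]
  rw [← hGH, eval₂_mul] at hα
  have hne : G * H ≠ 0 := by rw [hGH]; exact hf.ne_zero
  rw [← hGH] at hD
  rcases mul_eq_zero.1 hα with h | h
  · exact hG.ne_zero (key G (by omega) (factor_coeff_natDegree hD hne) h)
  · refine hH.ne_zero (key H (by omega) (factor_coeff_natDegree (G := H) (H := G) ?_ ?_) h)
    · rwa [mul_comm]
    · rwa [mul_comm]

end FCE

namespace FCE

theorem eval₂Hom_mem_fil {K σ A : Type*} [CommRing K] [CommRing A] {W : ℕ → AddSubgroup A} (hW : IsFil W)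
    (c : K →+* A) (v : σ → A) (hc : ∀ x, c x ∈ W 0) (hv : ∀ i, v i ∈ W 1) (g : MvPolynomial σ K)
    {D : ℕ} (hg : g.totalDegree ≤ D) : MvPolynomial.eval₂Hom c v g ∈ W D := by
  rw [MvPolynomial.coe_eval₂Hom, MvPolynomial.eval₂_eq]
  refine AddSubgroup.sum_mem _ fun m hm => ?_
  have h1 : ∀ s : Finset σ, ∏ i ∈ s, v i ^ m i ∈ W (∑ i ∈ s, m i) := by
    classical
    intro s
    induction s using Finset.induction_on with
    | empty => simpa using hW.one_mem
    | insert a s ha ih =>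
      rw [Finset.prod_insert ha, Finset.sum_insert ha]
      refine hW.mul_mem ?_ ih
      simpa using hW.pow_mem (hv a) (m a)
  have h2 := hW.mul_mem (hc (g.coeff m)) (h1 m.support)
  refine hW.mono ?_ h2
  rw [zero_add]
  exact (MvPolynomial.le_totalDegree hm).trans hg

/-- total degree filtration -/
noncomputable def FilM (σ K : Type*) [CommRing K] (m : ℕ) : AddSubgroup (MvPolynomial σ K) :=
  (MvPolynomial.restrictTotalDegree σ K m).toAddSubgroup

theorem mem_FilM {σ K : Type*} [CommRing K] {m : ℕ} {p : MvPolynomial σ K} :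
    p ∈ FilM σ K m ↔ p.totalDegree ≤ m := by
  unfold FilM; rw [Submodule.mem_toAddSubgroup, MvPolynomial.mem_restrictTotalDegree]

theorem isFil_FilM (σ K : Type*) [CommRing K] : IsFil (FilM σ K) where
  mono h x hx := by rw [mem_FilM] at *; omega
  one_mem := by rw [mem_FilM]; simp
  mul_mem hx hy := by
    rw [mem_FilM] at *
    exact (MvPolynomial.totalDegree_mul _ _).trans (by omega)

/-- polynomials over a filtered ring, with degree and coefficients bounded by `m` -/
def FilP {R : Type*} [CommRing R] {Fil : ℕ → AddSubgroup R} (_hF : IsFil Fil) (m : ℕ) : AddSubgroup R[X] where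
  carrier := {p | p.natDegree ≤ m ∧ ∀ k, p.coeff k ∈ Fil m}
  add_mem' := by
    rintro a b ⟨h1, h2⟩ ⟨h3, h4⟩
    exact ⟨natDegree_add_le_of_degree_le h1 h3, fun k => by
      rw [coeff_add]; exact (Fil m).add_mem (h2 k) (h4 k)⟩
  zero_mem' := ⟨by simp, fun k => by simp [(Fil m).zero_mem]⟩
  neg_mem' := by
    rintro a ⟨h1, h2⟩
    exact ⟨by rwa [natDegree_neg], fun k => by rw [coeff_neg]; exact (Fil m).neg_mem (h2 k)⟩

theorem isFil_FilP {R : Type*} [CommRing R] {Fil : ℕ → AddSubgroup R} (hF : IsFil Fil) :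
    IsFil (FilP hF) where
  mono h x hx := ⟨hx.1.trans h, fun k => hF.mono h (hx.2 k)⟩
  one_mem := ⟨by simp, fun k => by
    rw [coeff_one]; split_ifs
    exacts [hF.one_mem, (Fil 0).zero_mem]⟩
  mul_mem hx hy := ⟨natDegree_mul_le.trans (add_le_add hx.1 hy.1), fun k => by
    rw [coeff_mul]
    exact AddSubgroup.sum_mem _ fun x _ => hF.mul_mem (hx.2 _) (hy.2 _)⟩

section Line
variable {K : Type*} [Field K] {n : ℕ}

noncomputable def lineHom (P : Fin (n + 1) → K) :
    MvPolynomial (Fin (n + 1)) K →+* (MvPolynomial (Fin n) K)[X] :=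
  MvPolynomial.eval₂Hom ((C).comp MvPolynomial.C)
    (Fin.cons (C (MvPolynomial.C (P 0)) + X)
      (fun i => C (MvPolynomial.C (P i.succ)) + C (MvPolynomial.X i) * X))

theorem lineHom_mem (P : Fin (n + 1) → K) {g : MvPolynomial (Fin (n + 1)) K} {D : ℕ}
    (hg : g.totalDegree ≤ D) : lineHom P g ∈ FilP (isFil_FilM (Fin n) K) D := by
  have hW := isFil_FilP (isFil_FilM (Fin n) K)
  have hC : ∀ x : K, (C (MvPolynomial.C x) : (MvPolynomial (Fin n) K)[X]) ∈ FilP (isFil_FilM (Fin n) K) 0 := by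
    intro x
    refine ⟨by simp, fun k => ?_⟩
    rw [mem_FilM, coeff_C]; split_ifs <;> simp
  have hX : (X : (MvPolynomial (Fin n) K)[X]) ∈ FilP (isFil_FilM (Fin n) K) 1 := by
    refine ⟨by simp, fun k => ?_⟩
    rw [mem_FilM, coeff_X]; split_ifs <;> simp
  refine eval₂Hom_mem_fil hW _ _ hC ?_ g hg
  intro i
  refine Fin.cases ?_ (fun i => ?_) i
  · rw [Fin.cons_zero]
    exact AddSubgroup.add_mem _ (hW.mono zero_le_one (hC _)) hX
  · rw [Fin.cons_succ]
    refine AddSubgroup.add_mem _ (hW.mono zero_le_one (hC _)) ⟨?_, fun k => ?_⟩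
    · exact (natDegree_C_mul_le _ _).trans (by simp)
    · rw [mem_FilM, coeff_C_mul, coeff_X]; split_ifs <;> simp

theorem eval_zero_lineHom (P : Fin (n + 1) → K) :
    (eval₂RingHom (RingHom.id _) 0).comp (lineHom P) =
      (MvPolynomial.C).comp (MvPolynomial.eval P) := by
  apply MvPolynomial.ringHom_ext
  · intro r; simp [lineHom]
  · intro i
    refine Fin.cases ?_ (fun i => ?_) i <;> simp [lineHom]

theorem hensel_line (P : Fin (n + 1) → K) (β : K) (f : (MvPolynomial (Fin (n + 1)) K)[X]) {D : ℕ}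
    (hDf : ∀ j, (f.coeff j).totalDegree ≤ D)
    (h0 : (f.map (MvPolynomial.eval P)).eval β = 0)
    (h1 : ((derivative f).map (MvPolynomial.eval P)).eval β ≠ 0) :
    ∃ α : PowerSeries (MvPolynomial (Fin n) K), PB (FilM (Fin n) K) (2 * D) 0 α ∧
      (f.map (lineHom P)).eval₂ (eval₂RingHom PowerSeries.C PowerSeries.X) α = 0 := by
  set ft := f.map (lineHom P) with hft
  have hFil := isFil_FilM (Fin n) K
  set c := ((derivative f).map (MvPolynomial.eval P)).eval β with hc
  set b0 : ℕ → ℕ → MvPolynomial (Fin n) K := fun i j =>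
    (hD i j ft).eval₂ (eval₂RingHom (RingHom.id _) 0) (MvPolynomial.C β) with hb0
  have hval : ∀ g : (MvPolynomial (Fin (n + 1)) K)[X],
      (g.map (lineHom P)).eval₂ (eval₂RingHom (RingHom.id _) 0) (MvPolynomial.C β) =
        MvPolynomial.C ((g.map (MvPolynomial.eval P)).eval β) := by
    intro g
    rw [eval₂_map, eval_zero_lineHom, eval_map, hom_eval₂]
  have hcoef : ∀ k l, ((ft.coeff k).coeff l).totalDegree ≤ D := by
    intro k l
    rw [hft, coeff_map]
    exact mem_FilM.1 ((lineHom_mem P (hDf k)).2 l)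
  have hdeg : ∀ k, (ft.coeff k).natDegree ≤ D := by
    intro k
    rw [hft, coeff_map]
    exact (lineHom_mem P (hDf k)).1
  have hbD : ∀ i j, b0 i j ∈ FilM (Fin n) K D := by
    intro i j
    rw [hb0]
    simp only
    rw [eval₂_eq_sum_range]
    refine AddSubgroup.sum_mem _ fun k _ => ?_
    rw [← add_zero D]
    refine hFil.mul_mem ?_ ?_
    · rw [coe_eval₂RingHom, eval₂_at_zero, RingHom.id_apply, hD, finsetSum_coeff, finsetSum_coeff]
      refine AddSubgroup.sum_mem _ fun l _ => ?_
      rw [coeff_C_mul, coeff_X_pow]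
      split_ifs
      · rw [mul_one, ← nsmul_eq_mul, coeff_smul]
        refine AddSubgroup.nsmul_mem _ ?_ _
        rw [hasseDeriv_coeff, ← nsmul_eq_mul]
        exact AddSubgroup.nsmul_mem _ (mem_FilM.2 (hcoef _ _)) _
      · rw [mul_zero, coeff_zero]; exact AddSubgroup.zero_mem _
    · rw [mem_FilM, ← map_pow, MvPolynomial.totalDegree_C]
  obtain ⟨p, hp, hsum⟩ := hensel_core hFil D (D + 1) (ft.natDegree + 2)
    (fun i j => MvPolynomial.C c⁻¹ * b0 i j) (by omega) (by omega) (by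
      simp only [hb0]; rw [hD_zero_zero, hft, hval, h0]; simp) (by
      simp only [hb0]; rw [hD_zero_one, hft, derivative_map, hval, ← hc, ← map_mul,
        inv_mul_cancel₀ h1, map_one]) (by
      intro i j hij hne
      rw [← zero_add (D * _)]
      refine hFil.mul_mem (by rw [mem_FilM]; simp) (hFil.mono ?_ (hbD i j))
      have : 1 ≤ 2 * i + j - 1 := by
        by_contra hlt
        apply hne
        rw [Prod.mk.injEq]; omega
      nlinarith)
  refine ⟨PowerSeries.C (MvPolynomial.C β) + PowerSeries.X ^ 1 * p, ?_, ?_⟩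
  · refine PB.add hFil (PB.C_mem hFil (by rw [mem_FilM]; simp)) (PB.X_pow_mul hFil hp (by omega))
  · have ht := taylor2 PowerSeries.C ft 0 (PowerSeries.C (MvPolynomial.C β)) PowerSeries.X
      (PowerSeries.X ^ 1 * p) (I := D + 1) (J := ft.natDegree + 2)
      (fun k => Nat.lt_succ_of_le (hdeg k)) (by omega)
    rw [zero_add] at ht
    rw [ht]
    have h2 : ∀ i j, (hD i j ft).eval₂ (eval₂RingHom PowerSeries.C 0) (PowerSeries.C (MvPolynomial.C β)) =
        PowerSeries.C (MvPolynomial.C c) * PowerSeries.C (MvPolynomial.C c⁻¹ * b0 i j) := by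
      intro i j
      rw [← map_mul, ← mul_assoc, ← map_mul, mul_inv_cancel₀ h1, map_one, one_mul, hb0]
      simp only
      rw [hom_eval₂]
      congr 1
      apply Polynomial.ringHom_ext <;> simp
    simp only [h2]
    refine Eq.trans ?_ ((congrArg (PowerSeries.C (MvPolynomial.C c) * ·) hsum).trans (mul_zero _))
    rw [Finset.mul_sum]
    refine Finset.sum_congr rfl fun i _ => ?_
    rw [Finset.mul_sum]
    refine Finset.sum_congr rfl fun j _ => ?_
    rw [pow_one]; ring

end Line
end FCE

namespace FCE
section Line
variable {K : Type*} [Field K] {n : ℕ}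

theorem line_irreducible (P : Fin (n + 1) → K) {f : (MvPolynomial (Fin (n + 1)) K)[X]} (hf : f.Monic)
    (hirr : Irreducible f) :
    Irreducible ((f.map (lineHom P)).map
      (mapRingHom (algebraMap (MvPolynomial (Fin n) K) (FractionRing (MvPolynomial (Fin n) K))))) := by
  let x : Fin (n + 1) → (FractionRing (MvPolynomial (Fin (n + 1)) K)) := fun i => algebraMap (MvPolynomial (Fin (n + 1)) K) (FractionRing (MvPolynomial (Fin (n + 1)) K)) (MvPolynomial.X i)
  let k : K →+* (FractionRing (MvPolynomial (Fin (n + 1)) K)) := (algebraMap (MvPolynomial (Fin (n + 1)) K) (FractionRing (MvPolynomial (Fin (n + 1)) K))).comp MvPolynomial.C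
  have hx0 : x 0 - k (P 0) ≠ 0 := by
    simp only [x, k, RingHom.comp_apply]
    rw [← map_sub]
    intro h
    rw [FaithfulSMul.algebraMap_eq_zero_iff] at h
    have h2 := congrArg (MvPolynomial.eval (fun _ => P 0 + 1)) h
    simp at h2
  let μ0 : (MvPolynomial (Fin n) K) →+* (FractionRing (MvPolynomial (Fin (n + 1)) K)) := MvPolynomial.eval₂Hom k (fun i => (x i.succ - k (P i.succ)) / (x 0 - k (P 0)))
  let μ : (MvPolynomial (Fin n) K)[X] →+* (FractionRing (MvPolynomial (Fin (n + 1)) K)) := eval₂RingHom μ0 (x 0 - k (P 0))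
  have hμ : μ.comp (lineHom P) = algebraMap (MvPolynomial (Fin (n + 1)) K) (FractionRing (MvPolynomial (Fin (n + 1)) K)) := by
    apply MvPolynomial.ringHom_ext
    · intro r; simp [lineHom, μ, μ0, k]
    · intro i
      refine Fin.cases ?_ (fun i => ?_) i
      · simp [lineHom, μ, μ0, x]
      · simp only [lineHom, μ, μ0, RingHom.comp_apply, MvPolynomial.coe_eval₂Hom, MvPolynomial.eval₂_X,
          Fin.cons_succ, coe_eval₂RingHom, eval₂_add, eval₂_C, eval₂_mul, eval₂_X, MvPolynomial.eval₂_C]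
        rw [div_mul_cancel₀ _ hx0]; simp [x]
  have hinj : Function.Injective (lineHom P) := by
    have : Function.Injective (μ.comp (lineHom P)) := by
      rw [hμ]; exact FaithfulSMul.algebraMap_injective (MvPolynomial (Fin (n + 1)) K) (FractionRing (MvPolynomial (Fin (n + 1)) K))
    exact Function.Injective.of_comp (f := μ) this
  let lam : (MvPolynomial (Fin (n + 1)) K) →+* FractionRing (MvPolynomial (Fin n) K)[X] := (algebraMap (MvPolynomial (Fin n) K)[X] (FractionRing (MvPolynomial (Fin n) K)[X])).comp (lineHom P)
  have hlam : Function.Injective lam := (FaithfulSMul.algebraMap_injective (MvPolynomial (Fin n) K)[X] (FractionRing (MvPolynomial (Fin n) K)[X])).comp hinj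
  let lam' : (FractionRing (MvPolynomial (Fin (n + 1)) K)) →+* FractionRing (MvPolynomial (Fin n) K)[X] := IsFractionRing.lift hlam
  have hlam' : ∀ b : (MvPolynomial (Fin (n + 1)) K), lam' (algebraMap (MvPolynomial (Fin (n + 1)) K) (FractionRing (MvPolynomial (Fin (n + 1)) K)) b) = lam b := fun b => IsFractionRing.lift_algebraMap hlam b
  have hcomp : lam'.comp μ0 = (algebraMap (MvPolynomial (Fin n) K)[X] (FractionRing (MvPolynomial (Fin n) K)[X])).comp C := by
    apply MvPolynomial.ringHom_ext
    · intro r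
      simp only [RingHom.comp_apply, μ0, k, MvPolynomial.coe_eval₂Hom, MvPolynomial.eval₂_C, hlam', lam]
      simp [lineHom]
    · intro i
      simp only [RingHom.comp_apply, μ0, k, x, MvPolynomial.coe_eval₂Hom, MvPolynomial.eval₂_X, map_div₀,
        map_sub, hlam', lam]
      rw [div_eq_iff]
      · simp [lineHom]
      · simp [lineHom]
  have hμ0 : Function.Injective μ0 := by
    have : Function.Injective (lam'.comp μ0) := by
      rw [hcomp]; exact (FaithfulSMul.algebraMap_injective (MvPolynomial (Fin n) K)[X] (FractionRing (MvPolynomial (Fin n) K)[X])).comp C_injective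
    exact Function.Injective.of_comp (f := lam') this
  let ν : (FractionRing (MvPolynomial (Fin n) K)) →+* (FractionRing (MvPolynomial (Fin (n + 1)) K)) := IsFractionRing.lift hμ0
  let Φ : (FractionRing (MvPolynomial (Fin n) K))[X] →+* (FractionRing (MvPolynomial (Fin (n + 1)) K)) := eval₂RingHom ν (x 0 - k (P 0))
  have hΦ : (Φ.comp (mapRingHom (algebraMap (MvPolynomial (Fin n) K) (FractionRing (MvPolynomial (Fin n) K))))).comp (lineHom P) = algebraMap (MvPolynomial (Fin (n + 1)) K) (FractionRing (MvPolynomial (Fin (n + 1)) K)) := by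
    rw [← hμ]
    congr 1
    apply Polynomial.ringHom_ext
    · intro a; simp only [Φ, ν, μ, RingHom.comp_apply, coe_mapRingHom, map_C, coe_eval₂RingHom, eval₂_C]
      exact IsFractionRing.lift_algebraMap hμ0 a
    · simp [Φ, μ]
  refine Monic.irreducible_of_irreducible_map Φ _ ((hf.map _).map _) ?_
  rw [Polynomial.map_map, Polynomial.map_map, hΦ]
  exact (hf.irreducible_iff_irreducible_map_fraction_map (K := (FractionRing (MvPolynomial (Fin (n + 1)) K)))).1 hirr

end Line
end FCE

namespace FCE

theorem totalDegree_det_le {σ K r : Type*} [CommRing K] [Fintype r] [DecidableEq r]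
    (M : Matrix r r (MvPolynomial σ K)) {b : ℕ} (h : ∀ i j, (M i j).totalDegree ≤ b) :
    M.det.totalDegree ≤ Fintype.card r * b := by
  rw [Matrix.det_apply, ← mem_FilM]
  refine AddSubgroup.sum_mem _ fun s _ => ?_
  have : ∏ i, M (s i) i ∈ FilM σ K (Fintype.card r * b) := by
    rw [mem_FilM]
    refine (MvPolynomial.totalDegree_finsetProd _ _).trans ?_
    refine (Finset.sum_le_card_nsmul _ _ b fun i _ => h _ _).trans ?_
    simp
  rcases Int.units_eq_one_or (Equiv.Perm.sign s) with h1 | h1 <;> rw [h1]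
  · simpa using this
  · rw [Units.neg_smul, one_smul]; exact AddSubgroup.neg_mem _ this

section Line
variable {K : Type*} [Field K] {n : ℕ}

/-- restriction to the line through `P` with direction `(1,t)` -/
noncomputable def lineAt (P : Fin (n + 1) → K) (t : Fin n → K) : MvPolynomial (Fin (n + 1)) K →+* K[X] :=
  (mapRingHom (MvPolynomial.eval t)).comp (lineHom P)

theorem good_lines (P : Fin (n + 1) → K) (β : K) (f : (MvPolynomial (Fin (n + 1)) K)[X]) {D : ℕ}
    (hf : f.Monic) (hirr : Irreducible f) (hδ : f.natDegree ≤ D)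
    (hDf : ∀ j, (f.coeff j).totalDegree ≤ D)
    (h0 : (f.map (MvPolynomial.eval P)).eval β = 0)
    (h1 : ((derivative f).map (MvPolynomial.eval P)).eval β ≠ 0) :
    ∃ z : MvPolynomial (Fin n) K, z ≠ 0 ∧
      z.totalDegree ≤ ((D + 1) * D) * (2 * D * ((D + 1 + D * D + D * D + 1) * D + 1)) ∧
      ∀ t, MvPolynomial.eval t z ≠ 0 → Irreducible (f.map (lineAt P t)) := by
  classical
  obtain ⟨α, hα, hroot⟩ := hensel_line P β f hDf h0 h1
  have hFil := isFil_FilM (Fin n) K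
  let ι := algebraMap (MvPolynomial (Fin n) K) (FractionRing (MvPolynomial (Fin n) K))
  have hιinj : Function.Injective ι := FaithfulSMul.algebraMap_injective _ _
  have hpos : 0 < f.natDegree := by
    rcases Nat.eq_zero_or_pos f.natDegree with h | h
    · exact absurd (hf.natDegree_eq_zero.1 h) (fun h => hirr.not_isUnit (h ▸ isUnit_one))
    · exact h
  -- transporting the root
  have hmap : ∀ {A : Type _} [CommRing A] (φ : MvPolynomial (Fin n) K →+* A),
      ((f.map (lineHom P)).map (mapRingHom φ)).eval₂ (eval₂RingHom PowerSeries.C PowerSeries.X)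
        (PowerSeries.map φ α) = 0 := by
    intro A _ φ
    rw [eval₂_map]
    have := congrArg (PowerSeries.map φ) hroot
    rw [hom_eval₂, map_zero] at this
    rw [← this]
    congr 1
    apply Polynomial.ringHom_ext <;> simp
  set fF := (f.map (lineHom P)).map (mapRingHom ι) with hfF
  have hFm : fF.Monic := (hf.map _).map _
  have hFirr : Irreducible fF := line_irreducible P hf hirr
  have hFdeg : fF.natDegree = f.natDegree := by
    rw [hfF, (hf.map _).natDegree_map, hf.natDegree_map]
  have hdeg : ∀ k, ((f.map (lineHom P)).coeff k).natDegree ≤ D := by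
    intro k; rw [coeff_map]; exact (lineHom_mem P (hDf k)).1
  have hFD : ∀ j, (fF.coeff j).natDegree ≤ D := by
    intro j; rw [hfF, coeff_map]; exact natDegree_map_le.trans (hdeg j)
  set E := (D + 1 + D * f.natDegree + D * f.natDegree + 1) * f.natDegree + 1 with hE
  let ev : AdjoinRoot fF →+* PowerSeries (FractionRing (MvPolynomial (Fin n) K)) :=
    AdjoinRoot.lift (eval₂RingHom PowerSeries.C PowerSeries.X) (PowerSeries.map ι α) (hmap ι)
  have hevC : ∀ c, ev (algebraMap _ _ c) = PowerSeries.C c := by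
    intro c
    rw [← mk_C_C]; simp [ev]
  have hevs : ev (sQ fF) = PowerSeries.X := by simp [ev, sQ]
  have hevt : ev (tQ fF) = PowerSeries.map ι α := by simp [ev, tQ]
  let A : Fin (D + 1) × Fin f.natDegree → Fin E → MvPolynomial (Fin n) K := fun x e =>
    PowerSeries.coeff e (PowerSeries.X ^ (x.1 : ℕ) * α ^ (x.2 : ℕ))
  have hA : LinearIndependent (FractionRing (MvPolynomial (Fin n) K)) (fun x e => ι (A x e)) := by
    rw [Fintype.linearIndependent_iff]
    intro d hd
    by_contra hne
    push Not at hne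
    let d' : Fin (D + 1) × Fin fF.natDegree → FractionRing (MvPolynomial (Fin n) K) :=
      fun x => d (x.1, Fin.cast hFdeg x.2)
    have hd' : d' ≠ 0 := by
      obtain ⟨x, hx⟩ := hne
      intro h
      apply hx
      exact congrFun h (x.1, Fin.cast hFdeg.symm x.2)
    refine ev_ne_zero hFm hFirr hFD ev hevC 0 1 (by rw [hevs]; simp) one_ne_zero (lin_ne_zero hFm hd')
      (VQ_le_FilQ D _ (lin_mem (D + 1) d')) (M := E) (by rw [hFdeg, hE]; omega) ?_
    rw [PowerSeries.X_pow_dvd_iff]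
    intro e he
    have h3 := congrFun hd ⟨e, he⟩
    rw [Finset.sum_apply] at h3
    simp only [Pi.smul_apply, Pi.zero_apply, smul_eq_mul] at h3
    rw [← h3, map_sum, map_sum]
    refine Fintype.sum_equiv (Equiv.prodCongr (Equiv.refl _) (finCongr hFdeg)) _ _ ?_
    intro x
    rw [Algebra.smul_def, map_mul, hevC, PowerSeries.coeff_C_mul]
    simp only [famQ, map_mul, map_pow, hevs, hevt, d', A]
    congr 1
    rw [← PowerSeries.coeff_map]
    simp
  obtain ⟨c, hc⟩ := exists_minor _ hA
  let z := Matrix.det (Matrix.of fun i j => A i (c j))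
  have hz : ι z = Matrix.det (Matrix.of fun i j => ι (A i (c j))) := by
    simp only [z]; rw [RingHom.map_det]; rfl
  have hEle : E ≤ (D + 1 + D * D + D * D + 1) * D + 1 := by
    rw [hE]
    have : D * f.natDegree ≤ D * D := Nat.mul_le_mul_left _ hδ
    gcongr
  refine ⟨z, fun h => hc (by rw [← hz, h, map_zero]), ?_, ?_⟩
  · refine (totalDegree_det_le _ (b := 2 * D * E) ?_).trans ?_
    · intro i j
      have : PB (FilM (Fin n) K) (2 * D) 0 (PowerSeries.X ^ (i.1 : ℕ) * α ^ (i.2 : ℕ)) :=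
        PB.X_pow_mul hFil (PB.pow hFil hα _) (by simp)
      have h2 := mem_FilM.1 (this (c j))
      refine h2.trans ?_
      rw [add_zero]
      exact Nat.mul_le_mul_left _ (c j).2.le
    · rw [Fintype.card_prod, Fintype.card_fin, Fintype.card_fin]
      gcongr
  · intro t ht
    have hmm : f.map (lineAt P t) = (f.map (lineHom P)).map (mapRingHom (MvPolynomial.eval t)) := by
      rw [Polynomial.map_map]; rfl
    rw [hmm]
    have hdeg' : ((f.map (lineHom P)).map (mapRingHom (MvPolynomial.eval t))).natDegree = f.natDegree := by
      rw [(hf.map _).natDegree_map, hf.natDegree_map]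
    refine irreducible_of_ps ((hf.map _).map _) (by rw [hdeg']; exact hpos) (D := D)
      (fun j => by rw [coeff_map]; exact natDegree_map_le.trans (hdeg j)) _ (hmap _) (E := E) ?_
    have hdet : Matrix.det (Matrix.of fun i j => MvPolynomial.eval t (A i (c j))) ≠ 0 := by
      intro h; apply ht; simp only [z]; rw [RingHom.map_det]; exact h
    have hrows := Matrix.linearIndependent_rows_of_isUnit
      ((Matrix.isUnit_iff_isUnit_det _).2 (isUnit_iff_ne_zero.2 hdet))
    have hli : LinearIndependent K (fun (x : Fin (D + 1) × Fin f.natDegree) (e : Fin E) =>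
        MvPolynomial.eval t (A x e)) := by
      refine LinearIndependent.of_comp (LinearMap.funLeft K K c) ?_
      exact hrows
    have := hli.comp (Equiv.prodCongr (Equiv.refl _) (finCongr hdeg')) (Equiv.injective _)
    convert this using 1
    funext x e
    simp only [A, Function.comp]
    rw [← PowerSeries.coeff_map]
    simp
end Line
end FCE

namespace FCE

theorem fiber_bound {A K : Type*} [Field K] [DecidableEq A] (G : A → K[X]) (D : ℕ) (hG : ∀ a, G a ≠ 0)
    (hD : ∀ a, (G a).natDegree ≤ D) (S : Finset (A × K)) (hS : ∀ x ∈ S, (G x.1).eval x.2 = 0)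
    (T : Finset A) (hT : ∀ x ∈ S, x.1 ∈ T) : S.card ≤ D * T.card := by
  classical
  refine (Finset.card_le_mul_card_image (f := Prod.fst) S D ?_).trans ?_
  · intro a _
    have : (S.filter fun x => x.1 = a).card ≤ (G a).roots.toFinset.card := by
      refine Finset.card_le_card_of_injOn Prod.snd ?_ ?_
      · intro x hx
        simp only [Finset.coe_filter, Set.mem_ofPred_eq] at hx
        simp only [Finset.mem_coe, Multiset.mem_toFinset, mem_roots (hG a), IsRoot.def]
        rw [← hx.2]; exact hS x hx.1
      · intro x hx y hy hxy
        simp only [Finset.coe_filter, Set.mem_ofPred_eq] at hx hy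
        exact Prod.ext (hx.2.trans hy.2.symm) hxy
    exact this.trans ((Multiset.toFinset_card_le _).trans ((card_roots' _).trans (hD a)))
  · refine Nat.mul_le_mul_left _ (Finset.card_le_card ?_)
    intro a ha
    obtain ⟨x, hx, rfl⟩ := Finset.mem_image.1 ha
    exact hT x hx

theorem evalEval_lineAt {K : Type*} [Field K] {n : ℕ} (P : Fin (n + 1) → K) (t : Fin n → K)
    (G : (MvPolynomial (Fin (n + 1)) K)[X]) (s y : K) (a : Fin (n + 1) → K) (h0 : a 0 = P 0 + s)
    (hs : ∀ i : Fin n, a i.succ = P i.succ + t i * s) :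
    (G.map (lineAt P t)).evalEval s y = (G.map (MvPolynomial.eval a)).eval y := by
  have h1 : (evalRingHom s).comp (lineAt P t) = MvPolynomial.eval a := by
    apply MvPolynomial.ringHom_ext
    · intro r; simp [lineAt, lineHom]
    · intro i
      refine Fin.cases ?_ (fun i => ?_) i <;> simp [lineAt, lineHom, h0, hs]
  rw [← h1, ← Polynomial.map_map, map_evalRingHom_eval]

theorem lineAt_degree {K : Type*} [Field K] {n : ℕ} (P : Fin (n + 1) → K) (t : Fin n → K)
    (G : (MvPolynomial (Fin (n + 1)) K)[X]) {D : ℕ} (hD : ∀ j, (G.coeff j).totalDegree ≤ D) (j : ℕ) :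
    ((G.map (lineAt P t)).coeff j).natDegree ≤ D := by
  rw [coeff_map]
  exact natDegree_map_le.trans (lineHom_mem P (hD j)).1

set_option maxHeartbeats 1000000 in
theorem LW.{u} (n D : ℕ) : ∃ C : ℝ, 0 ≤ C ∧ ∀ (Fq : Type) [Field Fq] [Fintype Fq] (K : Type u) [Field K]
    [Algebra Fq K] (p k : ℕ) [ExpChar K p] (_ : ∀ x : K, ∃ y, y ^ (p ^ k) = x)
    (_ : Fintype.card Fq = p ^ k)
    (f w g : (MvPolynomial (Fin (n + 1)) K)[X]) (S : Finset ((Fin (n + 1) → Fq) × K)),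
    f.Monic → Irreducible f → f.natDegree ≤ D → (∀ j, (f.coeff j).totalDegree ≤ D) →
    (∀ j, (w.coeff j).totalDegree ≤ D) → w.natDegree ≤ D →
    (∀ j, (g.coeff j).totalDegree ≤ D) → g.natDegree ≤ D →
    (∀ x ∈ S, (f.map (MvPolynomial.eval (fun i => algebraMap Fq K (x.1 i)))).eval x.2 = 0 ∧
      ((derivative f).map (MvPolynomial.eval (fun i => algebraMap Fq K (x.1 i)))).eval x.2 ≠ 0 ∧
      (w.map (MvPolynomial.eval (fun i => algebraMap Fq K (x.1 i)))).eval x.2 ≠ 0 ∧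
      (w.map (MvPolynomial.eval (fun i => algebraMap Fq K (x.1 i)))).eval x.2 * x.2 ^ (p ^ k) =
        (g.map (MvPolynomial.eval (fun i => algebraMap Fq K (x.1 i)))).eval x.2) →
    (S.card : ℝ) ≤ (Fintype.card Fq : ℝ) ^ (n + 1) +
      C * (Fintype.card Fq : ℝ) ^ n * Real.sqrt (Fintype.card Fq) := by
  obtain ⟨C1, hC1, hLW⟩ := LW1.{u} D
  obtain ⟨Bd, hBd⟩ : ∃ Bd, Bd = ((D + 1) * D) * (2 * D * ((D + 1 + D * D + D * D + 1) * D + 1)) := ⟨_, rfl⟩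
  refine ⟨C1 + D + Bd * D, by positivity, ?_⟩
  intro Fq _ _ K _ _ p k _ hroot hcard f w g S hf hirr hδ hDf hDw hw hDg hg hS
  classical
  set q := Fintype.card Fq with hq
  have hq1 : 1 < q := Fintype.one_lt_card
  have hsq1 : (1 : ℝ) ≤ Real.sqrt q := by
    rw [Real.one_le_sqrt]; exact_mod_cast hq1.le
  have hq0 : (0 : ℝ) < q := by positivity
  rcases S.eq_empty_or_nonempty with rfl | ⟨⟨P, β⟩, hPS⟩
  · rw [Finset.card_empty, Nat.cast_zero]; positivity
  let P' : Fin (n + 1) → K := fun i => algebraMap Fq K (P i)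
  obtain ⟨z, hz0, hzdeg, hz⟩ := good_lines P' β f hf hirr hδ hDf (hS _ hPS).1 (hS _ hPS).2.1
  rw [← hBd] at hzdeg
  let ev : (Fin (n + 1) → Fq) → K[X] := fun a =>
    f.map (MvPolynomial.eval (fun i => algebraMap Fq K (a i)))
  have hev0 : ∀ a, ev a ≠ 0 := fun a => (hf.map _).ne_zero
  have hevD : ∀ a, (ev a).natDegree ≤ D := fun a => natDegree_map_le.trans hδ
  let S0 := S.filter fun x => x.1 0 = P 0
  let S1 := S.filter fun x => ¬ x.1 0 = P 0
  have hsplit : S.card = S0.card + S1.card := (Finset.card_filter_add_card_filter_not _).symm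
  have hS0 : S0.card ≤ D * q ^ n := by
    have hle := fiber_bound ev D hev0 hevD S0 (fun x hx => (hS x (Finset.mem_filter.1 hx).1).1)
      (Finset.univ.image fun v : Fin n → Fq => (Fin.cons (P 0) v : Fin (n + 1) → Fq)) (by
        intro x hx
        rw [Finset.mem_image]
        refine ⟨fun i => x.1 i.succ, Finset.mem_univ _, ?_⟩
        rw [← (Finset.mem_filter.1 hx).2]
        exact Fin.cons_self_tail _)
    refine hle.trans (Nat.mul_le_mul_left _ (Finset.card_image_le.trans ?_))
    simp [hq]
  let τ : (Fin (n + 1) → Fq) × K → (Fin n → Fq) := fun x i => (x.1 i.succ - P i.succ) / (x.1 0 - P 0)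
  let St : (Fin n → Fq) → Finset ((Fin (n + 1) → Fq) × K) := fun t => S1.filter fun x => τ x = t
  have hsum : S1.card = ∑ t, (St t).card :=
    Finset.card_eq_sum_card_fiberwise (fun x _ => Finset.mem_coe.2 (Finset.mem_univ _))
  have hmem : ∀ t, ∀ x ∈ St t, x ∈ S ∧ x.1 0 ≠ P 0 ∧
      ∀ i : Fin n, x.1 i.succ = P i.succ + t i * (x.1 0 - P 0) := by
    intro t x hx
    simp only [St, S1, Finset.mem_filter] at hx
    refine ⟨hx.1.1, hx.1.2, fun i => ?_⟩
    rw [← hx.2]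
    simp only [τ]
    rw [div_mul_cancel₀ _ (sub_ne_zero.2 hx.1.2)]; ring
  have hptinj : ∀ t, ∀ x ∈ St t, ∀ y ∈ St t, x.1 0 = y.1 0 → x.1 = y.1 := by
    intro t x hx y hy hxy
    funext i
    refine Fin.cases hxy (fun i => ?_) i
    rw [(hmem t x hx).2.2, (hmem t y hy).2.2, hxy]
  have hbad : ∀ t, (St t).card ≤ D * q := by
    intro t
    have hle := fiber_bound ev D hev0 hevD (St t) (fun x hx => (hS x (hmem t x hx).1).1)
      (Finset.univ.image fun s : Fq => (Fin.cons (P 0 + s) (fun i => P i.succ + t i * s) : Fin (n + 1) → Fq)) (by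
        intro x hx
        rw [Finset.mem_image]
        refine ⟨x.1 0 - P 0, Finset.mem_univ _, ?_⟩
        funext i
        refine Fin.cases ?_ (fun i => ?_) i
        · simp
        · rw [Fin.cons_succ, (hmem t x hx).2.2])
    refine hle.trans (Nat.mul_le_mul_left _ (Finset.card_image_le.trans ?_))
    simp [hq]
  have hgood : ∀ t : Fin n → Fq, MvPolynomial.eval (fun i => algebraMap Fq K (t i)) z ≠ 0 →
      ((St t).card : ℝ) ≤ q + C1 * Real.sqrt q := by
    intro t ht
    let emb : (Fin (n + 1) → Fq) × K → K × K := fun x => (algebraMap Fq K (x.1 0 - P 0), x.2)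
    have hinj : Set.InjOn emb (St t) := by
      intro x hx y hy hxy
      simp only [emb, Prod.mk.injEq] at hxy
      have h1 := (algebraMap Fq K).injective hxy.1
      exact Prod.ext (hptinj t x hx y hy (by linear_combination h1)) hxy.2
    rw [← Finset.card_image_of_injOn hinj, hcard]
    refine hLW K p k hroot (by omega) (f.map (lineAt P' fun i => algebraMap Fq K (t i)))
      (w.map (lineAt P' fun i => algebraMap Fq K (t i))) (g.map (lineAt P' fun i => algebraMap Fq K (t i)))
      _ (hf.map _) (hz _ ht) (natDegree_map_le.trans hδ) (lineAt_degree _ _ _ hDf)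
      (lineAt_degree _ _ _ hDw) (natDegree_map_le.trans hw) (lineAt_degree _ _ _ hDg)
      (natDegree_map_le.trans hg) ?_
    intro y hy
    obtain ⟨x, hx, rfl⟩ := Finset.mem_image.1 hy
    obtain ⟨hxS, hx0, hxs⟩ := hmem t x hx
    have hE : ∀ G : (MvPolynomial (Fin (n + 1)) K)[X],
        (G.map (lineAt P' fun i => algebraMap Fq K (t i))).evalEval (emb x).1 (emb x).2 =
        (G.map (MvPolynomial.eval (fun i => algebraMap Fq K (x.1 i)))).eval x.2 := by
      intro G
      refine evalEval_lineAt _ _ _ _ _ _ ?_ ?_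
      · simp [emb, P']
      · intro i; simp only [emb, P']; rw [hxs i]; simp
    rw [derivative_map, hE, hE, hE, hE]
    refine ⟨?_, hS x hxS⟩
    simp only [emb]
    rw [← map_pow, ← hcard, FiniteField.pow_card]
  let Bad : Finset (Fin n → Fq) := Finset.univ.filter fun t =>
    MvPolynomial.eval (fun i => algebraMap Fq K (t i)) z = 0
  have hBad : (Bad.card : ℝ) * q ≤ Bd * q ^ n := by
    have h1 := MvPolynomial.schwartz_zippel_totalDegree hz0 (Finset.univ.image (algebraMap Fq K))
    rw [Finset.card_image_of_injective _ (algebraMap Fq K).injective, Finset.card_univ, ← hq] at h1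
    have h2 : Bad.card ≤ (Finset.filter (fun v => MvPolynomial.eval v z = 0)
        (Fintype.piFinset fun _ : Fin n => Finset.univ.image (algebraMap Fq K))).card := by
      refine Finset.card_le_card_of_injOn (fun t i => algebraMap Fq K (t i)) ?_ ?_
      · intro t ht
        simp only [Bad, Finset.coe_filter, Set.mem_ofPred_eq, Finset.mem_univ, true_and] at ht
        simp only [Finset.coe_filter, Set.mem_ofPred_eq]
        refine ⟨?_, ht⟩
        simp
      · intro t _ t' _ h
        funext i
        exact (algebraMap Fq K).injective (congrFun h i)
    rw [div_le_div_iff₀ (by positivity) (by positivity)] at h1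
    have h3 : Bad.card * q ≤ z.totalDegree * q ^ n :=
      (Nat.mul_le_mul_right _ h2).trans (by exact_mod_cast h1)
    exact_mod_cast h3.trans (Nat.mul_le_mul_right _ hzdeg)
  have hS1 : (S1.card : ℝ) ≤ q ^ n * (q + C1 * Real.sqrt q) + Bad.card * (D * q) := by
    rw [hsum, Nat.cast_sum]
    calc ∑ t, ((St t).card : ℝ) ≤ ∑ t : Fin n → Fq, ((q + C1 * Real.sqrt q) + if t ∈ Bad then (D * q : ℝ) else 0) := by
          refine Finset.sum_le_sum fun t _ => ?_
          split_ifs with h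
          · have h1 : ((St t).card : ℝ) ≤ D * q := by exact_mod_cast hbad t
            have : 0 ≤ q + C1 * Real.sqrt q := by positivity
            linarith
          · rw [add_zero]; refine hgood t fun h' => h ?_
            simp [Bad, h']
      _ = _ := by
          rw [Finset.sum_add_distrib, Finset.sum_ite_mem]; simp [hq, mul_add]
  have hS0' : (S0.card : ℝ) ≤ D * q ^ n := by exact_mod_cast hS0
  rw [hsplit, Nat.cast_add]
  have h4 : (Bad.card : ℝ) * (D * q) ≤ D * (Bd * q ^ n) := by
    have := mul_le_mul_of_nonneg_left hBad (Nat.cast_nonneg (α := ℝ) D)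
    linarith
  have h5 : (D + Bd * D : ℝ) * q ^ n ≤ (D + Bd * D : ℝ) * q ^ n * Real.sqrt q :=
    le_mul_of_one_le_right (by positivity) hsq1
  calc _ ≤ D * q ^ n + (q ^ n * (q + C1 * Real.sqrt q) + D * (Bd * q ^ n)) := by linarith
    _ = q ^ (n + 1) + C1 * q ^ n * Real.sqrt q + (D + Bd * D : ℝ) * q ^ n := by ring
    _ ≤ _ := by nlinarith
end FCE

namespace FCE

section Wt
variable {σ F L : Type*} [Field F] [Field L] [Algebra (MvPolynomial σ F) L]

variable (σ F L) in
/-- the Rees ring of the degree filtration -/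
def Rees : Subring L[X] where
  carrier := {p | ∀ i, ∃ b : MvPolynomial σ F, b.totalDegree ≤ i ∧ p.coeff i = algebraMap _ L b}
  mul_mem' := by
    intro p q hp hq i
    choose b hb hb' using hp
    choose c hc hc' using hq
    refine ⟨∑ x ∈ Finset.HasAntidiagonal.antidiagonal i, b x.1 * c x.2, ?_, ?_⟩
    · refine (MvPolynomial.totalDegree_finsetSum_le fun x hx => ?_)
      rw [Finset.HasAntidiagonal.mem_antidiagonal] at hx
      refine (MvPolynomial.totalDegree_mul _ _).trans ?_
      have := hb x.1; have := hc x.2; omega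
    · rw [coeff_mul, map_sum]
      refine Finset.sum_congr rfl fun x _ => ?_
      rw [map_mul, hb', hc']
  one_mem' := by
    intro i
    refine ⟨if i = 0 then 1 else 0, ?_, ?_⟩
    · split_ifs <;> simp
    · rw [coeff_one]; split_ifs <;> simp
  add_mem' := by
    intro p q hp hq i
    obtain ⟨b, hb, hb'⟩ := hp i
    obtain ⟨c, hc, hc'⟩ := hq i
    exact ⟨b + c, (MvPolynomial.totalDegree_add _ _).trans (max_le hb hc), by simp [hb', hc']⟩
  zero_mem' := fun i => ⟨0, by simp, by simp⟩
  neg_mem' := by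
    intro p hp i
    obtain ⟨b, hb, hb'⟩ := hp i
    exact ⟨-b, by simpa using hb, by simp [hb']⟩

theorem monomial_mem_Rees {E : ℕ} {b : MvPolynomial σ F} (hb : b.totalDegree ≤ E) :
    C (algebraMap _ L b) * X ^ E ∈ Rees σ F L := by
  intro i
  refine ⟨if i = E then b else 0, ?_, ?_⟩
  · split_ifs with h
    · rw [h]; exact hb
    · simp
  · rw [coeff_C_mul, coeff_X_pow]; split_ifs <;> simp

variable (σ F L) in
/-- elements of weight at most `E` -/
def Wt (E : ℕ) : AddSubgroup L where
  carrier := {z | IsIntegral (Rees σ F L) (C z * X ^ E : L[X])}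
  add_mem' := by
    intro a b ha hb
    simp only [Set.mem_ofPred_eq] at *
    rw [map_add, add_mul]; exact ha.add hb
  zero_mem' := by
    simp only [Set.mem_ofPred_eq]
    rw [map_zero, zero_mul]; exact isIntegral_zero
  neg_mem' := by
    intro a ha
    simp only [Set.mem_ofPred_eq] at *
    rw [map_neg, neg_mul]; exact ha.neg

theorem mem_Wt {E : ℕ} {z : L} : z ∈ Wt σ F L E ↔ IsIntegral (Rees σ F L) (C z * X ^ E : L[X]) := Iff.rfl

theorem isIntegral_of_mem_Rees {p : L[X]} (hp : p ∈ Rees σ F L) : IsIntegral (Rees σ F L) p :=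
  isIntegral_algebraMap (x := (⟨p, hp⟩ : Rees σ F L))

theorem algebraMap_mem_Wt {E : ℕ} {b : MvPolynomial σ F} (hb : b.totalDegree ≤ E) :
    algebraMap _ L b ∈ Wt σ F L E :=
  isIntegral_of_mem_Rees (monomial_mem_Rees hb)

theorem isFil_Wt : IsFil (Wt σ F L) where
  one_mem := by
    rw [← map_one (algebraMap (MvPolynomial σ F) L)]; exact algebraMap_mem_Wt (by simp)
  mul_mem {a b x y} hx hy := by
    rw [mem_Wt] at *
    have := hx.mul hy
    have h : (C (x * y) * X ^ (a + b) : L[X]) = C x * X ^ a * (C y * X ^ b) := by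
      rw [map_mul]; ring
    rw [h]; exact this
  mono {a b} h x hx := by
    rw [mem_Wt] at *
    have h2 : IsIntegral (Rees σ F L) (X ^ (b - a) : L[X]) := by
      have := isIntegral_of_mem_Rees (monomial_mem_Rees (σ := σ) (F := F) (L := L) (E := b - a) (b := 1) (by simp))
      simpa using this
    have := hx.mul h2
    rwa [mul_assoc, ← pow_add, Nat.add_sub_cancel' h] at this

theorem Wt_map {E : ℕ} (g : L →ₐ[MvPolynomial σ F] L) {z : L} (hz : z ∈ Wt σ F L E) : g z ∈ Wt σ F L E := by
  rw [mem_Wt] at *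
  have := IsIntegral.map_of_comp_eq (R := Rees σ F L) (T := Rees σ F L) (RingHom.id _)
    (mapRingHom (g : L →+* L)) (by
      ext1 p
      simp only [RingHom.comp_apply, RingHom.id_apply]
      ext i
      obtain ⟨b, _, hb⟩ := p.2 i
      have h1 : ((algebraMap (Rees σ F L) L[X]) p).coeff i = algebraMap _ L b := hb
      rw [coe_mapRingHom, coeff_map, h1]
      exact (g.commutes b).symm) hz
  simpa using this

theorem isIntegral_of_mem_Wt {E : ℕ} {z : L} (hz : z ∈ Wt σ F L E) : IsIntegral (MvPolynomial σ F) z := by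
  rw [mem_Wt] at hz
  have hz' := hz.map_of_comp_eq (T := integralClosure (MvPolynomial σ F) L)
    (((evalRingHom 1).comp (Rees σ F L).subtype).codRestrict (integralClosure (MvPolynomial σ F) L).toSubring (by
      intro p
      simp only [RingHom.comp_apply, coe_evalRingHom]
      rw [eval_eq_sum_range]
      refine Subring.sum_mem _ fun i _ => ?_
      obtain ⟨b, _, hb⟩ := p.2 i
      have h1 : ((Rees σ F L).subtype p).coeff i = algebraMap _ L b := hb
      rw [h1, one_pow, mul_one]
      exact isIntegral_algebraMap)) (evalRingHom (1 : L)) rfl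
  simp at hz'
  exact isIntegral_trans _ hz'

theorem totalDegree_le_of_mem_Wt (hinj : Function.Injective (algebraMap (MvPolynomial σ F) L)) {E : ℕ}
    {b : MvPolynomial σ F} (hb : algebraMap _ L b ∈ Wt σ F L E) : b.totalDegree ≤ E := by
  by_contra hlt
  push Not at hlt
  have hb0 : b ≠ 0 := by rintro rfl; simp at hlt
  rw [mem_Wt] at hb
  obtain ⟨p, hp, hpe⟩ := hb
  rw [eval₂_eq_sum_range, Finset.sum_range_succ, hp.coeff_natDegree, map_one, one_mul] at hpe
  have h1 := congrArg (fun r : L[X] => r.coeff (E * p.natDegree)) hpe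
  simp only [coeff_add, finsetSum_coeff, coeff_zero] at h1
  have h2 : ∀ k ∈ Finset.range p.natDegree, ∃ c : MvPolynomial σ F, c.totalDegree ≤ E * (p.natDegree - k) ∧
      ((algebraMap (Rees σ F L) L[X]) (p.coeff k) * (C (algebraMap _ L b) * X ^ E) ^ k).coeff (E * p.natDegree) =
        algebraMap _ L (c * b ^ k) := by
    intro k hk
    rw [Finset.mem_range] at hk
    obtain ⟨c, hc, hc'⟩ := (p.coeff k).2 (E * (p.natDegree - k))
    refine ⟨c, hc, ?_⟩
    rw [mul_pow, ← map_pow, ← pow_mul, mul_left_comm, coeff_C_mul]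
    have h3 : E * p.natDegree = E * (p.natDegree - k) + E * k := by
      rw [← mul_add]; congr 1; omega
    rw [h3, coeff_mul_X_pow, map_mul, map_pow, mul_comm]
    congr 1
  choose! c hc hc' using h2
  rw [Finset.sum_congr rfl hc', mul_pow, ← map_pow, ← pow_mul, coeff_C_mul, coeff_X_pow, if_pos rfl, mul_one,
    ← map_pow, ← map_sum, ← map_add] at h1
  have h4 := hinj (h1.trans (map_zero _).symm)
  have h5 : b ^ p.natDegree = - ∑ k ∈ Finset.range p.natDegree, c k * b ^ k := by
    linear_combination h4
  have hdpos : 0 < p.natDegree := by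
    rcases Nat.eq_zero_or_pos p.natDegree with h | h
    · rw [h] at h5; simp at h5
    · exact h
  have h6 : (b ^ p.natDegree).totalDegree < p.natDegree * b.totalDegree := by
    rw [h5, MvPolynomial.totalDegree_neg]
    refine lt_of_le_of_lt (MvPolynomial.totalDegree_finsetSum_le (d := p.natDegree * b.totalDegree - 1)
      fun k hk => ?_) (Nat.sub_lt (Nat.mul_pos hdpos (by omega)) one_pos)
    have hk' := Finset.mem_range.1 hk
    refine (MvPolynomial.totalDegree_mul _ _).trans ?_
    have h7 := hc k hk
    have h8 := MvPolynomial.totalDegree_pow b k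
    have h9 : (p.natDegree - k) * E + (p.natDegree - k) ≤ (p.natDegree - k) * b.totalDegree := by
      rw [← Nat.mul_succ]; exact Nat.mul_le_mul_left _ hlt
    have h10 : p.natDegree * b.totalDegree = (p.natDegree - k) * b.totalDegree + k * b.totalDegree := by
      rw [← add_mul]; congr 1; omega
    rw [mul_comm] at h7
    omega
  have h7 : ∀ k : ℕ, (b ^ k).totalDegree = k * b.totalDegree := by
    intro k
    induction k with
    | zero => simp
    | succ k ih =>
      rw [pow_succ, MvPolynomial.totalDegree_mul_of_isDomain (pow_ne_zero _ hb0) hb0, ih]; ring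
  rw [h7] at h6
  omega

end Wt
end FCE

set_option linter.unusedSectionVars false
namespace FCE

theorem IsFil.prod_mem {R ι : Type*} [CommRing R] {Fil : ℕ → AddSubgroup R} (hF : IsFil Fil) {a : ℕ}
    (s : Finset ι) {x : ι → R} (h : ∀ i ∈ s, x i ∈ Fil a) : ∏ i ∈ s, x i ∈ Fil (a * s.card) := by
  classical
  induction s using Finset.induction_on with
  | empty => simpa using hF.one_mem
  | insert i s hi ih =>
    rw [Finset.prod_insert hi, Finset.card_insert_of_notMem hi, Nat.mul_succ, add_comm]
    exact hF.mul_mem (h i (Finset.mem_insert_self _ _)) (ih fun j hj => h j (Finset.mem_insert_of_mem hj))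

section
variable {σ F L : Type*} [Field F] [Field L] [Algebra (MvPolynomial σ F) L]

theorem lead_mul_root (p : (MvPolynomial σ F)[X]) {D : ℕ} (hD : ∀ k, (p.coeff k).totalDegree ≤ D)
    (hinj : Function.Injective (algebraMap (MvPolynomial σ F) L))
    {y : L} (hy : aeval y p = 0) : algebraMap _ L p.leadingCoeff * y ∈ Wt σ F L D := by
  rcases eq_or_ne p 0 with rfl | hp
  · simp [(Wt σ F L D).zero_mem]
  set c : ℕ → Rees σ F L := fun k => ⟨C (algebraMap _ L (p.coeff k)) * X ^ D, monomial_mem_Rees (hD k)⟩ with hc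
  set P : (Rees σ F L)[X] := ∑ k ∈ Finset.range (p.natDegree + 1), monomial k (c k) with hP
  have hcoef : ∀ k, P.coeff k = c k := by
    intro k
    rw [hP, finsetSum_coeff]
    simp only [coeff_monomial]
    rw [Finset.sum_ite_eq']
    split_ifs with h
    · rfl
    · rw [Finset.mem_range] at h
      apply Subtype.ext
      rw [hc]
      simp [coeff_eq_zero_of_natDegree_lt (show p.natDegree < k by omega)]
  have hdeg : P.natDegree = p.natDegree := by
    apply natDegree_eq_of_le_of_coeff_ne_zero
    · rw [natDegree_le_iff_coeff_eq_zero]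
      intro N hN
      rw [hcoef]
      apply Subtype.ext
      rw [hc]
      simp [coeff_eq_zero_of_natDegree_lt hN]
    · rw [hcoef]
      intro h
      have h1 : C (algebraMap _ L (p.coeff p.natDegree)) * X ^ D = (0 : L[X]) := congrArg Subtype.val h
      have h2 := congrArg (fun r : L[X] => r.coeff D) h1
      simp only [coeff_C_mul, coeff_X_pow, if_pos, mul_one, coeff_zero] at h2
      rw [map_eq_zero_iff _ hinj] at h2
      exact hp (leadingCoeff_eq_zero.1 h2)
  have hroot : aeval (C y : L[X]) P = 0 := by
    rw [hP, map_sum]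
    have : ∀ k, aeval (C y : L[X]) (monomial k (c k)) = C (algebraMap _ L (p.coeff k) * y ^ k) * X ^ D := by
      intro k
      rw [aeval_monomial, map_mul, map_pow]
      have : algebraMap (Rees σ F L) L[X] (c k) = C (algebraMap _ L (p.coeff k)) * X ^ D := rfl
      rw [this]; ring
    simp only [this]
    rw [← Finset.sum_mul, ← map_sum]
    have h3 : ∑ k ∈ Finset.range (p.natDegree + 1), algebraMap _ L (p.coeff k) * y ^ k = 0 := by
      rw [← hy, aeval_def, eval₂_eq_sum_range]
    rw [h3, map_zero, zero_mul]
  have := isIntegral_leadingCoeff_smul P (C y : L[X]) hroot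
  rw [leadingCoeff, hdeg, hcoef] at this
  rw [mem_Wt]
  have h2 : c p.natDegree • (C y : L[X]) = C (algebraMap _ L p.leadingCoeff * y) * X ^ D := by
    change (C (algebraMap _ L (p.coeff p.natDegree)) * X ^ D) * C y = _
    rw [map_mul, leadingCoeff]; ring
  rwa [h2] at this

end

section Gal
variable {σ F Ka L : Type*} [Field F] [Field Ka] [Algebra (MvPolynomial σ F) Ka] [IsFractionRing (MvPolynomial σ F) Ka]
  [Field L] [Algebra (MvPolynomial σ F) L] [Algebra Ka L] [IsScalarTower (MvPolynomial σ F) Ka L]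
  [FiniteDimensional Ka L] [IsGalois Ka L]

theorem inj_BL (Ka : Type*) [Field Ka] [Algebra (MvPolynomial σ F) Ka] [IsFractionRing (MvPolynomial σ F) Ka]
    [Algebra Ka L] [IsScalarTower (MvPolynomial σ F) Ka L] : Function.Injective (algebraMap (MvPolynomial σ F) L) := by
  rw [IsScalarTower.algebraMap_eq (MvPolynomial σ F) Ka L]
  exact (algebraMap Ka L).injective.comp (IsFractionRing.injective _ _)

theorem Wt_gal {E : ℕ} (g : L ≃ₐ[Ka] L) {z : L} (hz : z ∈ Wt σ F L E) : g z ∈ Wt σ F L E :=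
  Wt_map ((g : L →ₐ[Ka] L).restrictScalars (MvPolynomial σ F)) hz

variable (Ka) in
theorem int_descend {z : L} (hz : IsIntegral (MvPolynomial σ F) z) (hg : ∀ g : L ≃ₐ[Ka] L, g z = z) :
    ∃ b : MvPolynomial σ F, algebraMap _ L b = z := by
  obtain ⟨k, rfl⟩ := (IsGalois.mem_range_algebraMap_iff_fixed (F := Ka) z).2 hg
  have h2 : IsIntegral (MvPolynomial σ F) k := (isIntegral_algebraMap_iff (algebraMap Ka L).injective).1 hz
  obtain ⟨b, rfl⟩ := IsIntegrallyClosed.isIntegral_iff.1 h2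
  exact ⟨b, IsScalarTower.algebraMap_apply _ _ _ _⟩

variable (Ka) in
theorem Wt_descend {E : ℕ} {z : L} (hz : z ∈ Wt σ F L E) (hg : ∀ g : L ≃ₐ[Ka] L, g z = z) :
    ∃ b : MvPolynomial σ F, b.totalDegree ≤ E ∧ algebraMap _ L b = z := by
  obtain ⟨b, rfl⟩ := int_descend Ka (isIntegral_of_mem_Wt hz) hg
  exact ⟨b, totalDegree_le_of_mem_Wt (inj_BL Ka) hz, rfl⟩

variable (Ka) in
theorem Wt_norm {E : ℕ} {z : L} (hz : z ∈ Wt σ F L E) (h0 : z ≠ 0) :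
    ∃ b : MvPolynomial σ F, b.totalDegree ≤ E * Nat.card (L ≃ₐ[Ka] L) ∧ b ≠ 0 ∧
      algebraMap _ L b = ∏ g : L ≃ₐ[Ka] L, g z := by
  obtain ⟨b, hb, hb'⟩ := Wt_descend Ka (isFil_Wt.prod_mem (Finset.univ : Finset (L ≃ₐ[Ka] L)) (x := fun g => g z)
    fun g _ => Wt_gal g hz) (by
      intro h
      rw [map_prod]
      exact Fintype.prod_equiv (Equiv.mulLeft h) _ _ fun g => rfl)
  refine ⟨b, by simpa [Nat.card_eq_fintype_card] using hb, ?_, hb'⟩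
  rintro rfl
  rw [map_zero] at hb'
  refine Finset.prod_ne_zero_iff.2 (fun g _ => ?_) hb'.symm
  simpa using h0

variable (Ka) in
theorem poly_descend {E : ℕ} {P : L[X]} (hz : ∀ i, P.coeff i ∈ Wt σ F L E)
    (hg : ∀ g : L ≃ₐ[Ka] L, P.map (g : L →+* L) = P) :
    ∃ b : (MvPolynomial σ F)[X], b.natDegree ≤ P.natDegree ∧ (∀ i, (b.coeff i).totalDegree ≤ E) ∧
      b.map (algebraMap _ L) = P := by
  have := fun i => Wt_descend Ka (hz i) (fun g => by
    have := congrArg (fun r : L[X] => r.coeff i) (hg g)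
    simpa using this)
  choose b hb hb' using this
  refine ⟨∑ k ∈ Finset.range (P.natDegree + 1), monomial k (b k), ?_, ?_, ?_⟩
  · refine natDegree_sum_le_of_forall_le _ _ fun k hk => ?_
    have := Finset.mem_range.1 hk
    exact (natDegree_monomial_le _).trans (by omega)
  · intro i
    rw [finsetSum_coeff]
    simp only [coeff_monomial]
    rw [Finset.sum_ite_eq']
    split_ifs
    · exact hb i
    · simp
  · ext i
    rw [coeff_map, finsetSum_coeff]
    simp only [coeff_monomial]
    rw [Finset.sum_ite_eq']
    split_ifs with h
    · exact hb' i
    · rw [Finset.mem_range] at h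
      rw [map_zero, coeff_eq_zero_of_natDegree_lt (by omega)]

end Gal

section Theta
variable {n : ℕ} {F Ka L : Type*} [Field F] [Field Ka] [Algebra (MvPolynomial (Fin (n + 1)) F) Ka]
  [IsFractionRing (MvPolynomial (Fin (n + 1)) F) Ka]
  [Field L] [Algebra (MvPolynomial (Fin (n + 1)) F) L] [Algebra Ka L]
  [IsScalarTower (MvPolynomial (Fin (n + 1)) F) Ka L]
  [FiniteDimensional Ka L] [IsGalois Ka L]

theorem exists_theta {r D g0 : ℕ} (hg0 : Nat.card (L ≃ₐ[Ka] L) ≤ g0)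
    (u : Fin r → L) (hu : ∀ k, u k ∈ Wt (Fin (n + 1)) F L D)
    (hfix : ∀ g : L ≃ₐ[Ka] L, (∀ k, g (u k) = u k) → g = 1) :
    ∃ θ ∈ Wt (Fin (n + 1)) F L (D + g0 * g0 * r * r),
      Function.Injective (fun g : L ≃ₐ[Ka] L => g θ) := by
  classical
  set P : (L ≃ₐ[Ka] L) → (L ≃ₐ[Ka] L) → L[X] := fun g h => ∑ k : Fin r, C (g (u k) - h (u k)) * X ^ (k : ℕ) with hP
  have hP0 : ∀ g h, g ≠ h → P g h ≠ 0 := by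
    intro g h hgh hz
    apply hgh
    have : h⁻¹ * g = 1 := hfix _ fun k => by
      have h1 := congrArg (fun p : L[X] => p.coeff k) hz
      simp only [hP, finsetSum_coeff, coeff_C_mul, coeff_X_pow, coeff_zero, Fin.val_inj, mul_ite, mul_one, mul_zero,
        Finset.sum_ite_eq, Finset.mem_univ, if_true] at h1
      rw [sub_eq_zero] at h1
      change h⁻¹ (g (u k)) = u k
      rw [h1]
      exact h.symm_apply_apply _
    rw [inv_mul_eq_one] at this; exact this.symm
  have hPd : ∀ g h, (P g h).natDegree ≤ r := by
    intro g h
    refine natDegree_sum_le_of_forall_le _ _ fun k _ => ?_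
    exact (natDegree_C_mul_X_pow_le _ _).trans k.2.le
  set Q : L[X] := ∏ x : (L ≃ₐ[Ka] L) × (L ≃ₐ[Ka] L), if x.1 = x.2 then 1 else P x.1 x.2 with hQ
  have hQ0 : Q ≠ 0 := by
    refine Finset.prod_ne_zero_iff.2 fun x _ => ?_
    split_ifs with h
    · exact one_ne_zero
    · exact hP0 _ _ h
  have hQd : Q.natDegree ≤ g0 * g0 * r := by
    refine (natDegree_prod_le _ _).trans ?_
    refine (Finset.sum_le_card_nsmul _ _ r fun x _ => ?_).trans ?_
    · split_ifs
      · simp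
      · exact hPd _ _
    · rw [Finset.card_univ, Fintype.card_prod, smul_eq_mul]
      rw [Nat.card_eq_fintype_card] at hg0
      gcongr
  set s : ℕ → L := fun j => algebraMap (MvPolynomial (Fin (n + 1)) F) L (MvPolynomial.X 0 ^ j) with hs
  have hsinj : Function.Injective s := by
    intro i j hij
    have := inj_BL Ka hij
    have h2 := congrArg MvPolynomial.totalDegree this
    simpa [MvPolynomial.totalDegree_X_pow] using h2
  obtain ⟨j, hj, hjr⟩ : ∃ j ≤ g0 * g0 * r, Q.eval (s j) ≠ 0 := by
    by_contra hcon
    push Not at hcon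
    apply hQ0
    refine eq_zero_of_natDegree_lt_card_of_eval_eq_zero' Q ((Finset.range (g0 * g0 * r + 1)).image s) ?_ ?_
    · intro x hx
      obtain ⟨i, hi, rfl⟩ := Finset.mem_image.1 hx
      exact hcon i (by have := Finset.mem_range.1 hi; omega)
    · rw [Finset.card_image_of_injective _ hsinj, Finset.card_range]; omega
  refine ⟨∑ k : Fin r, u k * s j ^ (k : ℕ), ?_, ?_⟩
  · refine AddSubgroup.sum_mem _ fun k _ => ?_
    have h1 : s j ∈ Wt (Fin (n + 1)) F L j := algebraMap_mem_Wt (by simp [MvPolynomial.totalDegree_X_pow])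
    refine isFil_Wt.mono ?_ (isFil_Wt.mul_mem (hu k) (isFil_Wt.pow_mem h1 k))
    gcongr
    exact k.2.le
  · intro g h hgh
    by_contra hne
    apply hjr
    rw [hQ, eval_prod]
    refine Finset.prod_eq_zero (Finset.mem_univ (g, h)) ?_
    rw [if_neg hne]
    simp only [hP, eval_finsetSum, eval_mul, eval_C, eval_pow, eval_X, sub_mul, Finset.sum_sub_distrib]
    have hc : ∀ g : L ≃ₐ[Ka] L, g (s j) = s j := by
      intro g
      simp only [hs]
      rw [IsScalarTower.algebraMap_apply (MvPolynomial (Fin (n + 1)) F) Ka L, g.commutes]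
    simpa [map_sum, map_mul, map_pow, hc, sub_eq_zero] using hgh

end Theta
end FCE

set_option linter.unusedSectionVars false
namespace FCE

section Geom
variable {n : ℕ} {Fq K L Ω : Type} [Field Fq] [Fintype Fq] [Field K] [Algebra Fq K]
  [Normal Fq K]
  [Field L] [Algebra Fq L] [Algebra (MvPolynomial (Fin (n + 1)) Fq) L]
  [IsScalarTower Fq (MvPolynomial (Fin (n + 1)) Fq) L]
  [Field Ω] [Algebra L Ω] [Algebra K Ω] [Algebra Fq Ω] [IsScalarTower Fq L Ω] [IsScalarTower Fq K Ω] [IsGalois L Ω]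

variable (n Fq K L Ω) in
noncomputable def Phi : MvPolynomial (Fin (n + 1)) K →+* Ω :=
  MvPolynomial.eval₂Hom (algebraMap K Ω)
    (fun i => algebraMap L Ω (algebraMap (MvPolynomial (Fin (n + 1)) Fq) L (MvPolynomial.X i)))

theorem Phi_comp : (Phi n Fq K L Ω).comp (MvPolynomial.map (algebraMap Fq K)) =
    (algebraMap L Ω).comp (algebraMap (MvPolynomial (Fin (n + 1)) Fq) L) := by
  apply MvPolynomial.ringHom_ext
  · intro r
    simp only [Phi, RingHom.comp_apply, MvPolynomial.map_C, MvPolynomial.coe_eval₂Hom, MvPolynomial.eval₂_C]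
    rw [← IsScalarTower.algebraMap_apply, ← MvPolynomial.algebraMap_eq, ← IsScalarTower.algebraMap_apply Fq _ L,
      ← IsScalarTower.algebraMap_apply]
  · intro i; simp [Phi]

theorem Phi_inj (hinj : Function.Injective (algebraMap (MvPolynomial (Fin (n + 1)) Fq) L)) :
    Function.Injective (Phi n Fq K L Ω) := by
  have h1 : AlgebraicIndependent Fq (fun i : Fin (n + 1) =>
      algebraMap L Ω (algebraMap (MvPolynomial (Fin (n + 1)) Fq) L (MvPolynomial.X i))) := by
    rw [AlgebraicIndependent]
    have : ∀ p : MvPolynomial (Fin (n + 1)) Fq, MvPolynomial.aeval (fun i : Fin (n + 1) =>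
      algebraMap L Ω (algebraMap (MvPolynomial (Fin (n + 1)) Fq) L (MvPolynomial.X i))) p =
        algebraMap L Ω (algebraMap _ L p) := by
      intro p
      have h := congrArg (fun f => f p) (Phi_comp (n := n) (Fq := Fq) (K := K) (L := L) (Ω := Ω))
      simp only [RingHom.comp_apply] at h
      rw [← h, Phi, MvPolynomial.coe_eval₂Hom, MvPolynomial.eval₂_map, ← IsScalarTower.algebraMap_eq]
      rfl
    intro p q hpq
    rw [this, this] at hpq
    exact hinj ((algebraMap L Ω).injective hpq)
  exact h1.extendScalars K

theorem const_mem (hinj : Function.Injective (algebraMap (MvPolynomial (Fin (n + 1)) Fq) L))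
    (c : MvPolynomial (Fin (n + 1)) K) (hc : Phi n Fq K L Ω c ∈ Set.range (algebraMap L Ω)) (m) :
    algebraMap K Ω (c.coeff m) ∈ Set.range (algebraMap L Ω) := by
  rw [InfiniteGalois.mem_range_algebraMap_iff_fixed] at hc ⊢
  intro τ
  set τ' := (τ.restrictScalars Fq).restrictNormal K
  have hτ : ∀ y, algebraMap K Ω (τ' y) = τ (algebraMap K Ω y) := fun y =>
    AlgEquiv.restrictNormal_commutes (τ.restrictScalars Fq) K y
  have h2 : (Phi n Fq K L Ω).comp (MvPolynomial.map (τ' : K →+* K)) = (τ : Ω →+* Ω).comp (Phi n Fq K L Ω) := by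
    apply MvPolynomial.ringHom_ext
    · intro r; simp [Phi, hτ]
    · intro i; simp [Phi]
  have h3 : MvPolynomial.map (τ' : K →+* K) c = c := by
    apply Phi_inj (Ω := Ω) hinj
    have := congrArg (fun f => f c) h2
    simp only [RingHom.comp_apply] at this
    rw [this]; exact hc τ
  have h4 := congrArg (MvPolynomial.coeff m) h3
  rw [MvPolynomial.coeff_map] at h4
  rw [← hτ]
  exact congrArg _ h4

theorem exists_pow_card_eq (y : K) : ∃ k : ℕ, 0 < k ∧ y ^ Fintype.card Fq ^ k = y := by
  have hy : IsIntegral Fq y := Algebra.IsIntegral.isIntegral y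
  have := IntermediateField.adjoin.finiteDimensional hy
  have hfin : Finite (IntermediateField.adjoin Fq {y}) := Module.finite_of_finite Fq
  have := Fintype.ofFinite (IntermediateField.adjoin Fq {y})
  refine ⟨Module.finrank Fq (IntermediateField.adjoin Fq {y}), Module.finrank_pos, ?_⟩
  rw [← Module.card_eq_pow_finrank (K := Fq) (V := IntermediateField.adjoin Fq {y})]
  have := FiniteField.pow_card (⟨y, IntermediateField.mem_adjoin_simple_self Fq y⟩ : IntermediateField.adjoin Fq {y})
  exact congrArg Subtype.val this

variable (Fq K) in
/-- Frobenius on coefficients -/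
noncomputable def frobE (n : ℕ) : MvPolynomial (Fin (n + 1)) K ≃+* MvPolynomial (Fin (n + 1)) K :=
  MvPolynomial.mapEquiv _ (FiniteField.frobeniusAlgEquivOfAlgebraic Fq K).toRingEquiv

theorem frobE_coeff (c : MvPolynomial (Fin (n + 1)) K) (m) :
    (frobE Fq K n c).coeff m = c.coeff m ^ Fintype.card Fq := by
  unfold frobE
  rw [MvPolynomial.mapEquiv_apply, MvPolynomial.coeff_map]
  exact congrFun (FiniteField.coe_frobeniusAlgEquivOfAlgebraic Fq K) _

/-- Elements of `G₁` act on descended coefficients as Frobenius on constants. -/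
theorem gal_coeff (hinj : Function.Injective (algebraMap (MvPolynomial (Fin (n + 1)) Fq) L))
    (g : L →ₐ[MvPolynomial (Fin (n + 1)) Fq] L)
    (hg : ∀ y : L, (∃ k : ℕ, 0 < k ∧ y ^ Fintype.card Fq ^ k = y) → g y = y ^ Fintype.card Fq)
    (c : MvPolynomial (Fin (n + 1)) K) (z : L) (hz : algebraMap L Ω z = Phi n Fq K L Ω c) :
    algebraMap L Ω (g z) = Phi n Fq K L Ω (frobE Fq K n c) := by
  have hm := fun m => const_mem (Ω := Ω) hinj c ⟨z, hz⟩ m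
  choose d hd using hm
  have hgd : ∀ m, g (d m) = d m ^ Fintype.card Fq := by
    intro m
    apply hg
    obtain ⟨k, hk, hk'⟩ := exists_pow_card_eq (Fq := Fq) (c.coeff m)
    refine ⟨k, hk, (algebraMap L Ω).injective ?_⟩
    rw [map_pow, hd, ← map_pow, hk']
  set x : Fin (n + 1) → L := fun i => algebraMap (MvPolynomial (Fin (n + 1)) Fq) L (MvPolynomial.X i) with hx
  have hPhi : ∀ c' : MvPolynomial (Fin (n + 1)) K, c'.support ⊆ c.support → ∀ d' : (Fin (n + 1) →₀ ℕ) → L,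
      (∀ m, algebraMap L Ω (d' m) = algebraMap K Ω (c'.coeff m)) →
      Phi n Fq K L Ω c' = algebraMap L Ω (∑ m ∈ c.support, d' m * m.prod fun i k => x i ^ k) := by
    intro c' hc' d' hd'
    rw [Phi, MvPolynomial.coe_eval₂Hom, MvPolynomial.eval₂_eq, map_sum]
    rw [Finset.sum_subset hc']
    · refine Finset.sum_congr rfl fun m _ => ?_
      rw [map_mul, hd', Finsupp.prod, map_prod]
      simp [hx]
    · intro m _ hm
      rw [MvPolynomial.notMem_support_iff.1 hm, map_zero, zero_mul]
  have h1 : z = ∑ m ∈ c.support, d m * m.prod fun i k => x i ^ k :=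
    (algebraMap L Ω).injective (hz.trans (hPhi c le_rfl d hd))
  rw [hPhi (frobE Fq K n c) ?_ (fun m => d m ^ Fintype.card Fq)]
  · congr 1
    rw [h1, map_sum]
    refine Finset.sum_congr rfl fun m _ => ?_
    rw [map_mul, hgd, Finsupp.prod, map_prod]
    congr 1
    refine Finset.prod_congr rfl fun i _ => ?_
    rw [map_pow, hx, AlgHom.commutes]
  · intro m
    rw [frobE_coeff, map_pow, hd, map_pow]
  · intro m hm
    rw [MvPolynomial.mem_support_iff, frobE_coeff] at hm
    rw [MvPolynomial.mem_support_iff]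
    intro h
    rw [h, zero_pow Fintype.card_ne_zero] at hm
    exact hm rfl

end Geom
end FCE

set_option linter.unusedSectionVars false
namespace FCE

theorem exists_monic_irred_factor {R : Type*} [CommRing R] [IsDomain R] [UniqueFactorizationMonoid R]
    (f : R[X]) (hf : f.Monic) (hd : 0 < f.natDegree) : ∃ f1 : R[X], f1.Monic ∧ Irreducible f1 ∧ f1 ∣ f := by
  obtain ⟨f', hirr, hdvd⟩ := WfDvdMonoid.exists_irreducible_factor (a := f) (by
    intro h
    rw [hf.isUnit_iff] at h
    rw [h] at hd; simp at hd) hf.ne_zero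
  have hu : IsUnit f'.leadingCoeff := by
    have := leadingCoeff_dvd_leadingCoeff hdvd
    rw [hf.leadingCoeff] at this
    exact isUnit_of_dvd_one this
  obtain ⟨v, hv⟩ := hu.exists_left_inv
  have hvu : IsUnit (C v : R[X]) := isUnit_C.2 (IsUnit.of_mul_eq_one _ hv)
  refine ⟨C v * f', monic_C_mul_of_mul_leadingCoeff_eq_one hv, ?_, ?_⟩
  · exact (irreducible_isUnit_mul hvu).2 hirr
  · exact (hvu.mul_left_dvd).2 hdvd

section Geom
variable {n : ℕ} {Fq K L Ω : Type} [Field Fq] [Fintype Fq] [Field K] [Algebra Fq K]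
  [Normal Fq K]
  [Field L] [Algebra Fq L] [Algebra (MvPolynomial (Fin (n + 1)) Fq) L]
  [IsScalarTower Fq (MvPolynomial (Fin (n + 1)) Fq) L]
  [Field Ω] [Algebra L Ω] [Algebra K Ω] [Algebra Fq Ω] [IsScalarTower Fq L Ω] [IsScalarTower Fq K Ω] [IsGalois L Ω]

theorem exists_hat {ι : Type*} [Fintype ι] (θ : ι → L) (f : Polynomial Ω) (hf : f.Monic)
    (hdvd : f ∣ (∏ i, (X - C (θ i))).map (algebraMap L Ω)) : ∃ fh : L[X], fh.map (algebraMap L Ω) = f := by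
  have h0 : (∏ i, (X - C (θ i))).map (algebraMap L Ω) ≠ 0 := by
    rw [Polynomial.map_ne_zero_iff (algebraMap L Ω).injective]
    exact (monic_prod_of_monic _ _ fun i _ => monic_X_sub_C _).ne_zero
  have hs : f.Splits := by
    refine Splits.of_dvd ?_ h0 hdvd
    rw [Polynomial.map_prod]
    refine Splits.prod fun i _ => ?_
    rw [Polynomial.map_sub, map_X, map_C]
    exact Splits.X_sub_C _
  have : f ∈ lifts (algebraMap L Ω) := by
    rw [hs.eq_prod_roots_of_monic hf]
    refine Subsemiring.multiset_prod_mem _ _ fun p hp => ?_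
    obtain ⟨α, hα, rfl⟩ := Multiset.mem_map.1 hp
    have h1 : ((∏ i, (X - C (θ i))).map (algebraMap L Ω)).eval α = 0 :=
      eval_eq_zero_of_dvd_of_eval_eq_zero hdvd (isRoot_of_mem_roots hα)
    rw [Polynomial.map_prod, eval_prod, Finset.prod_eq_zero_iff] at h1
    obtain ⟨i, _, hi⟩ := h1
    simp only [Polynomial.map_sub, map_X, map_C, eval_sub, eval_X, eval_C] at hi
    rw [sub_eq_zero] at hi
    refine ⟨X - C (θ i), ?_⟩
    simp [hi]
  obtain ⟨fh, hfh⟩ := this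
  exact ⟨fh, hfh⟩

theorem factor_totalDegree (hinj : Function.Injective (Phi n Fq K L Ω)) {ι : Type*} [Fintype ι] (θ : ι → L)
    (fK f : (MvPolynomial (Fin (n + 1)) K)[X]) (hfK : fK.Monic) (hf : f.Monic) (hdvd : f ∣ fK)
    (hsp : fK.map (Phi n Fq K L Ω) = (∏ i, (X - C (θ i))).map (algebraMap L Ω)) {E : ℕ} (hE : 1 ≤ E)
    (hcoef : ∀ k, (fK.coeff k).totalDegree ≤ E) (k : ℕ) : (f.coeff k).totalDegree ≤ E * f.natDegree := by
  let _ : Algebra (MvPolynomial (Fin (n + 1)) K) Ω := (Phi n Fq K L Ω).toAlgebra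
  have hPhi : algebraMap (MvPolynomial (Fin (n + 1)) K) Ω = Phi n Fq K L Ω := rfl
  apply totalDegree_le_of_mem_Wt (L := Ω) hinj
  have hs : (f.map (Phi n Fq K L Ω)).Splits := by
    refine Splits.of_dvd (g := fK.map (Phi n Fq K L Ω)) ?_ (hfK.map _).ne_zero (Polynomial.map_dvd _ hdvd)
    rw [hsp, Polynomial.map_prod]
    refine Splits.prod fun i _ => ?_
    rw [Polynomial.map_sub, map_X, map_C]
    exact Splits.X_sub_C _
  have h1 : ∀ s : Multiset Ω, (∀ α ∈ s, α ∈ Wt (Fin (n + 1)) K Ω E) →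
      (s.map fun α => X - C α).prod ∈ FilP (isFil_Wt (σ := Fin (n + 1)) (F := K) (L := Ω)) (E * s.card) := by
    intro s
    have hW := isFil_FilP (isFil_Wt (σ := Fin (n + 1)) (F := K) (L := Ω))
    induction s using Multiset.induction_on with
    | empty => intro _; simpa using hW.one_mem
    | cons α s ih =>
      intro h
      rw [Multiset.map_cons, Multiset.prod_cons, Multiset.card_cons, Nat.mul_succ, add_comm (E * _) E]
      refine hW.mul_mem ⟨?_, fun k => ?_⟩ (ih fun β hβ => h β (Multiset.mem_cons_of_mem hβ))
      · rw [natDegree_X_sub_C]; exact hE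
      · rw [coeff_sub, coeff_X, coeff_C]
        refine AddSubgroup.sub_mem _ ?_ ?_
        · split_ifs
          · exact isFil_Wt.mono (Nat.zero_le _) isFil_Wt.one_mem
          · exact AddSubgroup.zero_mem _
        · split_ifs
          · exact h α (Multiset.mem_cons_self _ _)
          · exact AddSubgroup.zero_mem _
  have h2 := h1 (f.map (Phi n Fq K L Ω)).roots (by
    intro α hα
    have h3 : aeval α fK = 0 := by
      rw [aeval_def, hPhi, ← eval_map]
      exact eval_eq_zero_of_dvd_of_eval_eq_zero (Polynomial.map_dvd _ hdvd) (isRoot_of_mem_roots hα)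
    have := lead_mul_root fK hcoef hinj h3
    rwa [hfK.leadingCoeff, map_one, one_mul] at this)
  rw [← hs.eq_prod_roots_of_monic (hf.map _), ← hs.natDegree_eq_card_roots, hf.natDegree_map] at h2
  have := h2.2 k
  rwa [coeff_map] at this

end Geom
end FCE

set_option linter.unusedSectionVars false
namespace FCE

theorem mem_range_of_pow_card {Fq K : Type*} [Field Fq] [Fintype Fq] [Field K] [Algebra Fq K] {c : K}
    (hc : c ^ Fintype.card Fq = c) : c ∈ Set.range (algebraMap Fq K) := by
  classical
  by_contra hcon
  have h1 : 1 < Fintype.card Fq := Fintype.one_lt_card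
  have h0 : (X ^ Fintype.card Fq - X : K[X]) ≠ 0 := FiniteField.X_pow_card_sub_X_ne_zero K h1
  apply h0
  refine eq_zero_of_natDegree_lt_card_of_eval_eq_zero' _ (insert c (Finset.univ.image (algebraMap Fq K))) ?_ ?_
  · intro x hx
    rw [eval_sub, eval_pow, eval_X, sub_eq_zero]
    rcases Finset.mem_insert.1 hx with rfl | hx
    · exact hc
    · obtain ⟨d, _, rfl⟩ := Finset.mem_image.1 hx
      rw [← map_pow, FiniteField.pow_card]
  · rw [FiniteField.X_pow_card_sub_X_natDegree_eq K h1, Finset.card_insert_of_notMem,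
      Finset.card_image_of_injective _ (algebraMap Fq K).injective, Finset.card_univ]
    · omega
    · intro h
      obtain ⟨d, _, hd⟩ := Finset.mem_image.1 h
      exact hcon ⟨d, hd⟩

theorem pow_pow_iter {M : Type*} [Monoid M] {c : M} {q s : ℕ} (h : c ^ q ^ s = c) (k : ℕ) : c ^ q ^ (s * k) = c := by
  induction k with
  | zero => simp
  | succ k ih => rw [Nat.mul_succ, pow_add, pow_mul, ih, h]

section Geom
variable {n : ℕ} {Fq K L Ka : Type} [Field Fq] [Fintype Fq] [Field K] [Algebra Fq K]
  [Normal Fq K]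
  [Field L] [Algebra Fq L] [Algebra (MvPolynomial (Fin (n + 1)) Fq) L]
  [IsScalarTower Fq (MvPolynomial (Fin (n + 1)) Fq) L]
  [Field Ka] [Algebra (MvPolynomial (Fin (n + 1)) Fq) Ka] [IsFractionRing (MvPolynomial (Fin (n + 1)) Fq) Ka]
  [Algebra Ka L] [IsScalarTower (MvPolynomial (Fin (n + 1)) Fq) Ka L] [FiniteDimensional Ka L]

theorem exists_common_period (S : Finset K) : ∃ s : ℕ, 0 < s ∧ ∀ c ∈ S, c ^ Fintype.card Fq ^ s = c := by
  classical
  induction S using Finset.induction_on with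
  | empty => exact ⟨1, one_pos, by simp⟩
  | insert a S ha ih =>
    obtain ⟨s, hs, hs'⟩ := ih
    obtain ⟨k, hk, hk'⟩ := exists_pow_card_eq (Fq := Fq) a
    refine ⟨s * k, Nat.mul_pos hs hk, fun c hc => ?_⟩
    rcases Finset.mem_insert.1 hc with rfl | hc
    · rw [mul_comm]; exact pow_pow_iter hk' s
    · exact pow_pow_iter (hs' c hc) k

variable (Fq K) in
/-- Frobenius on coefficients of polynomials -/
noncomputable def phiE (n : ℕ) : (MvPolynomial (Fin (n + 1)) K)[X] ≃+* (MvPolynomial (Fin (n + 1)) K)[X] :=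
  Polynomial.mapEquiv (frobE Fq K n)

theorem phiE_coeff (f : (MvPolynomial (Fin (n + 1)) K)[X]) (i m) :
    ((phiE Fq K n f).coeff i).coeff m = (f.coeff i).coeff m ^ Fintype.card Fq := by
  rw [← frobE_coeff]
  simp [phiE]

theorem phiE_coeff' (f : (MvPolynomial (Fin (n + 1)) K)[X]) (i) :
    (phiE Fq K n f).coeff i = frobE Fq K n (f.coeff i) := by
  simp [phiE]

theorem phiE_iter_coeff (f : (MvPolynomial (Fin (n + 1)) K)[X]) (i m) (s : ℕ) :
    (((phiE Fq K n)^[s] f).coeff i).coeff m = (f.coeff i).coeff m ^ Fintype.card Fq ^ s := by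
  induction s with
  | zero => simp
  | succ s ih => rw [Function.iterate_succ_apply', phiE_coeff, ih, ← pow_mul, pow_succ]

theorem phiE_period (f : (MvPolynomial (Fin (n + 1)) K)[X]) : f ∈ Function.periodicPts (phiE Fq K n) := by
  classical
  obtain ⟨s, hs, hs'⟩ := exists_common_period (Fq := Fq)
    (f.support.biUnion fun i => (f.coeff i).support.image fun m => (f.coeff i).coeff m)
  refine ⟨s, hs, ?_⟩
  rw [Function.IsPeriodicPt, Function.IsFixedPt]
  ext i m
  rw [phiE_iter_coeff]
  by_cases h : (f.coeff i).coeff m = 0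
  · rw [h, zero_pow]; exact pow_ne_zero _ Fintype.card_ne_zero
  · apply hs'
    rw [Finset.mem_biUnion]
    refine ⟨i, ?_, ?_⟩
    · rw [mem_support_iff]; rintro h'; rw [h'] at h; simp at h
    · exact Finset.mem_image.2 ⟨m, MvPolynomial.mem_support_iff.2 h, rfl⟩

theorem phiE_descend (P : (MvPolynomial (Fin (n + 1)) K)[X]) (hP : phiE Fq K n P = P) :
    ∃ Q : (MvPolynomial (Fin (n + 1)) Fq)[X], Q.map (MvPolynomial.map (algebraMap Fq K)) = P := by
  have : P ∈ lifts (MvPolynomial.map (σ := Fin (n + 1)) (algebraMap Fq K)) := by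
    rw [lifts_iff_coeff_lifts]
    intro i
    have := (MvPolynomial.mem_range_map_iff_coeffs_subset (f := algebraMap Fq K) (x := P.coeff i)).2 (by
      intro c hc
      obtain ⟨m, -, rfl⟩ := MvPolynomial.mem_coeffs_iff.1 hc
      apply mem_range_of_pow_card
      rw [← phiE_coeff, hP])
    exact this
  obtain ⟨Q, hQ⟩ := this
  exact ⟨Q, hQ⟩

set_option maxHeartbeats 1600000 in
variable (K) in
theorem geom_factor_aux (Ω : Type) [Field Ω] [Algebra L Ω] [Algebra K Ω] [Algebra Fq Ω]
    [IsScalarTower Fq L Ω] [IsScalarTower Fq K Ω] [IsGalois L Ω] (θ : L) (fB : (MvPolynomial (Fin (n + 1)) Fq)[X]) (hmon : fB.Monic)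
    (hfB : fB.map (algebraMap _ L) = ∏ g : L ≃ₐ[Ka] L, (X - C (g θ)))
    (hθ : Function.Injective fun g : L ≃ₐ[Ka] L => g θ) {E : ℕ} (hE : 1 ≤ E)
    (hcoef : ∀ k, (fB.coeff k).totalDegree ≤ E) (G1 : Set (L ≃ₐ[Ka] L))
    (hG1 : ∀ g ∈ G1, ∀ y : L, (∃ k : ℕ, 0 < k ∧ y ^ Fintype.card Fq ^ k = y) → g y = y ^ Fintype.card Fq) :
    ∃ (e : ℕ) (fs : ℕ → (MvPolynomial (Fin (n + 1)) K)[X]),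
      (∀ j, (fs j).Monic ∧ Irreducible (fs j) ∧ (fs j).natDegree ≤ Nat.card (L ≃ₐ[Ka] L) ∧
        ∀ k, ((fs j).coeff k).totalDegree ≤ E * Nat.card (L ≃ₐ[Ka] L)) ∧
      e * Nat.card G1 ≤ Nat.card (L ≃ₐ[Ka] L) ∧
      fB.map (MvPolynomial.map (algebraMap Fq K)) ∣ ∏ j ∈ Finset.range e, fs j ∧
      ∀ j, fs j ∣ fB.map (MvPolynomial.map (algebraMap Fq K)) := by
  classical
  have hinj := inj_BL (σ := Fin (n + 1)) (F := Fq) (L := L) Ka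
  have hPhi := Phi_inj (K := K) (Ω := Ω) hinj
  set fK := fB.map (MvPolynomial.map (algebraMap Fq K)) with hfK
  have hfKm : fK.Monic := hmon.map _
  have hsp : fK.map (Phi n Fq K L Ω) = (∏ g : L ≃ₐ[Ka] L, (X - C (g θ))).map (algebraMap L Ω) := by
    rw [← hfB, hfK, Polynomial.map_map, Polynomial.map_map, Phi_comp]
  have hdeg : fK.natDegree = Nat.card (L ≃ₐ[Ka] L) := by
    rw [← hfKm.natDegree_map (Phi n Fq K L Ω), hsp, natDegree_map, natDegree_prod_of_monic _ _ fun g _ => monic_X_sub_C _]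
    simp [Nat.card_eq_fintype_card]
  obtain ⟨f1, hf1m, hf1i, hf1d⟩ := exists_monic_irred_factor fK hfKm (by rw [hdeg]; exact Nat.card_pos)
  set φ := phiE Fq K n with hφ
  have hφfK : φ fK = fK := by
    ext i m
    rw [phiE_coeff, hfK, coeff_map, MvPolynomial.coeff_map, ← map_pow, FiniteField.pow_card]
  have hall : ∀ j, (φ^[j] f1).Monic ∧ Irreducible (φ^[j] f1) ∧ φ^[j] f1 ∣ fK := by
    intro j
    induction j with
    | zero => exact ⟨hf1m, hf1i, hf1d⟩
    | succ j ih =>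
      rw [Function.iterate_succ_apply']
      refine ⟨?_, (MulEquiv.irreducible_iff φ).2 ih.2.1, ?_⟩
      · have : φ (φ^[j] f1) = (φ^[j] f1).map (frobE Fq K n : MvPolynomial (Fin (n + 1)) K →+* _) := rfl
        rw [this]; exact ih.1.map _
      · have h5 := map_dvd φ ih.2.2
        rwa [hφfK] at h5
  have hper : f1 ∈ Function.periodicPts φ := phiE_period f1
  set e := Function.minimalPeriod φ f1 with he
  have hepos : 0 < e := Function.minimalPeriod_pos_of_mem_periodicPts hper
  refine ⟨e, fun j => φ^[j] f1, fun j => ⟨(hall j).1, (hall j).2.1, ?_, fun k => ?_⟩, ?_, ?_, fun j => (hall j).2.2⟩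
  · rw [← hdeg]; exact natDegree_le_of_dvd (hall j).2.2 hfKm.ne_zero
  · refine (factor_totalDegree hPhi (fun g : L ≃ₐ[Ka] L => g θ) fK _ hfKm (hall j).1 (hall j).2.2 hsp hE ?_ k).trans ?_
    · intro k
      rw [hfK, coeff_map]
      exact (Finset.sup_mono (MvPolynomial.support_map_subset _ _)).trans (hcoef k)
    · gcongr
      rw [← hdeg]; exact natDegree_le_of_dvd (hall j).2.2 hfKm.ne_zero
  · -- counting
    rcases Set.eq_empty_or_nonempty G1 with h | ⟨σ0, hσ0⟩
    · rw [h]; simp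
    have hhat : ∀ j, ∃ fh : L[X], fh.map (algebraMap L Ω) = (φ^[j] f1).map (Phi n Fq K L Ω) := by
      intro j
      refine exists_hat (fun g : L ≃ₐ[Ka] L => g θ) _ ((hall j).1.map _) ?_
      rw [← hsp]
      exact Polynomial.map_dvd _ (hall j).2.2
    choose fh hfh using hhat
    have hact : ∀ g ∈ G1, ∀ j, (fh j).map (g : L →+* L) = fh (j + 1) := by
      intro g hg j
      apply Polynomial.map_injective _ (algebraMap L Ω).injective
      rw [hfh (j + 1), Function.iterate_succ_apply']
      ext i
      rw [coeff_map, coeff_map, coeff_map, phiE_coeff']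
      refine gal_coeff hinj ((g : L →ₐ[Ka] L).restrictScalars (MvPolynomial (Fin (n + 1)) Fq)) (hG1 g hg) _ _ ?_
      have := congrArg (fun r : Polynomial Ω => r.coeff i) (hfh j)
      simpa using this
    have hact2 : ∀ j k, (fh k).map ((σ0 ^ j : L ≃ₐ[Ka] L) : L →+* L) = fh (k + j) := by
      intro j
      induction j with
      | zero =>
        intro k
        ext i; simp
      | succ j ih =>
        intro k
        have h1 : (fh k).map ((σ0 ^ (j + 1) : L ≃ₐ[Ka] L) : L →+* L) =
            ((fh k).map (σ0 : L →+* L)).map ((σ0 ^ j : L ≃ₐ[Ka] L) : L →+* L) := by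
          ext i
          simp only [coeff_map]
          rw [pow_succ]; rfl
        rw [h1, hact σ0 hσ0, ih]; congr 1; omega
    have hinjm : Function.Injective (fun x : Fin e × G1 => σ0 ^ (x.1 : ℕ) * (x.2 : L ≃ₐ[Ka] L)) := by
      rintro ⟨i, g⟩ ⟨i', g'⟩ h
      simp only at h
      have h1 : ∀ (i : ℕ) (g : G1), (fh 0).map ((σ0 ^ i * (g : L ≃ₐ[Ka] L) : L ≃ₐ[Ka] L) : L →+* L) = fh (1 + i) := by
        intro i g
        have h1 : (fh 0).map ((σ0 ^ i * (g : L ≃ₐ[Ka] L) : L ≃ₐ[Ka] L) : L →+* L) =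
            ((fh 0).map ((g : L ≃ₐ[Ka] L) : L →+* L)).map ((σ0 ^ i : L ≃ₐ[Ka] L) : L →+* L) := by
          ext i
          simp only [coeff_map]
          rfl
        rw [h1, hact g g.2, hact2]
      have h2 : fh (1 + i) = fh (1 + i') := by rw [← h1 i g, ← h1 i' g', h]
      have h3 : φ^[(i : ℕ)] f1 = φ^[(i' : ℕ)] f1 := by
        apply φ.injective
        rw [← Function.iterate_succ_apply' φ, ← Function.iterate_succ_apply' φ]
        apply Polynomial.map_injective _ hPhi
        rw [← hfh, ← hfh, Nat.succ_eq_add_one, Nat.succ_eq_add_one, add_comm, h2, add_comm]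
      have h4 : (i : ℕ) = i' := Function.iterate_injOn_Iio_minimalPeriod (f := φ) (x := f1) i.2 i'.2 h3
      have h5 : i = i' := Fin.ext h4
      subst h5
      rw [mul_right_inj] at h
      rw [Subtype.ext h]
    have := Nat.card_le_card_of_injective _ hinjm
    rwa [Nat.card_prod, Nat.card_eq_fintype_card, Fintype.card_fin] at this
  · -- divisibility
    set P := ∏ j ∈ Finset.range e, φ^[j] f1 with hP
    have hφP : φ P = P := by
      have h1 : φ P = ∏ j ∈ Finset.range e, φ^[j + 1] f1 := by
        rw [hP, map_prod]
        exact Finset.prod_congr rfl fun j _ => (Function.iterate_succ_apply' _ _ _).symm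
      have h2 := Finset.prod_range_succ' (fun j => φ^[j] f1) e
      rw [Finset.prod_range_succ, ← h1, ← hP] at h2
      have h3 : φ^[e] f1 = f1 := Function.iterate_minimalPeriod
      rw [h3] at h2
      exact (mul_right_cancel₀ hf1m.ne_zero h2).symm
    obtain ⟨Q, hQ⟩ := phiE_descend P hφP
    have hf1P : f1 ∣ P := by
      have := Finset.dvd_prod_of_mem (fun j => φ^[j] f1) (Finset.mem_range.2 hepos)
      exact this
    have hs : (f1.map (Phi n Fq K L Ω)).Splits := by
      refine Splits.of_dvd (g := fK.map (Phi n Fq K L Ω)) ?_ (hfKm.map _).ne_zero (Polynomial.map_dvd _ hf1d)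
      rw [hsp, Polynomial.map_prod]
      refine Splits.prod fun i _ => ?_
      rw [Polynomial.map_sub, map_X, map_C]
      exact Splits.X_sub_C _
    obtain ⟨α, hα⟩ := hs.exists_eval_eq_zero (by
      rw [degree_eq_natDegree (hf1m.map _).ne_zero, hf1m.natDegree_map]
      intro h
      have : f1.natDegree = 0 := by exact_mod_cast h
      rw [hf1m.natDegree_eq_zero] at this
      rw [this] at hf1i; exact hf1i.not_isUnit isUnit_one)
    have h1 := eval_eq_zero_of_dvd_of_eval_eq_zero (Polynomial.map_dvd (Phi n Fq K L Ω) hf1d) hα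
    rw [hsp, Polynomial.map_prod, eval_prod, Finset.prod_eq_zero_iff] at h1
    obtain ⟨g, _, hg⟩ := h1
    simp only [Polynomial.map_sub, map_X, map_C, eval_sub, eval_X, eval_C] at hg
    rw [sub_eq_zero] at hg
    have h2 : (Q.map (algebraMap _ L)).eval (g θ) = 0 := by
      apply (algebraMap L Ω).injective
      rw [map_zero, ← eval_map_apply, ← hg, Polynomial.map_map, ← Phi_comp (K := K), ← Polynomial.map_map, hQ]
      exact eval_eq_zero_of_dvd_of_eval_eq_zero (Polynomial.map_dvd _ hf1P) hα
    have h3 : ∀ h : L ≃ₐ[Ka] L, (Q.map (algebraMap _ L)).eval (h θ) = 0 := by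
      intro h
      have h4 : h θ = (h * g⁻¹) (g θ) := by
        change h θ = h (g.symm (g θ)); rw [AlgEquiv.symm_apply_apply]
      have h5 := congrArg (h * g⁻¹) h2
      rw [map_zero, eval_map, ← aeval_def] at h5
      rw [eval_map, ← aeval_def, h4]
      rw [← h5]
      exact aeval_algHom_apply (((h * g⁻¹ : L ≃ₐ[Ka] L) : L →ₐ[Ka] L).restrictScalars (MvPolynomial (Fin (n + 1)) Fq)) (g θ) Q
    have h4 : fB.map (algebraMap _ L) ∣ Q.map (algebraMap _ L) := by
      rw [hfB]
      refine Finset.prod_dvd_of_coprime ?_ fun h _ => dvd_iff_isRoot.2 (h3 h)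
      intro a _ b _ hab
      exact pairwise_coprime_X_sub_C hθ hab
    have h5 : fB ∣ Q := by
      rw [← modByMonic_eq_zero_iff_dvd hmon]
      apply Polynomial.map_injective _ hinj
      rw [map_modByMonic _ hmon, Polynomial.map_zero, modByMonic_eq_zero_iff_dvd (hmon.map _)]
      exact h4
    rw [← hQ]
    exact Polynomial.map_dvd _ h5

variable (K) in
theorem geom_factor [Algebra.IsSeparable Fq K] (θ : L) (fB : (MvPolynomial (Fin (n + 1)) Fq)[X]) (hmon : fB.Monic)
    (hfB : fB.map (algebraMap _ L) = ∏ g : L ≃ₐ[Ka] L, (X - C (g θ)))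
    (hθ : Function.Injective fun g : L ≃ₐ[Ka] L => g θ) {E : ℕ} (hE : 1 ≤ E)
    (hcoef : ∀ k, (fB.coeff k).totalDegree ≤ E) (G1 : Set (L ≃ₐ[Ka] L))
    (hG1 : ∀ g ∈ G1, ∀ y : L, (∃ k : ℕ, 0 < k ∧ y ^ Fintype.card Fq ^ k = y) → g y = y ^ Fintype.card Fq) :
    ∃ (e : ℕ) (fs : ℕ → (MvPolynomial (Fin (n + 1)) K)[X]),
      (∀ j, (fs j).Monic ∧ Irreducible (fs j) ∧ (fs j).natDegree ≤ Nat.card (L ≃ₐ[Ka] L) ∧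
        ∀ k, ((fs j).coeff k).totalDegree ≤ E * Nat.card (L ≃ₐ[Ka] L)) ∧
      e * Nat.card G1 ≤ Nat.card (L ≃ₐ[Ka] L) ∧
      fB.map (MvPolynomial.map (algebraMap Fq K)) ∣ ∏ j ∈ Finset.range e, fs j ∧
      ∀ j, fs j ∣ fB.map (MvPolynomial.map (algebraMap Fq K)) := by
  let j : K →ₐ[Fq] SeparableClosure L := IsSepClosed.lift
  let _ : Algebra K (SeparableClosure L) := j.toRingHom.toAlgebra
  have : IsScalarTower Fq K (SeparableClosure L) := IsScalarTower.of_algebraMap_eq fun x => (j.commutes x).symm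
  exact geom_factor_aux K (SeparableClosure L) θ fB hmon hfB hθ hE hcoef G1 hG1

end Geom
end FCE

set_option linter.unusedSectionVars false
namespace FCE

theorem card_zeros {n : ℕ} {Fq : Type} [Field Fq] [Fintype Fq] [DecidableEq Fq] (b : MvPolynomial (Fin (n + 1)) Fq)
    (hb : b ≠ 0) : (Finset.univ.filter fun a : Fin (n + 1) → Fq => MvPolynomial.eval a b = 0).card ≤
      b.totalDegree * Fintype.card Fq ^ n := by
  have h1 := MvPolynomial.schwartz_zippel_totalDegree hb (Finset.univ : Finset Fq)
  rw [Finset.card_univ, Fintype.piFinset_univ] at h1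
  have hq : (0 : ℚ≥0) < Fintype.card Fq := by exact_mod_cast Fintype.card_pos
  rw [div_le_div_iff₀ (by positivity) hq] at h1
  have h2 : (Finset.univ.filter fun a : Fin (n + 1) → Fq => MvPolynomial.eval a b = 0).card * Fintype.card Fq ≤
      b.totalDegree * Fintype.card Fq ^ (n + 1) := by exact_mod_cast h1
  rw [pow_succ, ← mul_assoc] at h2
  exact Nat.le_of_mul_le_mul_right h2 Fintype.card_pos

section Psi
variable {n : ℕ} {Fq K L Ka : Type} [Field Fq] [Fintype Fq] [Field K] [Algebra Fq K]
  [Field L] [Algebra Fq L] [Algebra (MvPolynomial (Fin (n + 1)) Fq) L]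
  [IsScalarTower Fq (MvPolynomial (Fin (n + 1)) Fq) L]
  [Field Ka] [Algebra (MvPolynomial (Fin (n + 1)) Fq) Ka] [IsFractionRing (MvPolynomial (Fin (n + 1)) Fq) Ka]
  [Algebra Ka L] [IsScalarTower (MvPolynomial (Fin (n + 1)) Fq) Ka L] [FiniteDimensional Ka L] [IsGalois Ka L]

theorem exists_hom_algClosed {S : Type} [CommRing S] [IsDomain S] [Algebra Fq S] [Algebra.IsAlgebraic Fq S]
    [IsAlgClosed K] : Nonempty (S →ₐ[Fq] K) := by
  have : FaithfulSMul Fq S := (faithfulSMul_iff_algebraMap_injective Fq S).2 (algebraMap Fq S).injective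
  exact ⟨IsAlgClosed.lift⟩

theorem exists_psi_aux {A : Type} [CommRing A] [Algebra (MvPolynomial (Fin (n + 1)) Fq) A]
    [Algebra.IsIntegral (MvPolynomial (Fin (n + 1)) Fq) A] [IsAlgClosed K] (a : Fin (n + 1) → Fq)
    (Q : Ideal A) [hQ : Q.IsPrime] (hQc : Q.comap (algebraMap (MvPolynomial (Fin (n + 1)) Fq) A) = RingHom.ker (MvPolynomial.eval a)) :
    ∃ ψ : A →+* K, ∀ b, ψ (algebraMap _ _ b) = algebraMap Fq K (MvPolynomial.eval a b) := by
  let _ : Algebra Fq (A ⧸ Q) := ((Ideal.Quotient.mk Q).comp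
    ((algebraMap (MvPolynomial (Fin (n + 1)) Fq) A).comp MvPolynomial.C)).toAlgebra
  have hb : ∀ b : MvPolynomial (Fin (n + 1)) Fq, Ideal.Quotient.mk Q (algebraMap _ _ b) =
      algebraMap Fq (A ⧸ Q) (MvPolynomial.eval a b) := by
    intro b
    have h1 : b - MvPolynomial.C (MvPolynomial.eval a b) ∈
        Q.comap (algebraMap (MvPolynomial (Fin (n + 1)) Fq) A) := by
      rw [hQc, RingHom.mem_ker]; simp
    rw [Ideal.mem_comap, map_sub, ← Ideal.Quotient.eq_zero_iff_mem, map_sub, sub_eq_zero] at h1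
    rw [h1]; rfl
  have halg : Algebra.IsAlgebraic Fq (A ⧸ Q) := by
    constructor
    intro z
    obtain ⟨z, rfl⟩ := Ideal.Quotient.mk_surjective z
    apply IsIntegral.isAlgebraic
    exact (Algebra.IsIntegral.isIntegral (R := MvPolynomial (Fin (n + 1)) Fq) z).map_of_comp_eq (MvPolynomial.eval a) (Ideal.Quotient.mk Q)
      (RingHom.ext fun b => (hb b).symm)
  obtain ⟨f⟩ := exists_hom_algClosed (Fq := Fq) (K := K) (S := A ⧸ Q)
  refine ⟨(f : _ →+* K).comp (Ideal.Quotient.mk Q), fun b => ?_⟩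
  rw [RingHom.comp_apply, hb]
  exact f.commutes _

variable (K) in
theorem exists_psi [IsAlgClosed K] (hinj : Function.Injective (algebraMap (MvPolynomial (Fin (n + 1)) Fq) L))
    (a : Fin (n + 1) → Fq) :
    ∃ ψ : integralClosure (MvPolynomial (Fin (n + 1)) Fq) L →+* K,
      ∀ b, ψ (algebraMap _ _ b) = algebraMap Fq K (MvPolynomial.eval a b) := by
  have hker : RingHom.ker (algebraMap (MvPolynomial (Fin (n + 1)) Fq)
      (integralClosure (MvPolynomial (Fin (n + 1)) Fq) L)) ≤ RingHom.ker (MvPolynomial.eval a) := by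
    intro b hb
    have h1 : algebraMap (MvPolynomial (Fin (n + 1)) Fq) L b = 0 := congrArg Subtype.val (RingHom.mem_ker.1 hb)
    rw [map_eq_zero_iff _ hinj] at h1
    rw [h1]; exact Ideal.zero_mem _
  have hprime : (RingHom.ker (MvPolynomial.eval a)).IsPrime := RingHom.ker_isPrime _
  obtain ⟨Q, hQ, hQc⟩ := Ideal.exists_ideal_over_prime_of_isIntegral_of_isDomain
    (S := integralClosure (MvPolynomial (Fin (n + 1)) Fq) L) _ hker
  exact exists_psi_aux a Q hQc

/-- numerator of the interpolation polynomial -/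
noncomputable def interpL (Ka : Type) [Field Ka] [Algebra Ka L] [FiniteDimensional Ka L] [DecidableEq (L ≃ₐ[Ka] L)]
    (θ z : L) : L[X] :=
  ∑ g : L ≃ₐ[Ka] L, C (g z) * ∏ g' ∈ Finset.univ.erase g, (X - C (g' θ))

theorem interpL_eval [DecidableEq (L ≃ₐ[Ka] L)] (θ z : L) (g : L ≃ₐ[Ka] L) :
    (interpL Ka θ z).eval (g θ) = g z * (interpL Ka θ 1).eval (g θ) := by
  have h : ∀ z : L, (interpL Ka θ z).eval (g θ) = g z * ∏ g' ∈ Finset.univ.erase g, (g θ - g' θ) := by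
    intro z
    unfold interpL
    rw [eval_finsetSum, Finset.sum_eq_single g]
    · simp [eval_prod]
    · intro b _ hb
      rw [eval_mul, eval_prod, Finset.prod_eq_zero (Finset.mem_erase.2 ⟨hb.symm, Finset.mem_univ g⟩), mul_zero]
      simp
    · intro h; exact absurd (Finset.mem_univ _) h
  rw [h, h, map_one, one_mul]

theorem interpL_one_eval [DecidableEq (L ≃ₐ[Ka] L)] (θ : L) (g : L ≃ₐ[Ka] L) :
    (interpL Ka θ 1).eval (g θ) = ∏ g' ∈ Finset.univ.erase g, (g θ - g' θ) := by
  unfold interpL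
  rw [eval_finsetSum, Finset.sum_eq_single g]
  · simp [eval_prod]
  · intro b _ hb
    rw [eval_mul, eval_prod, Finset.prod_eq_zero (Finset.mem_erase.2 ⟨hb.symm, Finset.mem_univ g⟩), mul_zero]
    simp
  · intro h; exact absurd (Finset.mem_univ _) h

theorem interpL_one [DecidableEq (L ≃ₐ[Ka] L)] (θ : L) :
    interpL Ka θ 1 = derivative (∏ g : L ≃ₐ[Ka] L, (X - C (g θ))) := by
  unfold interpL
  rw [derivative_prod_finset]
  refine Finset.sum_congr rfl fun g _ => ?_
  simp

theorem interpL_map [DecidableEq (L ≃ₐ[Ka] L)] (θ z : L) (h : L ≃ₐ[Ka] L) :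
    (interpL Ka θ z).map (h : L →+* L) = interpL Ka θ z := by
  unfold interpL
  rw [Polynomial.map_sum]
  refine Fintype.sum_equiv (Equiv.mulLeft h) _ _ fun g => ?_
  rw [Polynomial.map_mul, map_C, Polynomial.map_prod]
  congr 1
  refine Finset.prod_equiv (Equiv.mulLeft h) ?_ ?_
  · intro i; simp
  · intro i _
    simp

theorem lin_mem_FilP {E : ℕ} (hE : 1 ≤ E) {θ : L} (hθ : θ ∈ Wt (Fin (n + 1)) Fq L E) :
    X - C θ ∈ FilP (isFil_Wt (σ := Fin (n + 1)) (F := Fq) (L := L)) E := by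
  refine ⟨by rw [natDegree_X_sub_C]; exact hE, fun k => ?_⟩
  rw [coeff_sub, coeff_X, coeff_C]
  refine AddSubgroup.sub_mem _ ?_ ?_
  · split_ifs
    · exact isFil_Wt.mono (Nat.zero_le _) isFil_Wt.one_mem
    · exact AddSubgroup.zero_mem _
  · split_ifs
    · exact hθ
    · exact AddSubgroup.zero_mem _

theorem interpL_mem [DecidableEq (L ≃ₐ[Ka] L)] {E : ℕ} (hE : 1 ≤ E) {θ z : L} (hθ : θ ∈ Wt (Fin (n + 1)) Fq L E)
    (hz : z ∈ Wt (Fin (n + 1)) Fq L E) :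
    interpL Ka θ z ∈ FilP (isFil_Wt (σ := Fin (n + 1)) (F := Fq) (L := L)) (E * Nat.card (L ≃ₐ[Ka] L)) := by
  have hW := isFil_FilP (isFil_Wt (σ := Fin (n + 1)) (F := Fq) (L := L))
  refine AddSubgroup.sum_mem _ fun g _ => ?_
  have h1 : C (g z) ∈ FilP (isFil_Wt (σ := Fin (n + 1)) (F := Fq) (L := L)) E := by
    refine ⟨by simp, fun k => ?_⟩
    rw [coeff_C]; split_ifs
    · exact Wt_gal g hz
    · exact AddSubgroup.zero_mem _
  have h2 := hW.prod_mem (Finset.univ.erase g) (x := fun g' => X - C (g' θ)) fun g' _ => lin_mem_FilP hE (Wt_gal g' hθ)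
  have h3 := hW.mul_mem h1 h2
  refine hW.mono ?_ h3
  rw [Finset.card_erase_of_mem (Finset.mem_univ _), Finset.card_univ, ← Nat.card_eq_fintype_card]
  have : 0 < Nat.card (L ≃ₐ[Ka] L) := Nat.card_pos
  obtain ⟨c, hc⟩ := Nat.exists_eq_succ_of_ne_zero this.ne'
  rw [hc, Nat.succ_sub_one, Nat.mul_succ]; omega

variable (Ka) in
theorem exists_interp [DecidableEq (L ≃ₐ[Ka] L)] {E : ℕ} (hE : 1 ≤ E) {θ z : L} (hθ : θ ∈ Wt (Fin (n + 1)) Fq L E)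
    (hz : z ∈ Wt (Fin (n + 1)) Fq L E) :
    ∃ h : (MvPolynomial (Fin (n + 1)) Fq)[X], h.natDegree ≤ E * Nat.card (L ≃ₐ[Ka] L) ∧
      (∀ i, (h.coeff i).totalDegree ≤ E * Nat.card (L ≃ₐ[Ka] L)) ∧ h.map (algebraMap _ L) = interpL Ka θ z := by
  have h1 := interpL_mem (Ka := Ka) hE hθ hz
  obtain ⟨b, hb1, hb2, hb3⟩ := poly_descend Ka h1.2 (interpL_map θ z)
  exact ⟨b, hb1.trans h1.1, hb2, hb3⟩

variable (Ka) in
theorem exists_fB {E : ℕ} (hE : 1 ≤ E) {θ : L} (hθ : θ ∈ Wt (Fin (n + 1)) Fq L E) :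
    ∃ h : (MvPolynomial (Fin (n + 1)) Fq)[X], h.Monic ∧
      (∀ i, (h.coeff i).totalDegree ≤ E * Nat.card (L ≃ₐ[Ka] L)) ∧
      h.map (algebraMap _ L) = ∏ g : L ≃ₐ[Ka] L, (X - C (g θ)) := by
  have hW := isFil_FilP (isFil_Wt (σ := Fin (n + 1)) (F := Fq) (L := L))
  have h2 := hW.prod_mem (Finset.univ : Finset (L ≃ₐ[Ka] L)) (x := fun g' => X - C (g' θ))
    fun g' _ => lin_mem_FilP hE (Wt_gal g' hθ)
  rw [Finset.card_univ, ← Nat.card_eq_fintype_card] at h2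
  obtain ⟨b, hb1, hb2, hb3⟩ := poly_descend Ka h2.2 (by
    intro h
    rw [Polynomial.map_prod]
    refine Fintype.prod_equiv (Equiv.mulLeft h) _ _ fun g => ?_
    simp)
  refine ⟨b, ?_, hb2, hb3⟩
  have hinj := inj_BL (σ := Fin (n + 1)) (F := Fq) (L := L) Ka
  apply monic_of_injective hinj
  rw [hb3]
  exact monic_prod_of_monic _ _ fun g _ => monic_X_sub_C _

theorem exists_Wt {z : L} (hz : IsIntegral (MvPolynomial (Fin (n + 1)) Fq) z)
    (hinj : Function.Injective (algebraMap (MvPolynomial (Fin (n + 1)) Fq) L)) :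
    ∃ E, z ∈ Wt (Fin (n + 1)) Fq L E := by
  obtain ⟨p, hp, hpz⟩ := hz
  refine ⟨p.support.sup fun k => (p.coeff k).totalDegree, ?_⟩
  have := lead_mul_root (L := L) p (D := p.support.sup fun k => (p.coeff k).totalDegree) (by
    intro k
    by_cases hk : k ∈ p.support
    · exact Finset.le_sup (f := fun k => (p.coeff k).totalDegree) hk
    · rw [notMem_support_iff.1 hk]; simp) hinj (y := z) hpz
  rwa [hp.leadingCoeff, map_one, one_mul] at this

end Psi
end FCE

set_option linter.unusedSectionVars false
namespace FCE

section Frob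
variable {n : ℕ} {Fq K L Ka : Type} [Field Fq] [Fintype Fq] [Field K] [Algebra Fq K]
  [Field L] [Algebra Fq L] [Algebra (MvPolynomial (Fin (n + 1)) Fq) L]
  [IsScalarTower Fq (MvPolynomial (Fin (n + 1)) Fq) L]
  [Field Ka] [Algebra (MvPolynomial (Fin (n + 1)) Fq) Ka] [IsFractionRing (MvPolynomial (Fin (n + 1)) Fq) Ka]
  [Algebra Ka L] [IsScalarTower (MvPolynomial (Fin (n + 1)) Fq) Ka L] [FiniteDimensional Ka L] [IsGalois Ka L]

/-- the action of the Galois group on the integral closure -/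
noncomputable def gA (g : L ≃ₐ[Ka] L) : integralClosure (MvPolynomial (Fin (n + 1)) Fq) L →ₐ[MvPolynomial (Fin (n + 1)) Fq]
    integralClosure (MvPolynomial (Fin (n + 1)) Fq) L :=
  AlgHom.mapIntegralClosure ((g : L →ₐ[Ka] L).restrictScalars (MvPolynomial (Fin (n + 1)) Fq))

theorem coe_gA (g : L ≃ₐ[Ka] L) (z : integralClosure (MvPolynomial (Fin (n + 1)) Fq) L) :
    ((gA g z : integralClosure (MvPolynomial (Fin (n + 1)) Fq) L) : L) = g z := rfl

theorem gA_mul (g h : L ≃ₐ[Ka] L) (z : integralClosure (MvPolynomial (Fin (n + 1)) Fq) L) :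
    gA (g * h) z = gA g (gA h z) := rfl

variable (K) in
/-- evaluation at a point -/
noncomputable def ev (a : Fin (n + 1) → Fq) : MvPolynomial (Fin (n + 1)) Fq →+* K :=
  (algebraMap Fq K).comp (MvPolynomial.eval a)

theorem psi_eval {a : Fin (n + 1) → Fq} (ψ : integralClosure (MvPolynomial (Fin (n + 1)) Fq) L →+* K)
    (hψ : ∀ b, ψ (algebraMap _ _ b) = algebraMap Fq K (MvPolynomial.eval a b)) (h : (MvPolynomial (Fin (n + 1)) Fq)[X])
    (z : integralClosure (MvPolynomial (Fin (n + 1)) Fq) L) : ψ (aeval z h) = eval₂ (ev K a) (ψ z) h := by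
  rw [aeval_def, hom_eval₂]
  congr 1
  exact RingHom.ext hψ

theorem ev_pow (a : Fin (n + 1) → Fq) (h : (MvPolynomial (Fin (n + 1)) Fq)[X]) (y : K) :
    eval₂ (ev K a) (y ^ Fintype.card Fq) h = eval₂ (ev K a) y h ^ Fintype.card Fq := by
  have := hom_eval₂ h (ev K a) (FiniteField.frobeniusAlgHom Fq K : K →+* K) y
  have h2 : (FiniteField.frobeniusAlgHom Fq K : K →+* K).comp (ev K a) = ev K a :=
    RingHom.ext fun b => (FiniteField.frobeniusAlgHom Fq K).commutes _
  rw [h2] at this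
  exact this.symm

theorem coe_aeval (h : (MvPolynomial (Fin (n + 1)) Fq)[X]) (z : integralClosure (MvPolynomial (Fin (n + 1)) Fq) L) :
    ((aeval z h : integralClosure (MvPolynomial (Fin (n + 1)) Fq) L) : L) = (h.map (algebraMap _ L)).eval (z : L) := by
  rw [eval_map_algebraMap]
  exact (aeval_algHom_apply (integralClosure (MvPolynomial (Fin (n + 1)) Fq) L).val z h).symm

theorem interp_psi [DecidableEq (L ≃ₐ[Ka] L)] {a : Fin (n + 1) → Fq} (ψ : integralClosure (MvPolynomial (Fin (n + 1)) Fq) L →+* K)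
    (hψ : ∀ b, ψ (algebraMap _ _ b) = algebraMap Fq K (MvPolynomial.eval a b))
    (θ z : integralClosure (MvPolynomial (Fin (n + 1)) Fq) L) (h w : (MvPolynomial (Fin (n + 1)) Fq)[X])
    (hh : h.map (algebraMap _ L) = interpL Ka (θ : L) z) (hw : w.map (algebraMap _ L) = interpL Ka (θ : L) 1) (g : L ≃ₐ[Ka] L) :
    eval₂ (ev K a) (ψ (gA g θ)) h = ψ (gA g z) * eval₂ (ev K a) (ψ (gA g θ)) w := by
  rw [← psi_eval ψ hψ, ← psi_eval ψ hψ, ← map_mul]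
  congr 1
  apply Subtype.ext
  rw [Subalgebra.coe_mul, coe_aeval, coe_aeval, hh, hw, coe_gA, coe_gA, interpL_eval]

theorem fB_psi {a : Fin (n + 1) → Fq} (ψ : integralClosure (MvPolynomial (Fin (n + 1)) Fq) L →+* K)
    (hψ : ∀ b, ψ (algebraMap _ _ b) = algebraMap Fq K (MvPolynomial.eval a b))
    (θ : integralClosure (MvPolynomial (Fin (n + 1)) Fq) L) (fB : (MvPolynomial (Fin (n + 1)) Fq)[X])
    (hfB : fB.map (algebraMap _ L) = ∏ g : L ≃ₐ[Ka] L, (X - C (g θ))) :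
    fB.map (ev K a) = ∏ g : L ≃ₐ[Ka] L, (X - C (ψ (gA g θ))) := by
  have h1 : fB.map (algebraMap _ (integralClosure (MvPolynomial (Fin (n + 1)) Fq) L)) =
      ∏ g : L ≃ₐ[Ka] L, (X - C (gA g θ)) := by
    apply Polynomial.map_injective (algebraMap (integralClosure (MvPolynomial (Fin (n + 1)) Fq) L) L) Subtype.val_injective
    rw [Polynomial.map_map, ← IsScalarTower.algebraMap_eq, hfB, Polynomial.map_prod]
    refine Finset.prod_congr rfl fun g _ => ?_
    rw [Polynomial.map_sub, map_X, map_C]; rfl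
  have h2 : ev K a = ψ.comp (algebraMap _ _) := (RingHom.ext hψ).symm
  rw [h2, ← Polynomial.map_map, h1, Polynomial.map_prod]
  refine Finset.prod_congr rfl fun g _ => ?_
  rw [Polynomial.map_sub, map_X, map_C]

theorem frob_exists [DecidableEq (L ≃ₐ[Ka] L)] {a : Fin (n + 1) → Fq} (ψ : integralClosure (MvPolynomial (Fin (n + 1)) Fq) L →+* K)
    (hψ : ∀ b, ψ (algebraMap _ _ b) = algebraMap Fq K (MvPolynomial.eval a b))
    (θ : integralClosure (MvPolynomial (Fin (n + 1)) Fq) L) (fB w : (MvPolynomial (Fin (n + 1)) Fq)[X])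
    (hfB : fB.map (algebraMap _ L) = ∏ g : L ≃ₐ[Ka] L, (X - C (g θ)))
    (hw : w.map (algebraMap _ L) = interpL Ka (θ : L) 1)
    (hne : ∀ g : L ≃ₐ[Ka] L, eval₂ (ev K a) (ψ (gA g θ)) w ≠ 0) :
    ∃ s : L ≃ₐ[Ka] L, ∀ z, ψ (gA s z) = ψ z ^ Fintype.card Fq := by
  have hinj := inj_BL (σ := Fin (n + 1)) (F := Fq) (L := L) Ka
  have h1 : eval₂ (ev K a) (ψ θ) fB = 0 := by
    rw [← psi_eval ψ hψ]
    have : aeval θ fB = 0 := by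
      apply Subtype.ext
      rw [coe_aeval, hfB, eval_prod, Finset.prod_eq_zero (Finset.mem_univ (1 : L ≃ₐ[Ka] L))]
      · rfl
      · simp
    rw [this, map_zero]
  have h2 : eval₂ (ev K a) (ψ θ ^ Fintype.card Fq) fB = 0 := by
    rw [ev_pow, h1, zero_pow Fintype.card_ne_zero]
  rw [← eval_map, fB_psi ψ hψ θ fB hfB, eval_prod, Finset.prod_eq_zero_iff] at h2
  obtain ⟨s, -, hs⟩ := h2
  rw [eval_sub, eval_X, eval_C, sub_eq_zero] at hs
  refine ⟨s, fun z => ?_⟩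
  obtain ⟨E1, hE1⟩ := exists_Wt z.2 hinj
  obtain ⟨E2, hE2⟩ := exists_Wt θ.2 hinj
  obtain ⟨h, -, -, hh⟩ := exists_interp Ka (E := E1 + E2 + 1) (by omega) (isFil_Wt.mono (by omega) hE2) (isFil_Wt.mono (by omega) hE1)
  have h3 := interp_psi ψ hψ θ z h w hh hw 1
  have h4 := interp_psi ψ hψ θ z h w hh hw s
  have e1 : ∀ z : integralClosure (MvPolynomial (Fin (n + 1)) Fq) L, gA (1 : L ≃ₐ[Ka] L) z = z := fun z => rfl
  rw [e1, e1] at h3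
  have h5 := congrArg (fun x => x ^ Fintype.card Fq) h3
  simp only [mul_pow, ← ev_pow] at h5
  rw [hs, h4] at h5
  exact mul_right_cancel₀ (hne s) h5

theorem frob_mem_G1 (ψ : integralClosure (MvPolynomial (Fin (n + 1)) Fq) L →+* K)
    (s : L ≃ₐ[Ka] L) (hs : ∀ z, ψ (gA s z) = ψ z ^ Fintype.card Fq) (y : L)
    (hy : ∃ k : ℕ, 0 < k ∧ y ^ Fintype.card Fq ^ k = y) : s y = y ^ Fintype.card Fq := by
  obtain ⟨k, hk, hy⟩ := hy
  have hq : 1 < Fintype.card Fq := Fintype.one_lt_card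
  have hqk : 1 < Fintype.card Fq ^ k := Nat.one_lt_pow hk.ne' hq
  have hYint : IsIntegral (MvPolynomial (Fin (n + 1)) Fq) y := by
    refine ⟨X ^ Fintype.card Fq ^ k - X, ?_, ?_⟩
    · apply monic_X_pow_sub
      rw [degree_X]; exact_mod_cast hqk
    · simp [hy]
  set Y : integralClosure (MvPolynomial (Fin (n + 1)) Fq) L := ⟨y, hYint⟩ with hY
  set Z := gA s Y - Y ^ Fintype.card Fq with hZ
  have h0 : ψ Z = 0 := by rw [hZ, map_sub, map_pow, hs, sub_self]
  have hZq : Z ^ Fintype.card Fq ^ k = Z := by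
    apply Subtype.ext
    have hZL : (Z : L) = s y - y ^ Fintype.card Fq := rfl
    rw [Subalgebra.coe_pow, hZL]
    obtain ⟨p, hp⟩ := CharP.exists Fq
    obtain ⟨f, hp1, hp2⟩ := FiniteField.card Fq p
    have : Fact p.Prime := ⟨hp1⟩
    have : CharP L p := charP_of_injective_algebraMap (algebraMap Fq L).injective p
    have e1 : (s y) ^ Fintype.card Fq ^ k = s y := by rw [← map_pow, hy]
    have e2 : (y ^ Fintype.card Fq) ^ Fintype.card Fq ^ k = y ^ Fintype.card Fq := by
      rw [← pow_mul, mul_comm, pow_mul, hy]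
    have e3 : (s y - y ^ Fintype.card Fq) ^ Fintype.card Fq ^ k =
        (s y) ^ Fintype.card Fq ^ k - (y ^ Fintype.card Fq) ^ Fintype.card Fq ^ k := by
      have : Fintype.card Fq ^ k = p ^ ((f : ℕ) * k) := by rw [hp2, pow_mul]
      rw [this]
      exact sub_pow_char_pow _ _ _
    rw [e3, e1, e2]
  have hZ0 : Z = 0 := by
    by_contra hne
    have h1 : Z ^ (Fintype.card Fq ^ k - 1) = 1 := by
      apply mul_right_cancel₀ hne
      rw [← pow_succ, Nat.sub_add_cancel hqk.le, hZq, one_mul]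
    have h2 := congrArg ψ h1
    rw [map_pow, h0, map_one, zero_pow (by omega)] at h2
    exact zero_ne_one h2
  have := congrArg Subtype.val hZ0
  exact sub_eq_zero.1 this

end Frob
end FCE

set_option linter.unusedSectionVars false
namespace FCE

section Cheb
variable {n : ℕ} {Fq K L Ka : Type} [Field Fq] [Fintype Fq] [Field K] [Algebra Fq K]
  [Field L] [Algebra Fq L] [Algebra (MvPolynomial (Fin (n + 1)) Fq) L]
  [IsScalarTower Fq (MvPolynomial (Fin (n + 1)) Fq) L]
  [Field Ka] [Algebra (MvPolynomial (Fin (n + 1)) Fq) Ka] [IsFractionRing (MvPolynomial (Fin (n + 1)) Fq) Ka]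
  [Algebra Ka L] [IsScalarTower (MvPolynomial (Fin (n + 1)) Fq) Ka L] [FiniteDimensional Ka L] [IsGalois Ka L]

theorem map_ev (a : Fin (n + 1) → Fq) :
    (MvPolynomial.eval (fun i => algebraMap Fq K (a i))).comp (MvPolynomial.map (algebraMap Fq K)) = ev K a := by
  apply MvPolynomial.ringHom_ext
  · intro r; simp [ev]
  · intro i; simp [ev]

theorem eval_map_map (a : Fin (n + 1) → Fq) (h : (MvPolynomial (Fin (n + 1)) Fq)[X]) (y : K) :
    ((h.map (MvPolynomial.map (algebraMap Fq K))).map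
      (MvPolynomial.eval (fun i => algebraMap Fq K (a i)))).eval y = eval₂ (ev K a) y h := by
  rw [Polynomial.map_map, map_ev, eval_map]

theorem psi_inj [DecidableEq (L ≃ₐ[Ka] L)] {a : Fin (n + 1) → Fq} (ψ : integralClosure (MvPolynomial (Fin (n + 1)) Fq) L →+* K)
    (hψ : ∀ b, ψ (algebraMap _ _ b) = algebraMap Fq K (MvPolynomial.eval a b))
    (θ : integralClosure (MvPolynomial (Fin (n + 1)) Fq) L) (w : (MvPolynomial (Fin (n + 1)) Fq)[X])
    (hw : w.map (algebraMap _ L) = interpL Ka (θ : L) 1)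
    (hne : ∀ g : L ≃ₐ[Ka] L, eval₂ (ev K a) (ψ (gA g θ)) w ≠ 0) (g g' : L ≃ₐ[Ka] L) (h : ψ (gA g θ) = ψ (gA g' θ)) :
    g = g' := by
  by_contra hgg
  apply hne g
  rw [← psi_eval ψ hψ]
  have : aeval (gA g θ) w = ∏ g' ∈ Finset.univ.erase g, (gA g θ - gA g' θ) := by
    apply Subtype.ext
    rw [coe_aeval, hw, coe_gA, interpL_one_eval]
    simp [coe_gA]
  rw [this, map_prod]
  apply Finset.prod_eq_zero (Finset.mem_erase.2 ⟨Ne.symm hgg, Finset.mem_univ g'⟩)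
  rw [map_sub, h, sub_self]

set_option maxHeartbeats 800000 in
theorem Nsig_le [DecidableEq (L ≃ₐ[Ka] L)] {D q : ℕ} {B : ℝ}
    (hLW : ∀ (f w g : (MvPolynomial (Fin (n + 1)) K)[X]) (S : Finset ((Fin (n + 1) → Fq) × K)), f.Monic → Irreducible f →
      f.natDegree ≤ D → (∀ j, (f.coeff j).totalDegree ≤ D) → (∀ j, (w.coeff j).totalDegree ≤ D) → w.natDegree ≤ D →
      (∀ j, (g.coeff j).totalDegree ≤ D) → g.natDegree ≤ D →
      (∀ x ∈ S, (f.map (MvPolynomial.eval (fun i => algebraMap Fq K (x.1 i)))).eval x.2 = 0 ∧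
        ((derivative f).map (MvPolynomial.eval (fun i => algebraMap Fq K (x.1 i)))).eval x.2 ≠ 0 ∧
        (w.map (MvPolynomial.eval (fun i => algebraMap Fq K (x.1 i)))).eval x.2 ≠ 0 ∧
        (w.map (MvPolynomial.eval (fun i => algebraMap Fq K (x.1 i)))).eval x.2 * x.2 ^ q =
          (g.map (MvPolynomial.eval (fun i => algebraMap Fq K (x.1 i)))).eval x.2) → (S.card : ℝ) ≤ B)
    (ψ : (Fin (n + 1) → Fq) → integralClosure (MvPolynomial (Fin (n + 1)) Fq) L →+* K)
    (hψ : ∀ a b, ψ a (algebraMap _ _ b) = algebraMap Fq K (MvPolynomial.eval a b))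
    (θ : integralClosure (MvPolynomial (Fin (n + 1)) Fq) L) {E : ℕ} (hE : 1 ≤ E) (hθE : (θ : L) ∈ Wt (Fin (n + 1)) Fq L E)
    (fB w : (MvPolynomial (Fin (n + 1)) Fq)[X])
    (hfB : fB.map (algebraMap _ L) = ∏ g : L ≃ₐ[Ka] L, (X - C (g θ)))
    (hw : w.map (algebraMap _ L) = interpL Ka (θ : L) 1) (hwd : w.natDegree ≤ D) (hwc : ∀ j, (w.coeff j).totalDegree ≤ D)
    (hED : E * Nat.card (L ≃ₐ[Ka] L) ≤ D)
    (good : (Fin (n + 1) → Fq) → Prop) [DecidablePred good] (s : (Fin (n + 1) → Fq) → (L ≃ₐ[Ka] L))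
    (hne : ∀ a, good a → ∀ g : L ≃ₐ[Ka] L, eval₂ (ev K a) (ψ a (gA g θ)) w ≠ 0)
    (hs : ∀ a, good a → ∀ z, ψ a (gA (s a) z) = ψ a z ^ q)
    (e : ℕ) (fs : ℕ → (MvPolynomial (Fin (n + 1)) K)[X])
    (hfs : ∀ j, (fs j).Monic ∧ Irreducible (fs j) ∧ (fs j).natDegree ≤ D ∧ ∀ k, ((fs j).coeff k).totalDegree ≤ D)
    (hdvd : fB.map (MvPolynomial.map (algebraMap Fq K)) ∣ ∏ j ∈ Finset.range e, fs j)
    (hdvd' : ∀ j, fs j ∣ fB.map (MvPolynomial.map (algebraMap Fq K))) (σ : L ≃ₐ[Ka] L) :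
    ((Finset.univ.filter fun x : (Fin (n + 1) → Fq) × (L ≃ₐ[Ka] L) => good x.1 ∧ x.2⁻¹ * s x.1 * x.2 = σ).card : ℝ) ≤
      e * B := by
  classical
  have hinj := inj_BL (σ := Fin (n + 1)) (F := Fq) (L := L) Ka
  set P := Finset.univ.filter fun x : (Fin (n + 1) → Fq) × (L ≃ₐ[Ka] L) => good x.1 ∧ x.2⁻¹ * s x.1 * x.2 = σ with hP
  have hmap : ∀ (h : (MvPolynomial (Fin (n + 1)) Fq)[X]) (j : ℕ), ((h.map (MvPolynomial.map (algebraMap Fq K))).coeff j).totalDegree ≤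
      (h.coeff j).totalDegree := by
    intro h j
    rw [coeff_map]
    exact Finset.sup_mono (MvPolynomial.support_map_subset _ _)
  have hfw : derivative fB = w := by
    apply Polynomial.map_injective _ hinj
    rw [← derivative_map, hfB, hw, interpL_one]
  obtain ⟨h, hh1, hh2, hh3⟩ := exists_interp Ka hE hθE (Wt_gal σ hθE)
  set pt : (Fin (n + 1) → Fq) × (L ≃ₐ[Ka] L) → (Fin (n + 1) → Fq) × K := fun x => (x.1, ψ x.1 (gA x.2 θ)) with hpt
  have hptinj : Set.InjOn pt P := by
    rintro ⟨a, g⟩ hx ⟨a', g'⟩ hx' hxx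
    have h1 : a = a' := congrArg Prod.fst hxx
    subst h1
    have h2 : ψ a (gA g θ) = ψ a (gA g' θ) := congrArg Prod.snd hxx
    have hg : good a := (Finset.mem_filter.1 hx).2.1
    rw [psi_inj (ψ a) (hψ a) θ w hw (hne a hg) g g' h2]
  set Pj : ℕ → Finset ((Fin (n + 1) → Fq) × (L ≃ₐ[Ka] L)) := fun j => P.filter fun x =>
    ((fs j).map (MvPolynomial.eval (fun i => algebraMap Fq K (x.1 i)))).eval (pt x).2 = 0 with hPj
  have hcov : P ⊆ (Finset.range e).biUnion Pj := by
    rintro ⟨a, g⟩ hx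
    have h1 : (fB.map (ev K a)).eval (ψ a (gA g θ)) = 0 := by
      rw [fB_psi (ψ a) (hψ a) θ fB hfB, eval_prod, Finset.prod_eq_zero (Finset.mem_univ g)]
      simp
    rw [eval_map, ← eval_map_map] at h1
    have h2 := eval_eq_zero_of_dvd_of_eval_eq_zero
      (Polynomial.map_dvd (MvPolynomial.eval (fun i => algebraMap Fq K (a i))) hdvd) h1
    rw [Polynomial.map_prod, eval_prod, Finset.prod_eq_zero_iff] at h2
    obtain ⟨j, hj, hj'⟩ := h2
    exact Finset.mem_biUnion.2 ⟨j, hj, Finset.mem_filter.2 ⟨hx, hj'⟩⟩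
  have hbound : ∀ j, ((Pj j).card : ℝ) ≤ B := by
    intro j
    have h1 : ((Pj j).image pt).card = (Pj j).card :=
      Finset.card_image_of_injOn (hptinj.mono (Finset.coe_subset.2 (Finset.filter_subset _ _)))
    rw [← h1]
    refine hLW (fs j) (w.map (MvPolynomial.map (algebraMap Fq K))) (h.map (MvPolynomial.map (algebraMap Fq K))) _
      (hfs j).1 (hfs j).2.1 (hfs j).2.2.1 (hfs j).2.2.2 (fun j => (hmap w j).trans (hwc j)) (natDegree_map_le.trans hwd)
      (fun j => (hmap h j).trans ((hh2 j).trans hED)) (natDegree_map_le.trans (hh1.trans hED)) ?_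
    intro y hy
    obtain ⟨⟨a, g⟩, hx, rfl⟩ := Finset.mem_image.1 hy
    obtain ⟨hx1, hx2⟩ := Finset.mem_filter.1 hx
    obtain ⟨hg, hσ⟩ := (Finset.mem_filter.1 hx1).2
    simp only [hpt] at hx2 ⊢ hg hσ
    have hne' := hne a hg g
    refine ⟨hx2, ?_, ?_, ?_⟩
    · intro h0
      apply hne'
      rw [← eval_map_map, ← hfw, ← derivative_map]
      obtain ⟨r, hr⟩ := hdvd' j
      rw [hr, derivative_mul, Polynomial.map_add, Polynomial.map_mul, Polynomial.map_mul, eval_add, eval_mul, eval_mul,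
        h0, hx2]
      ring
    · rw [eval_map_map]; exact hne'
    · rw [eval_map_map, eval_map_map, interp_psi (ψ a) (hψ a) θ (gA σ θ) h w hh3 hw g, ← hs a hg, ← gA_mul, ← gA_mul, ← hσ, mul_comm]
      congr 3
      group
  calc (P.card : ℝ) ≤ (((Finset.range e).biUnion Pj).card : ℝ) := by exact_mod_cast Finset.card_le_card hcov
    _ ≤ ∑ j ∈ Finset.range e, ((Pj j).card : ℝ) := by exact_mod_cast Finset.card_biUnion_le
    _ ≤ ∑ j ∈ Finset.range e, B := Finset.sum_le_sum fun j _ => hbound j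
    _ = e * B := by simp

end Cheb
end FCE

set_option linter.unusedSectionVars false
namespace FCE

theorem count_upper {A G : Type} [Fintype A] [Group G] [Fintype G] [DecidableEq G]
    (good : A → Prop) [DecidablePred good] (s : A → G) (G1 : Finset G) (T : Finset G)
    (hG1 : ∀ g σ, σ ∈ G1 → g⁻¹ * σ * g ∈ G1) (hT : ∀ g σ, σ ∈ T → g⁻¹ * σ * g ∈ T)
    (hs : ∀ a, good a → s a ∈ G1) (e : ℕ) (he : e * G1.card ≤ Fintype.card G) {Y : ℝ} (hY : 0 ≤ Y) (h1 : G1.Nonempty)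
    (hN : ∀ σ, ((Finset.univ.filter fun x : A × G => good x.1 ∧ x.2⁻¹ * s x.1 * x.2 = σ).card : ℝ) ≤ e * Y) :
    ((Finset.univ.filter fun a : A => good a ∧ s a ∈ T).card : ℝ) ≤ ((G1 ∩ T).card : ℝ) / G1.card * Y := by
  classical
  set M := Finset.univ.filter fun a : A => good a ∧ s a ∈ T with hM
  have hsub : M ×ˢ (Finset.univ : Finset G) ⊆ (G1 ∩ T).biUnion fun σ =>
      Finset.univ.filter fun x : A × G => good x.1 ∧ x.2⁻¹ * s x.1 * x.2 = σ := by
    rintro ⟨a, g⟩ hx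
    obtain ⟨hg, hst⟩ := (Finset.mem_filter.1 (Finset.mem_product.1 hx).1).2
    refine Finset.mem_biUnion.2 ⟨g⁻¹ * s a * g, ?_, ?_⟩
    · exact Finset.mem_inter.2 ⟨hG1 _ _ (hs a hg), hT _ _ hst⟩
    · simp only [Finset.mem_filter, Finset.mem_univ, true_and, and_true]; exact hg
  have h2 : (M.card : ℝ) * Fintype.card G ≤ (G1 ∩ T).card * (e * Y) := by
    calc (M.card : ℝ) * Fintype.card G = ((M ×ˢ (Finset.univ : Finset G)).card : ℝ) := by
          rw [Finset.card_product, Finset.card_univ]; push_cast; rfl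
      _ ≤ (((G1 ∩ T).biUnion fun σ =>
      Finset.univ.filter fun x : A × G => good x.1 ∧ x.2⁻¹ * s x.1 * x.2 = σ).card : ℝ) := by
          exact_mod_cast Finset.card_le_card hsub
      _ ≤ ∑ σ ∈ G1 ∩ T, ((Finset.univ.filter fun x : A × G => good x.1 ∧ x.2⁻¹ * s x.1 * x.2 = σ).card : ℝ) := by
          exact_mod_cast Finset.card_biUnion_le
      _ ≤ ∑ σ ∈ G1 ∩ T, e * Y := Finset.sum_le_sum fun σ _ => hN σ
      _ = _ := by simp
  have hG1pos : (0 : ℝ) < G1.card := by exact_mod_cast h1.card_pos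
  have hGpos : (0 : ℝ) < Fintype.card G := by exact_mod_cast Fintype.card_pos
  have he' : (e : ℝ) * G1.card ≤ Fintype.card G := by exact_mod_cast he
  rw [div_mul_eq_mul_div, le_div_iff₀ hG1pos]
  refine le_of_mul_le_mul_right ?_ hGpos
  calc (M.card : ℝ) * G1.card * Fintype.card G = (M.card * Fintype.card G) * G1.card := by ring
    _ ≤ (G1 ∩ T).card * (e * Y) * G1.card := by gcongr
    _ = (G1 ∩ T).card * Y * (e * G1.card) := by ring
    _ ≤ (G1 ∩ T).card * Y * Fintype.card G := by gcongr

theorem count_abs {A G : Type} [Fintype A] [Group G] [Fintype G] [DecidableEq G]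
    (good : A → Prop) [DecidablePred good] (s : A → G) (G1 : Finset G) (T : Finset G)
    (hG1 : ∀ g σ, σ ∈ G1 → g⁻¹ * σ * g ∈ G1) (hT : ∀ g σ, σ ∈ T → g⁻¹ * σ * g ∈ T)
    (hs : ∀ a, good a → s a ∈ G1) (e : ℕ) (he : e * G1.card ≤ Fintype.card G) {R R' : ℝ} (hR : 0 ≤ R) (hR' : 0 ≤ R')
    (hN : ∀ σ, ((Finset.univ.filter fun x : A × G => good x.1 ∧ x.2⁻¹ * s x.1 * x.2 = σ).card : ℝ) ≤ e * (Fintype.card A + R))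
    (hbad : ((Finset.univ.filter fun a : A => ¬ good a).card : ℝ) ≤ R') :
    |((Finset.univ.filter fun a : A => good a ∧ s a ∈ T).card : ℝ) - ((G1 ∩ T).card : ℝ) / G1.card * Fintype.card A| ≤ R + R' := by
  rcases G1.eq_empty_or_nonempty with h | h1
  · have : (Finset.univ.filter fun a : A => good a ∧ s a ∈ T) = ∅ := by
      apply Finset.filter_eq_empty_iff.2
      rintro a _ ⟨hg, _⟩
      have := hs a hg
      rw [h] at this; simp at this
    rw [this, h]; simp; positivity
  have hA : (0 : ℝ) ≤ Fintype.card A := by positivity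
  have hU := count_upper good s G1 T hG1 hT hs e he (add_nonneg hA hR) h1 hN
  have hU' := count_upper good s G1 Tᶜ hG1 (by
    intro g σ hσ
    rw [Finset.mem_compl] at hσ ⊢
    intro h; apply hσ
    have := hT g⁻¹ _ h
    have e : (g⁻¹)⁻¹ * (g⁻¹ * σ * g) * g⁻¹ = σ := by group
    rwa [e] at this) hs e he (add_nonneg hA hR) h1 hN
  have hG1pos : (0 : ℝ) < G1.card := by exact_mod_cast h1.card_pos
  have hsum : ((G1 ∩ T).card : ℝ) / G1.card + ((G1 ∩ Tᶜ).card : ℝ) / G1.card = 1 := by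
    rw [← add_div, div_eq_one_iff_eq hG1pos.ne']
    have := Finset.card_inter_add_card_sdiff G1 T
    rw [Finset.sdiff_eq_inter_compl] at this
    exact_mod_cast this
  have hc : ((Finset.univ.filter fun a : A => good a ∧ s a ∈ T).card : ℝ) +
      ((Finset.univ.filter fun a : A => good a ∧ s a ∈ Tᶜ).card : ℝ) +
      ((Finset.univ.filter fun a : A => ¬ good a).card : ℝ) = Fintype.card A := by
    have h2 := Finset.card_filter_add_card_filter_not (s := (Finset.univ : Finset A)) good
    have h3 := Finset.card_filter_add_card_filter_not (s := Finset.univ.filter good) (fun a => s a ∈ T)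
    rw [Finset.filter_filter, Finset.filter_filter] at h3
    simp only [Finset.mem_compl]
    rw [← Finset.card_univ, ← h2, ← h3]; push_cast; rfl
  set r := ((G1 ∩ T).card : ℝ) / G1.card with hr
  set r' := ((G1 ∩ Tᶜ).card : ℝ) / G1.card with hr'
  have hr0 : 0 ≤ r := by positivity
  have hr0' : 0 ≤ r' := by positivity
  have hr1 : r * R ≤ R := by nlinarith
  have hr1' : r' * R ≤ R := by nlinarith
  have hrA : r * (Fintype.card A : ℝ) + r' * Fintype.card A = Fintype.card A := by rw [← add_mul, hsum, one_mul]
  rw [abs_le]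
  constructor
  · linarith [mul_add r' (Fintype.card A : ℝ) R]
  · linarith [mul_add r (Fintype.card A : ℝ) R]

set_option maxHeartbeats 1600000 in
theorem cheb (n g0 E : ℕ) (hE : 1 ≤ E) : ∃ Cc : ℝ, 0 ≤ Cc ∧ ∀ (Fq K L Ka : Type) [Field Fq] [Fintype Fq] [Field K] [Algebra Fq K]
    [IsAlgClosed K] [Algebra.IsAlgebraic Fq K]
    [Field L] [Algebra Fq L] [Algebra (MvPolynomial (Fin (n + 1)) Fq) L]
    [IsScalarTower Fq (MvPolynomial (Fin (n + 1)) Fq) L]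
    [Field Ka] [Algebra (MvPolynomial (Fin (n + 1)) Fq) Ka] [IsFractionRing (MvPolynomial (Fin (n + 1)) Fq) Ka]
    [Algebra Ka L] [IsScalarTower (MvPolynomial (Fin (n + 1)) Fq) Ka L] [FiniteDimensional Ka L] [IsGalois Ka L]
    (G1 : Set (L ≃ₐ[Ka] L))
    (_ : G1 = {σ | ∀ y : L, (∃ k : ℕ, 0 < k ∧ y ^ Fintype.card Fq ^ k = y) → σ y = y ^ Fintype.card Fq})
    (θ : L), Nat.card (L ≃ₐ[Ka] L) ≤ g0 → θ ∈ Wt (Fin (n + 1)) Fq L E → (Function.Injective fun g : L ≃ₐ[Ka] L => g θ) →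
    ∃ (ψ : (Fin (n + 1) → Fq) → integralClosure (MvPolynomial (Fin (n + 1)) Fq) L →+* K)
      (s : (Fin (n + 1) → Fq) → (L ≃ₐ[Ka] L)) (b0 : MvPolynomial (Fin (n + 1)) Fq),
      b0 ≠ 0 ∧ b0.totalDegree ≤ E * g0 * g0 ∧ (∀ a b, ψ a (algebraMap _ _ b) = algebraMap Fq K (MvPolynomial.eval a b)) ∧
      (∀ a, MvPolynomial.eval a b0 ≠ 0 → ∀ z, ψ a (gA (s a) z) = ψ a z ^ Fintype.card Fq) ∧
      ∀ T : Set (L ≃ₐ[Ka] L), (∀ g σ, σ ∈ T → g⁻¹ * σ * g ∈ T) →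
        |(Nat.card {a : Fin (n + 1) → Fq // MvPolynomial.eval a b0 ≠ 0 ∧ s a ∈ T} : ℝ) -
          (Nat.card {σ : L ≃ₐ[Ka] L // σ ∈ G1 ∧ σ ∈ T} : ℝ) / (Nat.card {σ : L ≃ₐ[Ka] L // σ ∈ G1} : ℝ) *
            (Fintype.card Fq : ℝ) ^ (n + 1)| ≤ Cc * (Fintype.card Fq : ℝ) ^ n * √(Fintype.card Fq) := by
  obtain ⟨C0, hC0, hLW⟩ := LW.{0} n (E * g0 * g0)
  refine ⟨C0 + (E * g0 * g0 : ℕ), by positivity, ?_⟩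
  intro Fq K L Ka _ _ _ _ _ _ _ _ _ _ _ _ _ _ _ _ _ G1 hG1 θ hg0 hθE hθ
  classical
  have hinj := inj_BL (σ := Fin (n + 1)) (F := Fq) (L := L) Ka
  have hGpos : 1 ≤ Nat.card (L ≃ₐ[Ka] L) := Nat.card_pos
  have hg1 : 1 ≤ g0 := hGpos.trans hg0
  obtain ⟨p, hp⟩ := CharP.exists Fq
  obtain ⟨k, hp1, hp2⟩ := FiniteField.card Fq p
  have : Fact p.Prime := ⟨hp1⟩
  have : CharP K p := charP_of_injective_algebraMap (algebraMap Fq K).injective p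
  have : ExpChar K p := ExpChar.prime hp1
  have : IsAlgClosure Fq K := ⟨inferInstance, inferInstance⟩
  have : Normal Fq K := IsAlgClosure.normal Fq K
  set Θ : integralClosure (MvPolynomial (Fin (n + 1)) Fq) L := ⟨θ, isIntegral_of_mem_Wt hθE⟩ with hΘ
  have hEG : E * Nat.card (L ≃ₐ[Ka] L) ≤ E * g0 * g0 :=
    (Nat.mul_le_mul_left _ hg0).trans (Nat.le_mul_of_pos_right _ hg1)
  have hEGG : E * Nat.card (L ≃ₐ[Ka] L) * Nat.card (L ≃ₐ[Ka] L) ≤ E * g0 * g0 := by gcongr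
  obtain ⟨fB, hmon, hfBc, hfB⟩ := exists_fB Ka hE hθE
  obtain ⟨w, hwd, hwc, hw⟩ := exists_interp Ka hE hθE (isFil_Wt.mono (Nat.zero_le E) isFil_Wt.one_mem)
  have hδE : (interpL Ka θ 1).eval θ ∈ Wt (Fin (n + 1)) Fq L (E * Nat.card (L ≃ₐ[Ka] L)) := by
    have h1 := interpL_one_eval (Ka := Ka) θ 1
    rw [AlgEquiv.one_apply] at h1
    rw [h1]
    have h2 := (isFil_Wt (σ := Fin (n + 1)) (F := Fq) (L := L)).prod_mem (Finset.univ.erase (1 : L ≃ₐ[Ka] L)) (a := E)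
      (x := fun g' => θ - g' θ) fun g' _ => AddSubgroup.sub_mem _ hθE (Wt_gal g' hθE)
    refine isFil_Wt.mono ?_ h2
    gcongr
    rw [Nat.card_eq_fintype_card]; exact Finset.card_le_univ _
  have hδ0 : (interpL Ka θ 1).eval θ ≠ 0 := by
    have h1 := interpL_one_eval (Ka := Ka) θ 1
    rw [AlgEquiv.one_apply] at h1
    rw [h1, Finset.prod_ne_zero_iff]
    intro g hg h0
    exact (Finset.mem_erase.1 hg).1 (hθ (by simpa using (sub_eq_zero.1 h0).symm))
  obtain ⟨b0, hb0d, hb0, hb0e⟩ := Wt_norm Ka hδE hδ0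
  have hpsi : ∀ a : Fin (n + 1) → Fq, ∃ ψ : integralClosure (MvPolynomial (Fin (n + 1)) Fq) L →+* K,
      ∀ b, ψ (algebraMap _ _ b) = algebraMap Fq K (MvPolynomial.eval a b) := fun a => exists_psi K hinj a
  choose ψ hψ using hpsi
  have hne : ∀ a, MvPolynomial.eval a b0 ≠ 0 → ∀ g : L ≃ₐ[Ka] L, eval₂ (ev K a) (ψ a (gA g Θ)) w ≠ 0 := by
    intro a ha g h0
    apply ha
    apply (algebraMap Fq K).injective
    rw [map_zero, ← hψ]
    have h1 : algebraMap (MvPolynomial (Fin (n + 1)) Fq) (integralClosure (MvPolynomial (Fin (n + 1)) Fq) L) b0 =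
        ∏ g : L ≃ₐ[Ka] L, aeval (gA g Θ) w := by
      apply Subtype.ext
      have h2 : ((algebraMap (MvPolynomial (Fin (n + 1)) Fq) (integralClosure (MvPolynomial (Fin (n + 1)) Fq) L) b0 :
        integralClosure (MvPolynomial (Fin (n + 1)) Fq) L) : L) = algebraMap _ L b0 := rfl
      rw [h2, hb0e, SubmonoidClass.coe_finsetProd]
      refine Finset.prod_congr rfl fun g _ => ?_
      rw [coe_aeval, hw, coe_gA]
      have h3 := congrArg (fun P : L[X] => P.eval (g θ)) (interpL_map (Ka := Ka) θ 1 g)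
      rw [← h3, eval_map]
      exact (eval₂_hom (g : L →+* L) θ).symm
    rw [h1, map_prod]
    apply Finset.prod_eq_zero (Finset.mem_univ g)
    rw [psi_eval (ψ a) (hψ a), h0]
  have hs : ∀ a, ∃ s : L ≃ₐ[Ka] L, MvPolynomial.eval a b0 ≠ 0 → ∀ z, ψ a (gA s z) = ψ a z ^ Fintype.card Fq := by
    intro a
    by_cases ha : MvPolynomial.eval a b0 ≠ 0
    · obtain ⟨s, hs⟩ := frob_exists (ψ a) (hψ a) Θ fB w hfB hw (hne a ha)
      exact ⟨s, fun _ => hs⟩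
    · exact ⟨1, fun h => absurd h ha⟩
  choose s hs using hs
  refine ⟨ψ, s, b0, hb0, hb0d.trans hEGG, hψ, hs, fun T hT => ?_⟩
  obtain ⟨e, fs, hfs, he, hdvd, hdvd'⟩ := geom_factor K θ fB hmon hfB hθ (E := E * Nat.card (L ≃ₐ[Ka] L))
    (Nat.mul_pos hE hGpos) hfBc G1 (by intro g hg; rw [hG1] at hg; exact hg)
  have hN := Nsig_le (D := E * g0 * g0) (q := Fintype.card Fq)
    (B := (Fintype.card Fq : ℝ) ^ (n + 1) + C0 * (Fintype.card Fq : ℝ) ^ n * √(Fintype.card Fq))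
    (fun f w g S h1 h2 h3 h4 h5 h6 h7 h8 h9 => hLW Fq K p k
      (fun x => IsAlgClosed.exists_pow_nat_eq x (pow_pos hp1.pos _)) hp2 f w g S h1 h2 h3 h4 h5 h6 h7 h8
        (by rw [← hp2]; exact h9)) ψ hψ Θ hE hθE fB w hfB hw (hwd.trans hEG) (fun j => (hwc j).trans hEG) hEG
    (fun a => MvPolynomial.eval a b0 ≠ 0) s hne hs e fs
    (fun j => ⟨(hfs j).1, (hfs j).2.1, (hfs j).2.2.1.trans (hg0.trans (by
      calc g0 = 1 * 1 * g0 := by ring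
        _ ≤ E * g0 * g0 := by gcongr)), fun k => ((hfs j).2.2.2 k).trans hEGG⟩) hdvd hdvd'
  have hq1 : (1 : ℝ) ≤ √(Fintype.card Fq) := by
    rw [Real.one_le_sqrt]; exact_mod_cast Fintype.card_pos
  have hcount := count_abs (fun a => MvPolynomial.eval a b0 ≠ 0) s (Finset.univ.filter fun σ => σ ∈ G1)
    (Finset.univ.filter fun σ => σ ∈ T) (R := C0 * (Fintype.card Fq : ℝ) ^ n * √(Fintype.card Fq))
    (R' := (E * g0 * g0 : ℕ) * (Fintype.card Fq : ℝ) ^ n * √(Fintype.card Fq))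
    (by
      intro g σ hσ
      simp only [Finset.mem_filter, Finset.mem_univ, true_and] at hσ ⊢
      rw [hG1] at hσ ⊢
      rintro y ⟨k, hk, hy⟩
      have h1 := hσ (g y) ⟨k, hk, by rw [← map_pow, hy]⟩
      have h2 : (g⁻¹ * σ * g) y = g⁻¹ (σ (g y)) := rfl
      rw [h2, h1, ← map_pow]
      exact g.symm_apply_apply _)
    (by
      intro g σ hσ
      simp only [Finset.mem_filter, Finset.mem_univ, true_and] at hσ ⊢
      exact hT g σ hσ)
    (by
      intro a ha
      simp only [Finset.mem_filter, Finset.mem_univ, true_and]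
      rw [hG1]
      exact frob_mem_G1 (ψ a) (s a) (hs a ha)) e
    (by
      rw [Nat.card_eq_fintype_card, Nat.card_eq_fintype_card, Fintype.card_subtype] at he
      exact he)
    (by positivity) (by positivity)
    (by
      intro σ
      have := hN σ
      rw [Fintype.card_fun, Fintype.card_fin]
      push_cast
      exact this)
    (by
      have h1 := card_zeros b0 hb0
      simp only [not_not]
      calc ((Finset.univ.filter fun a : Fin (n + 1) → Fq => MvPolynomial.eval a b0 = 0).card : ℝ)
          ≤ (b0.totalDegree * Fintype.card Fq ^ n : ℕ) := by exact_mod_cast h1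
        _ ≤ ((E * g0 * g0) * Fintype.card Fq ^ n : ℕ) := by
          have := hb0d.trans hEGG
          gcongr
        _ = (E * g0 * g0 : ℕ) * (Fintype.card Fq : ℝ) ^ n * 1 := by push_cast; ring
        _ ≤ _ := by gcongr)
  rw [Fintype.card_fun, Fintype.card_fin] at hcount
  rw [Nat.card_eq_fintype_card, Nat.card_eq_fintype_card, Nat.card_eq_fintype_card, Fintype.card_subtype, Fintype.card_subtype,
    Fintype.card_subtype, Finset.filter_and]
  calc _ = _ := ?_
    _ ≤ _ := hcount
    _ = _ := by ring
  simp only [Finset.mem_filter, Finset.mem_univ, true_and, Finset.filter_and]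
  push_cast
  rfl

end FCE

set_option linter.unusedSectionVars false
namespace FCE

section Subst
variable {Fq : Type} [Field Fq]

/-- the substitution as a ring homomorphism -/
noncomputable def substHom (Fq : Type) [Field Fq] (n : ℕ) :
    Polynomial (Polynomial Fq) →+* Polynomial (MvPolynomial (Fin (n + 1)) Fq) :=
  (evalRingHom (fsharp Fq n)).comp (mapRingHom (mapRingHom MvPolynomial.C))

theorem substHom_apply (n : ℕ) (F : Polynomial (Polynomial Fq)) : substHom Fq n F = substF n F := rfl

theorem substF_injective (n : ℕ) : Function.Injective (substF (K := Fq) n) := by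
  let φ : MvPolynomial (Fin (n + 1)) Fq →+* Polynomial (Polynomial Fq) :=
    MvPolynomial.eval₂Hom (C.comp C) (fun j => if j = 0 then X else 0)
  let Ψ : Polynomial (MvPolynomial (Fin (n + 1)) Fq) →+* Polynomial (Polynomial Fq) := eval₂RingHom φ (C X)
  have hΨ : Ψ.comp (substHom Fq n) = RingHom.id _ := by
    apply Polynomial.ringHom_ext'
    · apply Polynomial.ringHom_ext'
      · ext1 c
        simp [Ψ, φ, substHom]
      · simp [Ψ, φ, substHom]
    · simp only [Ψ, φ, substHom, fsharp]
      simp only [RingHom.comp_apply, coe_mapRingHom, map_X, coe_evalRingHom, eval_X, coe_eval₂RingHom, eval₂_finsetSum, eval₂_mul, eval₂_C, eval₂_pow, eval₂_X,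
        MvPolynomial.coe_eval₂Hom, MvPolynomial.eval₂_X]
      rw [Finset.sum_eq_single 0]
      · simp
      · intro b _ hb; simp [hb]
      · simp
  intro x y h
  have := congrArg Ψ h
  rw [← substHom_apply, ← substHom_apply, ← RingHom.comp_apply, ← RingHom.comp_apply, hΨ] at this
  exact this

theorem substF_ne_zero (n : ℕ) {F : Polynomial (Polynomial Fq)} (hF : F ≠ 0) : substF n F ≠ 0 := by
  intro h
  apply hF
  apply substF_injective n
  rw [h, ← substHom_apply, map_zero]

theorem substF_prod {ι : Type} (s : Finset ι) (n : ℕ) (F : ι → Polynomial (Polynomial Fq)) :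
    substF n (∏ i ∈ s, F i) = ∏ i ∈ s, substF n (F i) := by
  simp only [← substHom_apply, map_prod]

theorem substF_mem (n : ℕ) (F : Polynomial (Polynomial Fq)) :
    substF n F ∈ FilP (isFil_FilM (Fin (n + 1)) Fq) (totalDeg F * (n + 1)) := by
  have hW := isFil_FilP (isFil_FilM (Fin (n + 1)) Fq)
  have hX : (X : Polynomial (MvPolynomial (Fin (n + 1)) Fq)) ∈ FilP (isFil_FilM (Fin (n + 1)) Fq) 1 := by
    refine ⟨natDegree_X_le, fun k => ?_⟩
    rw [mem_FilM, coeff_X]; split_ifs <;> simp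
  have hsharp : fsharp Fq n ∈ FilP (isFil_FilM (Fin (n + 1)) Fq) (n + 1) := by
    unfold fsharp
    refine ⟨natDegree_sum_le_of_forall_le _ _ fun j _ => (natDegree_C_mul_X_pow_le _ _).trans (by omega), fun k => ?_⟩
    rw [mem_FilM, finsetSum_coeff]
    refine MvPolynomial.totalDegree_finsetSum_le fun j _ => ?_
    rw [coeff_C_mul_X_pow]
    split_ifs
    · rw [MvPolynomial.totalDegree_X]; omega
    · simp
  have hC : ∀ p : Polynomial Fq, p.map MvPolynomial.C ∈ FilP (isFil_FilM (Fin (n + 1)) Fq) p.natDegree := by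
    intro p
    refine ⟨natDegree_map_le, fun k => ?_⟩
    rw [mem_FilM, coeff_map, MvPolynomial.totalDegree_C]; omega
  unfold substF
  rw [eval_map, eval₂_eq_sum_range]
  refine AddSubgroup.sum_mem _ fun j hj => ?_
  refine hW.mono ?_ (hW.mul_mem (hC (F.coeff j)) (hW.pow_mem hsharp j))
  have : j + (F.coeff j).natDegree ≤ totalDeg F := Finset.le_sup (f := fun j => j + (F.coeff j).natDegree) hj
  calc (F.coeff j).natDegree + (n + 1) * j ≤ (F.coeff j).natDegree * (n + 1) + (n + 1) * j := by
        gcongr; exact Nat.le_mul_of_pos_right _ (by omega)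
    _ = (j + (F.coeff j).natDegree) * (n + 1) := by ring
    _ ≤ _ := by gcongr

theorem substF_natDegree (n : ℕ) (F : Polynomial (Polynomial Fq)) : (substF n F).natDegree ≤ totalDeg F * (n + 1) :=
  (substF_mem n F).1

theorem substF_coeff (n : ℕ) (F : Polynomial (Polynomial Fq)) (k : ℕ) :
    ((substF n F).coeff k).totalDegree ≤ totalDeg F * (n + 1) := mem_FilM.1 ((substF_mem n F).2 k)

/-- the polynomial with coefficient vector `a` -/
noncomputable def fa {n : ℕ} (a : Fin (n + 1) → Fq) : Polynomial Fq := ∑ j : Fin (n + 1), C (a j) * X ^ (j : ℕ)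

theorem fa_coeff {n : ℕ} (a : Fin (n + 1) → Fq) (j : Fin (n + 1)) : (fa a).coeff j = a j := by
  unfold fa
  rw [finsetSum_coeff, Finset.sum_eq_single j]
  · simp
  · intro b _ hb
    rw [coeff_C_mul_X_pow, if_neg]
    intro h; exact hb (Fin.ext h.symm)
  · simp

theorem fa_natDegree {n : ℕ} (a : Fin (n + 1) → Fq) : (fa a).natDegree ≤ n :=
  natDegree_sum_le_of_forall_le _ _ fun j _ => (natDegree_C_mul_X_pow_le _ _).trans (by omega)

theorem fa_degree {n : ℕ} (a : Fin (n + 1) → Fq) : (fa a).degree = n ↔ a (Fin.last n) ≠ 0 := by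
  have h := fa_coeff a (Fin.last n)
  rw [Fin.val_last] at h
  rw [← h]
  constructor
  · intro hd
    exact coeff_ne_zero_of_eq_degree hd
  · intro hd
    exact degree_eq_of_le_of_coeff_ne_zero (natDegree_le_iff_degree_le.1 (fa_natDegree a)) hd

theorem fa_of_coeff {n : ℕ} (f : Polynomial Fq) (hf : f.natDegree ≤ n) : fa (fun j : Fin (n + 1) => f.coeff j) = f := by
  unfold fa
  rw [Fin.sum_univ_eq_sum_range (fun j => C (f.coeff j) * X ^ j) (n + 1)]
  exact (as_sum_range_C_mul_X_pow' f (by omega)).symm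

/-- the bijection between polynomials of degree `n` and coefficient vectors -/
noncomputable def faEquiv (n : ℕ) (Q : Polynomial Fq → Prop) :
    {f : Polynomial Fq // f.degree = (n : ℕ) ∧ Q f} ≃ {a : Fin (n + 1) → Fq // a (Fin.last n) ≠ 0 ∧ Q (fa a)} where
  toFun f := ⟨fun j => f.1.coeff j, by
    have h := fa_of_coeff f.1 (natDegree_le_of_degree_le f.2.1.le)
    refine ⟨?_, ?_⟩
    · refine (fa_degree (fun j : Fin (n + 1) => f.1.coeff j)).1 ?_
      rw [h]; exact f.2.1
    · rw [h]; exact f.2.2⟩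
  invFun a := ⟨fa a.1, (fa_degree a.1).2 a.2.1, a.2.2⟩
  left_inv f := Subtype.ext (fa_of_coeff f.1 (natDegree_le_of_degree_le f.2.1.le))
  right_inv a := Subtype.ext (funext fun j => fa_coeff a.1 j)

theorem eval_fa {n : ℕ} (a : Fin (n + 1) → Fq) (F : Polynomial (Polynomial Fq)) :
    eval (fa a) F = (substF n F).map (MvPolynomial.eval a) := by
  let φ : Polynomial (Polynomial Fq) →+* Polynomial Fq := evalRingHom (fa a)
  let φ' : Polynomial (Polynomial Fq) →+* Polynomial Fq := (mapRingHom (MvPolynomial.eval a)).comp (substHom Fq n)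
  have : φ = φ' := by
    apply Polynomial.ringHom_ext'
    · apply Polynomial.ringHom_ext'
      · ext1 c
        simp [φ, φ', substHom]
      · simp [φ, φ', substHom]
    · simp [φ, φ', substHom, fa, fsharp, Polynomial.map_sum]
  exact RingHom.congr_fun this F

end Subst
end FCE

set_option linter.unusedSectionVars false
namespace FCE

section Point
variable {n m : ℕ} {Fq K L Ka : Type} [Field Fq] [Fintype Fq] [Field K] [Algebra Fq K]
  [Field L] [Algebra Fq L] [Algebra (MvPolynomial (Fin (n + 1)) Fq) L]
  [IsScalarTower Fq (MvPolynomial (Fin (n + 1)) Fq) L]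
  [Field Ka] [Algebra (MvPolynomial (Fin (n + 1)) Fq) Ka] [IsFractionRing (MvPolynomial (Fin (n + 1)) Fq) Ka]
  [Algebra Ka L] [IsScalarTower (MvPolynomial (Fin (n + 1)) Fq) Ka L] [FiniteDimensional Ka L] [IsGalois Ka L]

theorem perm_exists {F : Fin m → Polynomial (Polynomial Fq)} {N : Fin m → ℕ} (y : ∀ i, Fin (N i) → L)
    (hy0 : ∀ i b, aeval (y i b) (substF n (F i)) = 0) (hyinj : ∀ i, Function.Injective (y i))
    (hysurj : ∀ i z, aeval z (substF n (F i)) = 0 → ∃ b, y i b = z) (g : L ≃ₐ[Ka] L) :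
    ∃ τ : (∀ i, Equiv.Perm (Fin (N i))), ∀ i b, g (y i b) = y i (τ i b) := by
  have h1 : ∀ i b, ∃ b', y i b' = g (y i b) := by
    intro i b
    apply hysurj
    have := aeval_algHom_apply ((g : L →ₐ[Ka] L).restrictScalars (MvPolynomial (Fin (n + 1)) Fq)) (y i b) (substF n (F i))
    rw [hy0, map_zero] at this
    exact this
  choose τ hτ using h1
  have hb : ∀ i, Function.Bijective (τ i) := by
    intro i
    apply Finite.injective_iff_bijective.1
    intro b b' h
    apply hyinj i
    apply g.injective
    rw [← hτ, ← hτ, h]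
  exact ⟨fun i => Equiv.ofBijective _ (hb i), fun i b => (hτ i b).symm⟩

theorem T_conj {F : Fin m → Polynomial (Polynomial Fq)} {N : Fin m → ℕ} (y : ∀ i, Fin (N i) → L)
    (hy0 : ∀ i b, aeval (y i b) (substF n (F i)) = 0) (hyinj : ∀ i, Function.Injective (y i))
    (hysurj : ∀ i z, aeval z (substF n (F i)) = 0 → ∃ b, y i b = z)
    (π₀ : ∀ i, Equiv.Perm (Fin (N i))) (g σ : L ≃ₐ[Ka] L)
    (hσ : ∃ π : (∀ i, Equiv.Perm (Fin (N i))), IsConj π₀ π ∧ ∀ i b, σ (y i b) = y i (π i b)) :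
    ∃ π : (∀ i, Equiv.Perm (Fin (N i))), IsConj π₀ π ∧ ∀ i b, (g⁻¹ * σ * g) (y i b) = y i (π i b) := by
  obtain ⟨π, hπ, h⟩ := hσ
  obtain ⟨τ, hτ⟩ := perm_exists y hy0 hyinj hysurj g
  refine ⟨τ⁻¹ * π * τ, hπ.trans (isConj_iff.2 ⟨τ⁻¹, by simp⟩), fun i b => ?_⟩
  have h1 : (g⁻¹ * σ * g) (y i b) = g.symm (σ (g (y i b))) := rfl
  rw [h1, AlgEquiv.symm_apply_eq, hτ, h, hτ]
  simp

theorem point_equiv {F : Fin m → Polynomial (Polynomial Fq)} {N : Fin m → ℕ} (hF : ∀ i, F i ≠ 0) (hN : ∀ i, N i = (substF n (F i)).natDegree)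
    (y : ∀ i, Fin (N i) → L)
    (hy0 : ∀ i b, aeval (y i b) (substF n (F i)) = 0) (hyinj : ∀ i, Function.Injective (y i))
    (hysurj : ∀ i z, aeval z (substF n (F i)) = 0 → ∃ b, y i b = z)
    (π₀ : ∀ i, Equiv.Perm (Fin (N i))) (a : Fin (n + 1) → Fq)
    (ψ : integralClosure (MvPolynomial (Fin (n + 1)) Fq) L →+* K)
    (hψ : ∀ b, ψ (algebraMap _ _ b) = algebraMap Fq K (MvPolynomial.eval a b))
    (s : L ≃ₐ[Ka] L) (hs : ∀ z, ψ (gA s z) = ψ z ^ Fintype.card Fq)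
    (u : ∀ i, Fin (N i) → integralClosure (MvPolynomial (Fin (n + 1)) Fq) L)
    (hu : ∀ i b, (u i b : L) = algebraMap _ L (substF n (F i)).leadingCoeff * y i b)
    (hc : ∀ i, MvPolynomial.eval a (substF n (F i)).leadingCoeff ≠ 0)
    (hdist : ∀ i, Function.Injective fun b => ψ (u i b)) :
    ((∀ i, eval (fa a) (F i) ≠ 0) ∧ ∃ π : (∀ i, Equiv.Perm (Fin (N i))), IsConj π₀ π ∧
        ∀ i, ∃ e : Fin (N i) → K, Function.Injective e ∧ (∀ b, aeval (e b) (eval (fa a) (F i)) = 0) ∧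
          (∀ b, e (π i b) = (e b) ^ Fintype.card Fq)) ↔
      ∃ π : (∀ i, Equiv.Perm (Fin (N i))), IsConj π₀ π ∧ ∀ i b, s (y i b) = y i (π i b) := by
  classical
  have hinj := inj_BL (σ := Fin (n + 1)) (F := Fq) (L := L) Ka
  have hcK : ∀ i, ev K a (substF n (F i)).leadingCoeff ≠ 0 := fun i h =>
    hc i ((algebraMap Fq K).injective (by rw [map_zero]; exact h))
  set e0 : ∀ i, Fin (N i) → K := fun i b => ψ (u i b) / ev K a (substF n (F i)).leadingCoeff with he0
  have hev : ∀ i (x : K), aeval x (eval (fa a) (F i)) = eval₂ (ev K a) x (substF n (F i)) := by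
    intro i x
    rw [eval_fa, aeval_def, eval₂_map]; rfl
  have he0inj : ∀ i, Function.Injective (e0 i) := by
    intro i b b' h
    exact hdist i ((div_left_inj' (hcK i)).1 h)
  have he0root : ∀ i b, aeval (e0 i b) (eval (fa a) (F i)) = 0 := by
    intro i b
    rw [hev]
    have h1 : aeval (u i b) ((substF n (F i)).scaleRoots (substF n (F i)).leadingCoeff) = 0 := by
      apply Subtype.ext
      rw [coe_aeval, hu, eval_map, scaleRoots_eval₂_mul, ← aeval_def, hy0, mul_zero]; rfl
    have h2 := congrArg ψ h1
    rw [psi_eval ψ hψ, map_zero] at h2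
    have h3 : ψ (u i b) = ev K a (substF n (F i)).leadingCoeff * e0 i b := by
      rw [he0]; field_simp [hcK i]
    rw [h3, scaleRoots_eval₂_mul, mul_eq_zero] at h2
    exact h2.resolve_left (pow_ne_zero _ (hcK i))
  have hne : ∀ i, eval (fa a) (F i) ≠ 0 := by
    intro i h0
    apply hc i
    rw [eval_fa] at h0
    have := congrArg (fun P : Polynomial Fq => P.coeff (substF n (F i)).natDegree) h0
    simpa using this
  have he0all : ∀ i x, aeval x (eval (fa a) (F i)) = 0 → ∃ b, e0 i b = x := by
    intro i x hx
    have hsub : Finset.univ.image (e0 i) ⊆ ((eval (fa a) (F i)).map (algebraMap Fq K)).roots.toFinset := by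
      intro z hz
      obtain ⟨b, -, rfl⟩ := Finset.mem_image.1 hz
      rw [Multiset.mem_toFinset, mem_roots (Polynomial.map_ne_zero (hne i)), IsRoot.def, eval_map_algebraMap]
      exact he0root i b
    have hcard : (Finset.univ.image (e0 i)).card = N i := by
      rw [Finset.card_image_of_injective _ (he0inj i), Finset.card_univ, Fintype.card_fin]
    have heq := Finset.eq_of_subset_of_card_le hsub (by
      rw [hcard, hN]
      refine (Multiset.toFinset_card_le _).trans ((card_roots' _).trans ?_)
      rw [natDegree_map, eval_fa]
      exact natDegree_map_le)
    have : x ∈ Finset.univ.image (e0 i) := by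
      rw [heq, Multiset.mem_toFinset, mem_roots (Polynomial.map_ne_zero (hne i)), IsRoot.def, eval_map_algebraMap]
      exact hx
    obtain ⟨b, -, hb⟩ := Finset.mem_image.1 this
    exact ⟨b, hb⟩
  have hfrob : ∀ (τ : ∀ i, Equiv.Perm (Fin (N i))), (∀ i b, s (y i b) = y i (τ i b)) →
      ∀ i b, e0 i (τ i b) = e0 i b ^ Fintype.card Fq := by
    intro τ hτ i b
    have h1 : gA s (u i b) = u i (τ i b) := by
      apply Subtype.ext
      rw [coe_gA, hu, hu, map_mul, hτ]
      congr 1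
      rw [IsScalarTower.algebraMap_apply (MvPolynomial (Fin (n + 1)) Fq) Ka L, AlgEquiv.commutes]
    have h2 : ev K a (substF n (F i)).leadingCoeff ^ Fintype.card Fq = ev K a (substF n (F i)).leadingCoeff := by
      unfold ev
      rw [RingHom.comp_apply, ← map_pow, FiniteField.pow_card]
    simp only [he0]
    rw [div_pow, h2, ← hs, h1]
  constructor
  · rintro ⟨-, π, hπ, he⟩
    choose e heinj heroot hefrob using he
    obtain ⟨τ, hτ⟩ := perm_exists y hy0 hyinj hysurj s
    have hρ : ∀ i b, ∃ b', e0 i b' = e i b := fun i b => he0all i _ (heroot i b)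
    choose ρ hρ using hρ
    have hρb : ∀ i, Function.Bijective (ρ i) := by
      intro i
      apply Finite.injective_iff_bijective.1
      intro b b' h
      apply heinj i
      rw [← hρ, ← hρ, h]
    set ρ' : ∀ i, Equiv.Perm (Fin (N i)) := fun i => Equiv.ofBijective _ (hρb i) with hρ'
    refine ⟨τ, hπ.trans (isConj_iff.2 ⟨ρ', ?_⟩), hτ⟩
    rw [mul_inv_eq_iff_eq_mul]
    funext i
    ext1 b
    apply he0inj i
    have h1 : e0 i ((ρ' * π) i b) = e i (π i b) := hρ i (π i b)
    have h2 : e0 i ((τ * ρ') i b) = e0 i (τ i (ρ i b)) := rfl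
    rw [h1, h2, hfrob τ hτ, hefrob, hρ]
  · rintro ⟨π, hπ, h⟩
    exact ⟨hne, π, hπ, fun i => ⟨e0 i, he0inj i, he0root i, hfrob π h i⟩⟩

end Point
end FCE

set_option linter.unusedSectionVars false
namespace FCE

theorem card_compare {A : Type} [Fintype A] (P Q Z : A → Prop) [DecidablePred Z]
    (h : ∀ a, ¬ Z a → (P a ↔ Q a)) :
    |(Nat.card {a // P a} : ℝ) - (Nat.card {a // Q a} : ℝ)| ≤ ((Finset.univ.filter Z).card : ℝ) := by
  classical
  have key : ∀ P Q : A → Prop, (∀ a, ¬ Z a → (P a ↔ Q a)) →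
      (Nat.card {a // P a} : ℝ) ≤ (Nat.card {a // Q a} : ℝ) + ((Finset.univ.filter Z).card : ℝ) := by
    intro P Q h
    rw [Nat.card_eq_fintype_card, Nat.card_eq_fintype_card, Fintype.card_subtype, Fintype.card_subtype]
    have : (Finset.univ.filter P) ⊆ (Finset.univ.filter Q) ∪ (Finset.univ.filter Z) := by
      intro a ha
      simp only [Finset.mem_union, Finset.mem_filter, Finset.mem_univ, true_and] at ha ⊢
      by_cases hz : Z a
      · exact Or.inr hz
      · exact Or.inl ((h a hz).1 ha)
    exact_mod_cast (Finset.card_le_card this).trans (Finset.card_union_le _ _)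
  rw [abs_le]
  constructor
  · linarith [key Q P fun a ha => (h a ha).symm]
  · linarith [key P Q h]

section Disc
variable {n : ℕ} {Fq K L Ka : Type} [Field Fq] [Fintype Fq] [Field K] [Algebra Fq K]
  [Field L] [Algebra Fq L] [Algebra (MvPolynomial (Fin (n + 1)) Fq) L]
  [IsScalarTower Fq (MvPolynomial (Fin (n + 1)) Fq) L]
  [Field Ka] [Algebra (MvPolynomial (Fin (n + 1)) Fq) Ka] [IsFractionRing (MvPolynomial (Fin (n + 1)) Fq) Ka]
  [Algebra Ka L] [IsScalarTower (MvPolynomial (Fin (n + 1)) Fq) Ka L] [FiniteDimensional Ka L] [IsGalois Ka L]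

variable (Ka) in
theorem disc_poly {D M g0 : ℕ} (hg0 : Nat.card (L ≃ₐ[Ka] L) ≤ g0) {ι : Type} (S : Finset ι) (hM : S.card ≤ M)
    (x : ι → integralClosure (MvPolynomial (Fin (n + 1)) Fq) L)
    (hx : ∀ j ∈ S, (x j : L) ∈ Wt (Fin (n + 1)) Fq L D) (h0 : ∀ j ∈ S, x j ≠ 0) :
    ∃ b : MvPolynomial (Fin (n + 1)) Fq, b ≠ 0 ∧ b.totalDegree ≤ D * M * g0 ∧
      ∀ (a : Fin (n + 1) → Fq) (ψ : integralClosure (MvPolynomial (Fin (n + 1)) Fq) L →+* K),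
        (∀ b, ψ (algebraMap _ _ b) = algebraMap Fq K (MvPolynomial.eval a b)) →
        MvPolynomial.eval a b ≠ 0 → ∀ j ∈ S, ψ (x j) ≠ 0 := by
  classical
  have h1 := isFil_Wt.prod_mem S (x := fun j => (x j : L)) hx
  have h2 : ∏ j ∈ S, (x j : L) ≠ 0 := Finset.prod_ne_zero_iff.2 fun j hj h => h0 j hj (Subtype.ext h)
  obtain ⟨b, hb, hb0, hbe⟩ := Wt_norm Ka h1 h2
  refine ⟨b, hb0, hb.trans (by gcongr), ?_⟩
  intro a ψ hψ hab j hj hz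
  have h3 : algebraMap (MvPolynomial (Fin (n + 1)) Fq) (integralClosure (MvPolynomial (Fin (n + 1)) Fq) L) b =
      ∏ g : L ≃ₐ[Ka] L, gA g (∏ j ∈ S, x j) := by
    apply Subtype.ext
    rw [SubmonoidClass.coe_finsetProd]
    simp only [coe_gA, SubmonoidClass.coe_finsetProd]
    exact hbe
  have h4 := hψ b
  rw [h3, map_prod] at h4
  have h5 : ψ (gA (1 : L ≃ₐ[Ka] L) (∏ j ∈ S, x j)) = 0 := by
    have : gA (1 : L ≃ₐ[Ka] L) (∏ j ∈ S, x j) = ∏ j ∈ S, x j := Subtype.ext rfl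
    rw [this, map_prod]
    exact Finset.prod_eq_zero hj hz
  rw [Finset.prod_eq_zero (i := (1 : L ≃ₐ[Ka] L)) (f := fun g : L ≃ₐ[Ka] L => ψ (gA g (∏ j ∈ S, x j)))
    (Finset.mem_univ _) h5] at h4
  exact hab ((algebraMap Fq K).injective (by rw [map_zero]; exact h4.symm))

theorem card_gal_le {m : ℕ} {F : Fin m → Polynomial (Polynomial Fq)} {N : Fin m → ℕ} (y : ∀ i, Fin (N i) → L)
    (hy0 : ∀ i b, aeval (y i b) (substF n (F i)) = 0) (hyinj : ∀ i, Function.Injective (y i))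
    (hysurj : ∀ i z, aeval z (substF n (F i)) = 0 → ∃ b, y i b = z)
    (hgen : ∀ g : L ≃ₐ[Ka] L, (∀ i b, g (y i b) = y i b) → g = 1) {K0 : ℕ} (hK : Fintype.card (Σ i, Fin (N i)) ≤ K0) :
    Nat.card (L ≃ₐ[Ka] L) ≤ (K0 + 1) ^ (K0 + 1) := by
  classical
  have h := fun g : L ≃ₐ[Ka] L => perm_exists y hy0 hyinj hysurj g
  choose τ hτ using h
  let Φ : (L ≃ₐ[Ka] L) → ((Σ i, Fin (N i)) → (Σ i, Fin (N i))) := fun g k => ⟨k.1, τ g k.1 k.2⟩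
  have hΦ : Function.Injective Φ := by
    intro g g' hgg
    have : g'⁻¹ * g = 1 := hgen _ fun i b => by
      have h1 : (⟨i, τ g i b⟩ : Σ i, Fin (N i)) = ⟨i, τ g' i b⟩ := congrFun hgg ⟨i, b⟩
      have h2 : τ g i b = τ g' i b := eq_of_heq (Sigma.mk.inj h1).2
      have h3 : (g'⁻¹ * g) (y i b) = g'.symm (g (y i b)) := rfl
      rw [h3, AlgEquiv.symm_apply_eq, hτ, hτ, h2]
    rw [inv_mul_eq_one] at this
    exact this.symm
  have h1 := Nat.card_le_card_of_injective Φ hΦ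
  rw [Nat.card_eq_fintype_card (α := _ → _), Fintype.card_fun] at h1
  refine h1.trans ?_
  calc _ ≤ (K0 + 1) ^ (Fintype.card (Σ i, Fin (N i))) := Nat.pow_le_pow_left (by omega) _
    _ ≤ _ := Nat.pow_le_pow_right (by omega) (by omega)

end Disc
end FCE

set_option linter.unusedSectionVars false
namespace FCE

set_option maxHeartbeats 1600000 in
theorem main_gen (m : ℕ) (d : Fin m → ℕ) (n : ℕ) : ∃ C0 : ℝ, ∀ (Fq K L Ka : Type) [Field Fq] [Fintype Fq] [Field K] [Algebra Fq K]
    [IsAlgClosed K] [Algebra.IsAlgebraic Fq K]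
    [Field L] [Algebra Fq L] [Algebra (MvPolynomial (Fin (n + 1)) Fq) L]
    [IsScalarTower Fq (MvPolynomial (Fin (n + 1)) Fq) L]
    [Field Ka] [Algebra (MvPolynomial (Fin (n + 1)) Fq) Ka] [IsFractionRing (MvPolynomial (Fin (n + 1)) Fq) Ka]
    [Algebra Ka L] [IsScalarTower (MvPolynomial (Fin (n + 1)) Fq) Ka L] [FiniteDimensional Ka L] [IsGalois Ka L]
    (F : Fin m → Polynomial (Polynomial Fq)) (_ : ∀ i, totalDeg (F i) = d i) (_ : ∀ i, F i ≠ 0)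
    (G1 : Set (L ≃ₐ[Ka] L))
    (_ : G1 = {σ | ∀ y : L, (∃ k : ℕ, 0 < k ∧ y ^ Fintype.card Fq ^ k = y) → σ y = y ^ Fintype.card Fq})
    (N : Fin m → ℕ) (_ : ∀ i, N i = (substF n (F i)).natDegree)
    (y : ∀ i, Fin (N i) → L)
    (_ : ∀ i b, aeval (y i b) (substF n (F i)) = 0) (_ : ∀ i, Function.Injective (y i))
    (_ : ∀ i z, aeval z (substF n (F i)) = 0 → ∃ b, y i b = z)
    (_ : ∀ g : L ≃ₐ[Ka] L, (∀ i b, g (y i b) = y i b) → g = 1)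
    (π₀ : ∀ i, Equiv.Perm (Fin (N i))),
    |(Nat.card {f : Polynomial Fq // f.degree = (n : ℕ) ∧ (∀ i, eval f (F i) ≠ 0) ∧
        ∃ π : (∀ i, Equiv.Perm (Fin (N i))), IsConj π₀ π ∧
          ∀ i, ∃ e : Fin (N i) → K, Function.Injective e ∧ (∀ b, aeval (e b) (eval f (F i)) = 0) ∧
          (∀ b, e (π i b) = (e b) ^ Fintype.card Fq)} : ℝ) -
      (Nat.card {σ : L ≃ₐ[Ka] L // σ ∈ G1 ∧ ∃ π : (∀ i, Equiv.Perm (Fin (N i))), IsConj π₀ π ∧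
          ∀ i b, σ (y i b) = y i (π i b)} : ℝ) / (Nat.card {σ : L ≃ₐ[Ka] L // σ ∈ G1} : ℝ) *
            (Fintype.card Fq : ℝ) ^ (n + 1)| ≤ C0 * (Fintype.card Fq : ℝ) ^ n * √(Fintype.card Fq) := by
  obtain ⟨K0, hK0⟩ : ∃ K0, K0 = ∑ i, d i * (n + 1) := ⟨_, rfl⟩
  obtain ⟨g0, hg0⟩ : ∃ g0, g0 = (K0 + 1) ^ (K0 + 1) := ⟨_, rfl⟩
  obtain ⟨E, hE⟩ : ∃ E, E = K0 + g0 * g0 * K0 * K0 + 1 := ⟨_, rfl⟩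
  obtain ⟨Cc, hCc, hcheb⟩ := cheb n g0 E (by omega)
  obtain ⟨Dz, hDz⟩ : ∃ Dz, Dz = E * g0 * g0 + 1 + K0 + K0 * (K0 * K0) * g0 := ⟨_, rfl⟩
  refine ⟨Cc + Dz, ?_⟩
  intro Fq K L Ka _ _ _ _ _ _ _ _ _ _ _ _ _ _ _ _ _ F hd hF0 G1 hG1 N hN y hy0 hyinj hysurj hgen π₀
  classical
  have hinj := inj_BL (σ := Fin (n + 1)) (F := Fq) (L := L) Ka
  have hdK : ∀ i, d i * (n + 1) ≤ K0 := fun i => by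
    rw [hK0]; exact Finset.single_le_sum (f := fun i => d i * (n + 1)) (fun _ _ => Nat.zero_le _) (Finset.mem_univ i)
  have hcard : Fintype.card (Σ i, Fin (N i)) ≤ K0 := by
    rw [Fintype.card_sigma, hK0]
    refine Finset.sum_le_sum fun i _ => ?_
    rw [Fintype.card_fin, hN, ← hd]
    exact substF_natDegree n (F i)
  have hG : Nat.card (L ≃ₐ[Ka] L) ≤ g0 := by
    rw [hg0]; exact card_gal_le y hy0 hyinj hysurj hgen hcard
  -- the integral elements
  have hlc0 : ∀ i, (substF n (F i)).leadingCoeff ≠ 0 := fun i => leadingCoeff_ne_zero.2 (substF_ne_zero n (hF0 i))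
  have hlcL : ∀ i, algebraMap _ L (substF n (F i)).leadingCoeff ≠ 0 := fun i h =>
    hlc0 i (hinj (by rw [map_zero]; exact h))
  have hW : ∀ i b, algebraMap _ L (substF n (F i)).leadingCoeff * y i b ∈ Wt (Fin (n + 1)) Fq L K0 := by
    intro i b
    refine isFil_Wt.mono (hdK i) (lead_mul_root _ (fun k => ?_) hinj (hy0 i b))
    rw [← hd]; exact substF_coeff n (F i) k
  set u : ∀ i, Fin (N i) → integralClosure (MvPolynomial (Fin (n + 1)) Fq) L :=
    fun i b => ⟨_, isIntegral_of_mem_Wt (hW i b)⟩ with hu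
  have hu' : ∀ i b, (u i b : L) = algebraMap _ L (substF n (F i)).leadingCoeff * y i b := fun _ _ => rfl
  -- theta
  obtain ⟨θ, hθE, hθ⟩ := exists_theta (D := K0) (F := Fq) hG
    (fun k => ((u ((Fintype.equivFin (Σ i, Fin (N i))).symm k).1 ((Fintype.equivFin (Σ i, Fin (N i))).symm k).2 :
      integralClosure (MvPolynomial (Fin (n + 1)) Fq) L) : L))
    (fun k => hW _ _) (by
      intro g hg
      apply hgen
      intro i b
      obtain ⟨k, hk⟩ := (Fintype.equivFin (Σ i, Fin (N i))).symm.surjective ⟨i, b⟩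
      have h1 := hg k
      beta_reduce at h1
      rw [hk] at h1
      rw [hu', map_mul, IsScalarTower.algebraMap_apply (MvPolynomial (Fin (n + 1)) Fq) Ka L, AlgEquiv.commutes,
        ← IsScalarTower.algebraMap_apply (MvPolynomial (Fin (n + 1)) Fq) Ka L] at h1
      exact mul_left_cancel₀ (hlcL i) h1)
  have hθE' : θ ∈ Wt (Fin (n + 1)) Fq L E := by
    refine isFil_Wt.mono ?_ hθE
    rw [hE]
    have : g0 * g0 * Fintype.card (Σ i, Fin (N i)) * Fintype.card (Σ i, Fin (N i)) ≤ g0 * g0 * K0 * K0 := by gcongr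
    omega
  obtain ⟨ψ, s, b0, hb0, hb0d, hψ, hs, hT⟩ := hcheb Fq K L Ka G1 hG1 θ hG hθE' hθ
  have hT1 := hT {σ | ∃ π : (∀ i, Equiv.Perm (Fin (N i))), IsConj π₀ π ∧ ∀ i b, σ (y i b) = y i (π i b)}
    (fun g σ hσ => T_conj y hy0 hyinj hysurj π₀ g σ hσ)
  simp only [Set.mem_ofPred_eq] at hT1
  -- the discriminant
  set S : Finset ((Σ i, Fin (N i)) × (Σ i, Fin (N i))) := Finset.univ.filter fun x => x.1.1 = x.2.1 ∧ x.1 ≠ x.2 with hS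
  obtain ⟨bZ, hbZ, hbZd, hbZψ⟩ := disc_poly (K := K) Ka (D := K0) (M := K0 * K0) hG S (by
      refine (Finset.card_le_univ S).trans ?_
      rw [Fintype.card_prod]; gcongr)
    (fun x => u x.1.1 x.1.2 - u x.2.1 x.2.2)
    (fun x _ => by
      exact (Wt (Fin (n + 1)) Fq L K0).sub_mem (hW x.1.1 x.1.2) (hW x.2.1 x.2.2))
    (by
      rintro ⟨⟨i, b⟩, ⟨i', b'⟩⟩ hx
      obtain ⟨h1, h2⟩ := (Finset.mem_filter.1 hx).2
      simp only at h1
      subst h1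
      simp only [sub_ne_zero]
      intro h3
      have h4 := congrArg (Subtype.val) h3
      rw [hu', hu'] at h4
      exact h2 (by rw [hyinj i (mul_left_cancel₀ (hlcL i) h4)]))
  set Zt : MvPolynomial (Fin (n + 1)) Fq := b0 * MvPolynomial.X (Fin.last n) * (∏ i, (substF n (F i)).leadingCoeff) * bZ with hZt
  have hZ0 : Zt ≠ 0 := mul_ne_zero (mul_ne_zero (mul_ne_zero hb0 (MvPolynomial.X_ne_zero _))
    (Finset.prod_ne_zero_iff.2 fun i _ => hlc0 i)) hbZ
  have hZd : Zt.totalDegree ≤ Dz := by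
    rw [hZt, hDz]
    have h1 := MvPolynomial.totalDegree_mul (b0 * MvPolynomial.X (Fin.last n) * (∏ i, (substF n (F i)).leadingCoeff)) bZ
    have h2 := MvPolynomial.totalDegree_mul (b0 * MvPolynomial.X (Fin.last n)) (∏ i, (substF n (F i)).leadingCoeff)
    have h3 := MvPolynomial.totalDegree_mul b0 (MvPolynomial.X (Fin.last n))
    have h4 : (MvPolynomial.X (Fin.last n) : MvPolynomial (Fin (n + 1)) Fq).totalDegree = 1 := MvPolynomial.totalDegree_X _
    have h5 : (∏ i, (substF n (F i)).leadingCoeff).totalDegree ≤ K0 := by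
      rw [hK0]
      refine (MvPolynomial.totalDegree_finsetProd _ _).trans (Finset.sum_le_sum fun i _ => ?_)
      rw [← hd]; exact substF_coeff n (F i) _
    omega
  -- comparison
  have hcomp : ∀ a, ¬ (MvPolynomial.eval a Zt = 0) →
      ((a (Fin.last n) ≠ 0 ∧ (∀ i, eval (fa a) (F i) ≠ 0) ∧
        ∃ π : (∀ i, Equiv.Perm (Fin (N i))), IsConj π₀ π ∧
          ∀ i, ∃ e : Fin (N i) → K, Function.Injective e ∧ (∀ b, aeval (e b) (eval (fa a) (F i)) = 0) ∧
          (∀ b, e (π i b) = (e b) ^ Fintype.card Fq)) ↔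
      (MvPolynomial.eval a b0 ≠ 0 ∧ ∃ π : (∀ i, Equiv.Perm (Fin (N i))), IsConj π₀ π ∧
          ∀ i b, s a (y i b) = y i (π i b))) := by
    intro a ha
    rw [hZt, map_mul, map_mul, map_mul, MvPolynomial.eval_X, map_prod, mul_eq_zero, mul_eq_zero, mul_eq_zero, not_or, not_or, not_or,
      Finset.prod_eq_zero_iff] at ha
    obtain ⟨⟨⟨ha1, ha2⟩, ha3⟩, ha4⟩ := ha
    push Not at ha3
    have := point_equiv hF0 hN y hy0 hyinj hysurj π₀ a (ψ a) (hψ a) (s a) (hs a ha1) u hu' (fun i => ha3 i (Finset.mem_univ _))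
      (by
        intro i b b' hbb
        by_contra hne
        refine hbZψ a (ψ a) (hψ a) ha4 (⟨i, b⟩, ⟨i, b'⟩) ?_ ?_
        · rw [hS, Finset.mem_filter]
          refine ⟨Finset.mem_univ _, rfl, ?_⟩
          intro h
          exact hne (eq_of_heq (Sigma.mk.inj h).2)
        · rw [map_sub, sub_eq_zero]; exact hbb)
    constructor
    · rintro ⟨-, h⟩
      exact ⟨ha1, this.1 h⟩
    · rintro ⟨-, h⟩
      exact ⟨ha2, this.2 h⟩
  have hcc := card_compare _ _ _ hcomp
  rw [← Nat.card_congr (faEquiv n fun f => (∀ i, eval f (F i) ≠ 0) ∧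
        ∃ π : (∀ i, Equiv.Perm (Fin (N i))), IsConj π₀ π ∧
          ∀ i, ∃ e : Fin (N i) → K, Function.Injective e ∧ (∀ b, aeval (e b) (eval f (F i)) = 0) ∧
          (∀ b, e (π i b) = (e b) ^ Fintype.card Fq))] at hcc
  have hz : ((Finset.univ.filter fun a : Fin (n + 1) → Fq => MvPolynomial.eval a Zt = 0).card : ℝ) ≤
      Dz * (Fintype.card Fq : ℝ) ^ n * √(Fintype.card Fq) := by
    have h1 := (card_zeros Zt hZ0).trans (Nat.mul_le_mul_right _ hZd)
    have h2 : (1 : ℝ) ≤ √(Fintype.card Fq) := by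
      rw [Real.one_le_sqrt]
      exact_mod_cast Fintype.card_pos
    calc _ ≤ ((Dz * Fintype.card Fq ^ n : ℕ) : ℝ) := by exact_mod_cast h1
      _ = Dz * (Fintype.card Fq : ℝ) ^ n * 1 := by push_cast; ring
      _ ≤ _ := by gcongr
  refine (abs_sub_le _ _ _).trans ((add_le_add (hcc.trans hz) hT1).trans (le_of_eq ?_))
  ring

end FCE

set_option linter.unusedSectionVars false
namespace FCE

/-- A splitting field of a product of polynomials, each having as many roots as its degree, is Galois. -/
theorem isGalois_of_roots {Ka L : Type} [Field Ka] [Field L] [Algebra Ka L] {m : ℕ} (P : Fin m → Ka[X]) (Q : Ka[X])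
    (hQ : Q = ∏ i, P i) (hQ0 : Q ≠ 0) [IsSplittingField Ka L Q]
    (r : ∀ i, Fin (P i).natDegree ≃ (P i).rootSet L) : IsGalois Ka L := by
  classical
  have hfd : FiniteDimensional Ka L := IsSplittingField.finiteDimensional L Q
  have hP0 : ∀ i, P i ≠ 0 := fun i h => hQ0 (by rw [hQ]; exact Finset.prod_eq_zero (Finset.mem_univ i) h)
  have hsplit : ∀ i, ((P i).map (algebraMap Ka L)).Splits := fun i => by
    have h1 := IsSplittingField.splits L Q
    refine h1.of_dvd (Polynomial.map_ne_zero hQ0) (Polynomial.map_dvd _ ?_)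
    rw [hQ]; exact Finset.dvd_prod_of_mem _ (Finset.mem_univ i)
  have hsep : ∀ i, (P i).Separable := fun i => by
    rw [← card_rootSet_eq_natDegree_iff_of_splits (hP0 i) (hsplit i), ← Fintype.card_congr (r i), Fintype.card_fin]
  have hroots : ∀ x ∈ Q.rootSet L, IsSeparable Ka x := by
    intro x hx
    rw [mem_rootSet] at hx
    have h2 := hx.2
    rw [hQ, map_prod, Finset.prod_eq_zero_iff] at h2
    obtain ⟨i, -, hi⟩ := h2
    exact (hsep i).of_dvd (minpoly.dvd Ka x hi)
  have htop : IntermediateField.adjoin Ka (Q.rootSet L) = ⊤ := by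
    rw [← IntermediateField.toSubalgebra_injective.eq_iff, IntermediateField.top_toSubalgebra, eq_top_iff,
      ← IsSplittingField.adjoin_rootSet L Q]
    exact IntermediateField.algebra_adjoin_le_adjoin _ _
  have h1 := (IntermediateField.isSeparable_adjoin_iff_isSeparable Ka L).2 hroots
  rw [htop] at h1
  have hS : Algebra.IsSeparable Ka L := AlgEquiv.Algebra.isSeparable (IntermediateField.topEquiv (F := Ka) (E := L))
  have hN : Normal Ka L := Normal.of_isSplittingField Q
  exact ⟨⟩

theorem gen_of_roots {Ka L : Type} [Field Ka] [Field L] [Algebra Ka L] {m : ℕ} (P : Fin m → Ka[X]) (Q : Ka[X])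
    (hQ : Q = ∏ i, P i) [IsSplittingField Ka L Q] (g : L ≃ₐ[Ka] L)
    (hg : ∀ i z, z ∈ (P i).rootSet L → g z = z) : g = 1 := by
  have h1 : (g : L →ₐ[Ka] L) = AlgHom.id Ka L := by
    apply AlgHom.ext_of_adjoin_eq_top (IsSplittingField.adjoin_rootSet L Q)
    intro x hx
    rw [mem_rootSet] at hx
    have h2 := hx.2
    have hP0 : ∀ i, P i ≠ 0 := fun i h => hx.1 (by rw [hQ]; exact Finset.prod_eq_zero (Finset.mem_univ i) h)
    rw [hQ, map_prod, Finset.prod_eq_zero_iff] at h2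
    obtain ⟨i, -, hi⟩ := h2
    exact hg i x (mem_rootSet.2 ⟨hP0 i, hi⟩)
  ext x
  exact DFunLike.congr_fun h1 x

end FCE


/-- the explicit Chebotarev-type equidistribution theorem.  For fixed
`m`, total degrees `d_i` and `n`, there is `C` such that for any finite field `F_q`
and pairwise non-associate irreducible `F_i ∈ F_q[t][x]`, separable over `F_q(t)`,
`deg_x F_i > 0`, `deg F_i = d_i`, with `L` the splitting field of `∏ F_i(t,f♯)` over
`F_q(a_0,…,a_n)`, `G = Gal(L/F_q(a_0,…,a_n))` acting on the roots of the `F_i(t,f♯)`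
(viewed inside `∏ S_{N_i}` through enumerations `r_i` of the root sets), and `G₁` the
coset of `σ ∈ G` acting as the `q`-power Frobenius on the algebraic closure of `F_q`
in `L` (= the elements lying in finite subfields), for every conjugacy class `K` of
`S_{N_1} × … × S_{N_m}` (given by a representative `π₀`):
`|#{f : deg f = n, Θ(F_1(t,f),…,F_m(t,f)) = K} − (#(K ∩ G₁)/#G₁)·q^{n+1}|
  ≤ C q^{n+1/2}`, where `Θ(F_1(t,f),…,F_m(t,f)) = K` is expressed by the existence of
enumerations of the roots of the `F_i(t,f)` in `F̄_q` conjugating the `q`-power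
Frobenius to a member of `K`. -/
theorem frobenius_classes_equidistribution
    (m : ℕ) (hm : 1 ≤ m) (d : Fin m → ℕ) (n : ℕ) :
    ∃ C : ℝ, ∀ (Fq : Type) [Field Fq] [Fintype Fq],
      ∀ F : Fin m → Polynomial (Polynomial Fq),
        (∀ i, totalDeg (F i) = d i) →
        (∀ i, 0 < (F i).natDegree) →
        (∀ i j, i ≠ j → ¬ Associated (F i) (F j)) →
        (∀ i, Irreducible (F i)) →
        (∀ i, ∀ G : Polynomial (Polynomial Fq),
          F i ≠ G.comp (Polynomial.X ^ ringChar Fq)) →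
        let q := Fintype.card Fq
        let R := MvPolynomial (Fin (n + 1)) Fq
        let Ka := FractionRing R
        let Pprod : Polynomial Ka := (substF n (∏ i, F i)).map (algebraMap R Ka)
        let L := Pprod.SplittingField
        let Pi : Fin m → Polynomial Ka := fun i => (substF n (F i)).map (algebraMap R Ka)
        let N : Fin m → ℕ := fun i => (Pi i).natDegree
        -- `G₁`: the elements of the Galois group acting as the `q`-power Frobenius on
        -- the algebraic closure of `F_q` in `L`.
        let G1 : Set (L ≃ₐ[Ka] L) :=
          {σ | ∀ y : L, (∃ k : ℕ, 0 < k ∧ y ^ q ^ k = y) → σ y = y ^ q}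
        ∀ r : (∀ i, Fin (N i) ≃ (Pi i).rootSet L),
          ∀ π₀ : (∀ i, Equiv.Perm (Fin (N i))),
            |(Nat.card {f : Polynomial Fq // f.degree = (n : ℕ) ∧
                  (∀ i, Polynomial.eval f (F i) ≠ 0) ∧
                  ∃ π : (∀ i, Equiv.Perm (Fin (N i))), IsConj π₀ π ∧
                    ∀ i, ∃ e : Fin (N i) → AlgebraicClosure Fq,
                      Function.Injective e ∧
                      (∀ a, Polynomial.aeval (e a) (Polynomial.eval f (F i)) = 0) ∧
                      (∀ a, e (π i a) = (e a) ^ q)} : ℝ)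
                - ((Nat.card {σ : L ≃ₐ[Ka] L // σ ∈ G1 ∧
                      ∃ π : (∀ i, Equiv.Perm (Fin (N i))), IsConj π₀ π ∧
                        ∀ i a, σ (r i a : L) = (r i (π i a) : L)} : ℝ) /
                    (Nat.card {σ : L ≃ₐ[Ka] L // σ ∈ G1} : ℝ)) *
                  (q : ℝ) ^ (n + 1)|
              ≤ C * (q : ℝ) ^ n * Real.sqrt q := by
  obtain ⟨C, hC⟩ := FCE.main_gen m d n
  refine ⟨C, ?_⟩
  intro Fq _ _ F hd _ _ hirr _ q R Ka Pprod L Pi N G1 r π₀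
  have hF0 : ∀ i, F i ≠ 0 := fun i => (hirr i).ne_zero
  have hinj : Function.Injective (algebraMap R Ka) := IsFractionRing.injective R Ka
  have hPi0 : ∀ i, Pi i ≠ 0 := fun i =>
    (Polynomial.map_ne_zero_iff hinj).2 (FCE.substF_ne_zero n (hF0 i))
  have hQ : Pprod = ∏ i, Pi i := by
    simp only [Pprod, Pi]
    rw [FCE.substF_prod, Polynomial.map_prod]
  have hQ0 : Pprod ≠ 0 := by
    rw [hQ]; exact Finset.prod_ne_zero_iff.2 fun i _ => hPi0 i
  have hsf : Polynomial.IsSplittingField Ka L Pprod := Polynomial.IsSplittingField.splittingField Pprod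
  have hfd : FiniteDimensional Ka L := Polynomial.IsSplittingField.finiteDimensional L Pprod
  have hgal : IsGalois Ka L := FCE.isGalois_of_roots Pi Pprod hQ hQ0 r
  have hae : ∀ i (z : L), aeval z (Pi i) = aeval z (substF n (F i)) := fun i z => aeval_map_algebraMap Ka z _
  have hmem : ∀ i (z : L), z ∈ (Pi i).rootSet L ↔ aeval z (substF n (F i)) = 0 := by
    intro i z
    rw [mem_rootSet, hae]
    exact ⟨fun h => h.2, fun h => ⟨hPi0 i, h⟩⟩
  have hsurj : ∀ i (z : L), z ∈ (Pi i).rootSet L → ∃ b, (r i b : L) = z := fun i z hz => by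
    obtain ⟨b, hb⟩ := (r i).surjective ⟨z, hz⟩
    exact ⟨b, by rw [hb]⟩
  have hst : IsScalarTower Fq R L := by
    apply IsScalarTower.of_algebraMap_eq
    intro x
    rw [IsScalarTower.algebraMap_apply R Ka L, ← IsScalarTower.algebraMap_apply Fq R Ka,
      IsScalarTower.algebraMap_apply Fq Ka L]
  exact hC Fq (AlgebraicClosure Fq) L Ka F hd hF0 G1 rfl N
    (fun i => natDegree_map_eq_of_injective hinj _) (fun i b => (r i b : L))
    (fun i b => (hmem i _).1 (r i b).2) (fun i => Subtype.val_injective.comp (r i).injective)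
    (fun i z hz => hsurj i z ((hmem i z).2 hz))
    (fun g hg => FCE.gen_of_roots Pi Pprod hQ g fun i z hz => by
      obtain ⟨b, rfl⟩ := hsurj i z hz
      exact hg i b) π₀
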